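/- arXiv:1310.8102 — 2 statements merged into one kernel-verified Lean document; each statement's English description precedes it below -/
import Mathlib

section
/- Let 0 < q ≤ 2 and let (ℝⁿ, ‖·‖) be an n-dimensional normed space that embeds in L_q. Then (ℝⁿ, ‖·‖) embeds in L_{−p} for every p ∈ (0, n). -/
open MeasureTheory Metric Module
open scoped ENNReal FourierTransform RealInnerProductSpace Pointwise

noncomputable section

/-- `ℝⁿ` with its Euclidean structure. -/
abbrev Euc (n : ℕ) : Type := EuclideanSpace ℝ (Fin n)

/-- The radial function of a star body: the reciprocal of the Minkowski functional (gauge). -/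
def radialFn {n : ℕ} (K : Set (Euc n)) (x : Euc n) : ℝ := (gauge K x)⁻¹

/-- A star body: compact, the origin is interior, the Minkowski functional is continuous and
positive off the origin, and `K` is the unit ball of its Minkowski functional. -/
def IsStarBody {n : ℕ} (K : Set (Euc n)) : Prop :=
  IsCompact K ∧ (0 : Euc n) ∈ interior K ∧ Continuous (gauge K) ∧
    (∀ x : Euc n, x ≠ 0 → gauge K x ≠ 0) ∧ K = {x : Euc n | gauge K x ≤ 1}

/-- The Grassmannian of `d`-dimensional linear subspaces of `ℝⁿ`. -/
def Gr (n d : ℕ) : Type := {H : Submodule ℝ (Euc n) // finrank ℝ H = d}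

/-- The spherical Radon transform `R_{d} g (H) = ∫_{S^{n-1} ∩ H} g`, the integral being with
respect to the `(d-1)`-dimensional Hausdorff measure on the sphere of the `d`-dimensional
subspace `H`. -/
def sphRadon (n d : ℕ) (g : Euc n → ℝ) (H : Gr n d) : ℝ :=
  ∫ x in sphere (0 : Euc n) 1 ∩ (H.1 : Set (Euc n)), g x ∂μH[(d : ℝ) - 1]

/-- A generalized `m`-intersection body: an origin-symmetric star body `K` such that there is a
positive continuous (= bounded) linear functional `ν` on the range of the spherical Radon
transform `R_{n-m}` with `∫_{S^{n-1}} ‖x‖_K^{-m} g(x) dx = ν (R_{n-m} g)` for all continuous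
`g`. -/
def IsGenIntBody (n m : ℕ) (K : Set (Euc n)) : Prop :=
  IsStarBody K ∧ K = -K ∧
    ∃ ν : (Gr n (n - m) → ℝ) → ℝ,
      (∀ g₁ g₂ : Euc n → ℝ, Continuous g₁ → Continuous g₂ →
        ν (sphRadon n (n - m) (g₁ + g₂)) =
          ν (sphRadon n (n - m) g₁) + ν (sphRadon n (n - m) g₂)) ∧
      (∀ (c : ℝ) (g : Euc n → ℝ), Continuous g →
        ν (sphRadon n (n - m) (c • g)) = c * ν (sphRadon n (n - m) g)) ∧
      (∀ g : Euc n → ℝ, Continuous g → (∀ H, 0 ≤ sphRadon n (n - m) g H) →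
        0 ≤ ν (sphRadon n (n - m) g)) ∧
      (∃ C : ℝ, ∀ g : Euc n → ℝ, Continuous g →
        |ν (sphRadon n (n - m) g)| ≤ C * ⨆ H : Gr n (n - m), |sphRadon n (n - m) g H|) ∧
      (∀ g : Euc n → ℝ, Continuous g →
        (∫ x in sphere (0 : Euc n) 1, radialFn K x ^ m * g x ∂μH[(n : ℝ) - 1]) =
          ν (sphRadon n (n - m) g))

/-- `D` is the `k`-intersection body of `L`: `|D ∩ H^⊥| = |L ∩ H|` for every
`(n-k)`-dimensional subspace `H`. -/
def IsKIntBodyOf (n k : ℕ) (D L : Set (Euc n)) : Prop :=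
  ∀ H : Submodule ℝ (Euc n), finrank ℝ H = n - k →
    μH[(k : ℝ)] ((Hᗮ : Set (Euc n)) ∩ D) = μH[((n - k : ℕ) : ℝ)] ((H : Set (Euc n)) ∩ L)

/-- The class of `k`-intersection bodies: the closure in the radial metric of the class of
`k`-intersection bodies of star bodies. -/
def IsKIntBody (n k : ℕ) (D : Set (Euc n)) : Prop :=
  IsStarBody D ∧ ∀ ε : ℝ, 0 < ε → ∃ D' L : Set (Euc n),
    IsStarBody D' ∧ IsStarBody L ∧ IsKIntBodyOf n k D' L ∧
    ∀ ξ ∈ sphere (0 : Euc n) 1, |radialFn D ξ - radialFn D' ξ| ≤ ε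

/-- `K` is the intersection body of the star body `L` (Lutwak): the radius of `K` in every
direction equals the `(n-1)`-dimensional volume of the central hyperplane section of `L`
perpendicular to that direction. -/
def IsIntBodyOfStar (n : ℕ) (K L : Set (Euc n)) : Prop :=
  K = -K ∧ L = -L ∧ ∀ ξ ∈ sphere (0 : Euc n) 1,
    radialFn K ξ = (μH[((n - 1 : ℕ) : ℝ)] (((ℝ ∙ ξ)ᗮ : Set (Euc n)) ∩ L)).toReal

/-- The class of intersection bodies: the closure in the radial metric of the class of
intersection bodies of star bodies. -/
def IsIntersectionBody (n : ℕ) (K : Set (Euc n)) : Prop :=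
  IsStarBody K ∧ ∀ ε : ℝ, 0 < ε → ∃ K' L : Set (Euc n),
    IsStarBody K' ∧ IsStarBody L ∧ IsIntBodyOfStar n K' L ∧
    ∀ ξ ∈ sphere (0 : Euc n) 1, |radialFn K ξ - radialFn K' ξ| ≤ ε

/-- Geometric distance between star bodies. -/
def geomDist {n : ℕ} (K L : Set (Euc n)) : ℝ :=
  sInf {r : ℝ | 0 < r ∧ ∃ a : ℝ, 0 < a ∧ K ⊆ a • L ∧ a • L ⊆ r • K}

/-- Banach–Mazur distance. -/
def bmDist {n : ℕ} (K L : Set (Euc n)) : ℝ :=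
  ⨅ T : Euc n ≃ₗ[ℝ] Euc n, geomDist K (T '' L)

/-- Banach–Mazur distance from a body to a class of bodies. -/
def bmDistClass {n : ℕ} (L : Set (Euc n)) (P : Set (Euc n) → Prop) : ℝ :=
  sInf {r : ℝ | ∃ K, P K ∧ r = bmDist L K}

/-- Volume of the unit Euclidean ball `B_2^k` in `ℝ^k`. -/
def ballVol (k : ℕ) : ℝ := (volume (ball (0 : Euc k) 1)).toReal

/-- The constant `c_{n,m} = |B_2^n|^{(n-m)/n} / |B_2^{n-m}|`. -/
def cnm (n m : ℕ) : ℝ := ballVol n ^ (((n : ℝ) - m) / n) / ballVol (n - m)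

/-- The space `(ℝⁿ, N)` embeds in `L_{-p}`, `0 < p < n`. -/
def EmbedsInLNeg (n : ℕ) (p : ℝ) (N : Euc n → ℝ) : Prop :=
  ∃ μ : Measure (sphere (0 : Euc n) 1), IsFiniteMeasure μ ∧
    ∀ φ : SchwartzMap (Euc n) ℂ, (∀ x, φ (-x) = φ x) →
      (∫ x : Euc n, (N x ^ (-p)) • φ x) =
        ∫ θ : sphere (0 : Euc n) 1,
          (∫ t : ℝ, |t| ^ (p - 1) • 𝓕 (⇑φ) (t • (θ : Euc n))) ∂μ

/-- The space `(ℝⁿ, N)` embeds in `L_q`, `q > 0`: Lévy's representation of the norm. -/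
def EmbedsInLPos (n : ℕ) (q : ℝ) (N : Euc n → ℝ) : Prop :=
  ∃ μ : Measure (sphere (0 : Euc n) 1), IsFiniteMeasure μ ∧
    ∀ x : Euc n, N x ^ q = ∫ ξ : sphere (0 : Euc n) 1, |⟪x, (ξ : Euc n)⟫| ^ q ∂μ

/-- Embedding in `L_p` for `p ≠ 0` of either sign. -/
def EmbedsInL (n : ℕ) (p : ℝ) (N : Euc n → ℝ) : Prop :=
  if 0 < p then EmbedsInLPos n p N else EmbedsInLNeg n (-p) N

/-- `N` is a norm on `ℝⁿ`. -/
def IsNormOn (n : ℕ) (N : Euc n → ℝ) : Prop :=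
  (∀ x : Euc n, N x = 0 ↔ x = 0) ∧
  (∀ (c : ℝ) (x : Euc n), N (c • x) = |c| * N x) ∧
  (∀ x y : Euc n, N (x + y) ≤ N x + N y)

/-- The `L_p([0,1])` (quasi-)norm of an a.e.-equivalence class of functions on `[0,1]`. -/
def lpNormIcc (p : ℝ) (f : ℝ →ₘ[volume.restrict (Set.Icc (0 : ℝ) 1)] ℝ) : ℝ :=
  (eLpNorm f (ENNReal.ofReal p) (volume.restrict (Set.Icc (0 : ℝ) 1))).toReal

/-- `L` is the unit ball of an `n`-dimensional subspace of `L_p([0,1])`: there is an injective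
linear map `T` from `ℝⁿ` to (equivalence classes of) functions on `[0,1]` and `L` is the unit
ball of the norm `x ↦ ‖T x‖_p`. -/
def IsUnitBallOfLpSubspace (n : ℕ) (p : ℝ) (L : Set (Euc n)) : Prop :=
  ∃ T : Euc n →ₗ[ℝ] (ℝ →ₘ[volume.restrict (Set.Icc (0 : ℝ) 1)] ℝ),
    Function.Injective T ∧ L = {x : Euc n | lpNormIcc p (T x) ≤ 1}

open Set Filter Topology Real in
/-- The Lévy density of the symmetric `q`-stable law integrates `1 - cos` when `0 < q < 2`. -/
lemma integrableOn_rpow_mul_one_sub_cos {q : ℝ} (hq0 : 0 < q) (hq2 : q < 2) :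
    IntegrableOn (fun s : ℝ => s ^ (-1 - q) * (1 - cos s)) (Ioi 0) := by
  have hmeas : Measurable (fun s : ℝ => s ^ (-1 - q) * (1 - cos s)) := by fun_prop
  rw [← Ioc_union_Ioi_eq_Ioi zero_le_one]
  refine IntegrableOn.union ?_ ?_
  · have h1 : IntegrableOn (fun s : ℝ => s ^ (1 - q)) (Ioc 0 1) :=
      (intervalIntegrable_iff_integrableOn_Ioc_of_le zero_le_one).1
        (intervalIntegral.intervalIntegrable_rpow' (by linarith))
    refine h1.mono' hmeas.aestronglyMeasurable ?_
    filter_upwards [ae_restrict_mem measurableSet_Ioc] with s hs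
    have h2 : s ^ (1 - q) = s ^ (-1 - q) * s ^ 2 := by
      rw [← rpow_natCast s 2, ← rpow_add hs.1]; norm_num; ring_nf
    have h3 : 0 ≤ 1 - cos s := by linarith [cos_le_one s]
    have h4 := one_sub_sq_div_two_le_cos (x := s)
    have h5 : 0 ≤ s ^ (-1 - q) := rpow_nonneg hs.1.le _
    rw [norm_of_nonneg (by positivity), h2]
    gcongr
    nlinarith [sq_nonneg s]
  · have h1 : IntegrableOn (fun s : ℝ => s ^ (-1 - q) * 2) (Ioi 1) :=
      (integrableOn_Ioi_rpow_of_lt (by linarith) zero_lt_one).mul_const 2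
    refine h1.mono' hmeas.aestronglyMeasurable ?_
    filter_upwards [ae_restrict_mem measurableSet_Ioi] with s hs
    have h3 : 0 ≤ 1 - cos s := by linarith [cos_le_one s]
    have h5 : 0 ≤ s ^ (-1 - q) := rpow_nonneg (zero_le_one.trans hs.le) _
    rw [norm_of_nonneg (by positivity)]
    gcongr
    linarith [neg_one_le_cos s]

open Set Filter Topology Real in
lemma integral_rpow_mul_one_sub_cos_pos {q : ℝ} (hq0 : 0 < q) (hq2 : q < 2) :
    0 < ∫ s in Ioi (0 : ℝ), s ^ (-1 - q) * (1 - cos s) := by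
  have hnn : ∀ s ∈ Ioi (0 : ℝ), 0 ≤ s ^ (-1 - q) * (1 - cos s) := fun s hs =>
    mul_nonneg (rpow_nonneg (mem_Ioi.1 hs).le _) (by linarith [cos_le_one s])
  rw [setIntegral_pos_iff_support_of_nonneg_ae
    ((ae_restrict_iff' measurableSet_Ioi).2 (ae_of_all _ hnn))
    (integrableOn_rpow_mul_one_sub_cos hq0 hq2)]
  refine lt_of_lt_of_le ?_ (measure_mono (s := Ioo (0 : ℝ) 1) ?_)
  · simp
  · intro s hs
    refine ⟨?_, hs.1⟩
    have h1 : cos s < 1 := by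
      have := cos_lt_cos_of_nonneg_of_le_pi le_rfl (by linarith [pi_gt_three, hs.2]) hs.1
      simpa using this
    exact (mul_pos (rpow_pos_of_pos hs.1 _) (by linarith)).ne'

open Set Filter Topology Real in
lemma integral_rpow_mul_one_sub_cos_mul {q : ℝ} (hq0 : 0 < q) (t : ℝ) :
    ∫ s in Ioi (0 : ℝ), s ^ (-1 - q) * (1 - cos (t * s)) =
      |t| ^ q * ∫ s in Ioi (0 : ℝ), s ^ (-1 - q) * (1 - cos s) := by
  rcases eq_or_ne t 0 with rfl | ht
  · simp [zero_rpow hq0.ne']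
  have ht' : 0 < |t| := abs_pos.2 ht
  have h1 := integral_comp_mul_left_Ioi (fun s : ℝ => s ^ (-1 - q) * (1 - cos s)) 0 ht'
  rw [mul_zero, smul_eq_mul] at h1
  have h2 : ∫ s in Ioi (0 : ℝ), s ^ (-1 - q) * (1 - cos (t * s)) =
      ∫ s in Ioi (0 : ℝ), |t| ^ (1 + q) * ((|t| * s) ^ (-1 - q) * (1 - cos (|t| * s))) := by
    refine setIntegral_congr_fun measurableSet_Ioi fun s hs => ?_
    have h3 : cos (|t| * s) = cos (t * s) := by
      rw [← cos_abs (t * s), abs_mul, abs_of_pos (mem_Ioi.1 hs)]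
    have h4 : |t| ^ (1 + q) * |t| ^ (-1 - q) = 1 := by
      rw [← rpow_add ht']; ring_nf; exact rpow_zero _
    simp only [h3, mul_rpow ht'.le (mem_Ioi.1 hs).le]
    rw [← mul_assoc, ← mul_assoc, h4, one_mul]
  rw [h2, integral_const_mul, h1, rpow_add ht', rpow_one]
  field_simp

open Set Filter Topology Real in
lemma integrableOn_rpow_mul_one_sub_cos_mul {q : ℝ} (hq0 : 0 < q) (hq2 : q < 2) (t : ℝ) :
    IntegrableOn (fun s : ℝ => s ^ (-1 - q) * (1 - cos (t * s))) (Ioi 0) := by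
  rcases eq_or_ne t 0 with rfl | ht
  · simp
  · refine Integrable.of_integral_ne_zero ?_
    rw [integral_rpow_mul_one_sub_cos_mul hq0]
    exact (mul_pos (rpow_pos_of_pos (abs_pos.2 ht) _)
      (integral_rpow_mul_one_sub_cos_pos hq0 hq2)).ne'

open Set Filter Topology Real in
/-- For `0 < q ≤ 2`, the function `|t| ^ q` is the limit of `∫ (1 - cos (t s)) dκ(s)` for suitable
finite measures `κ`, from below. -/
lemma exists_tendsto_integral_one_sub_cos {q : ℝ} (hq0 : 0 < q) (hq2 : q ≤ 2) :
    ∃ κ : ℕ → Measure ℝ, (∀ m, IsFiniteMeasure (κ m)) ∧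
      (∀ m t, ∫ s, (1 - cos (t * s)) ∂κ m ≤ |t| ^ q) ∧
      ∀ t, Tendsto (fun m => ∫ s, (1 - cos (t * s)) ∂κ m) atTop (𝓝 (|t| ^ q)) := by
  rcases hq2.lt_or_eq with hq2 | rfl
  · set c : ℝ := ∫ s in Ioi (0 : ℝ), s ^ (-1 - q) * (1 - cos s) with hc
    have hc0 : 0 < c := integral_rpow_mul_one_sub_cos_pos hq0 hq2
    let a : ℕ → ℝ := fun m => 1 / ((m : ℝ) + 1)
    have ha : ∀ m, 0 < a m := fun m => Nat.one_div_pos_of_nat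
    have haU : ⋃ m, Ioi (a m) = Ioi 0 := by
      ext x
      simp only [mem_iUnion, mem_Ioi]
      exact ⟨fun ⟨m, hm⟩ => (ha m).trans hm, fun hx => exists_nat_one_div_lt hx⟩
    have hint : ∀ t : ℝ, IntegrableOn (fun s : ℝ => c⁻¹ * s ^ (-1 - q) * (1 - cos (t * s)))
        (Ioi 0) := fun t => by
      simpa only [mul_assoc, IntegrableOn] using
        (integrableOn_rpow_mul_one_sub_cos_mul hq0 hq2 t).const_mul c⁻¹
    have hval : ∀ t : ℝ, ∫ s in Ioi (0 : ℝ), c⁻¹ * s ^ (-1 - q) * (1 - cos (t * s)) =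
        |t| ^ q := fun t => by
      simp only [mul_assoc]
      rw [integral_const_mul, integral_rpow_mul_one_sub_cos_mul hq0, ← hc]
      field_simp
    let κ : ℕ → Measure ℝ := fun m =>
      (volume.restrict (Ioi (a m))).withDensity fun s => ENNReal.ofReal (c⁻¹ * s ^ (-1 - q))
    have hκ : ∀ m t, ∫ s, (1 - cos (t * s)) ∂κ m =
        ∫ s in Ioi (a m), c⁻¹ * s ^ (-1 - q) * (1 - cos (t * s)) := fun m t => by
      simp only [κ]
      rw [integral_withDensity_eq_integral_toReal_smul (by fun_prop) (by simp)]
      refine setIntegral_congr_fun measurableSet_Ioi fun s hs => ?_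
      have hs0 : 0 < s := (ha m).trans hs
      simp only [smul_eq_mul]
      rw [ENNReal.toReal_ofReal (by positivity)]
    refine ⟨κ, fun m => ?_, fun m t => ?_, fun t => ?_⟩
    · exact isFiniteMeasure_withDensity_ofReal
        ((integrableOn_Ioi_rpow_of_lt (by linarith) (ha m)).const_mul c⁻¹).2
    · rw [hκ, ← hval t]
      refine setIntegral_mono_set (hint t) ?_ (Ioi_subset_Ioi (ha m).le).eventuallyLE
      filter_upwards [ae_restrict_mem measurableSet_Ioi] with s hs
      have hs0 : (0 : ℝ) < s := hs
      have h3 : 0 ≤ 1 - cos (t * s) := by linarith [cos_le_one (t * s)]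
      simp only [Pi.zero_apply]
      positivity
    · simp only [hκ]
      rw [← hval t, ← haU]
      refine tendsto_setIntegral_of_monotone (fun _ => measurableSet_Ioi) ?_ ?_
      · intro m k hmk
        refine Ioi_subset_Ioi ?_
        simp only [a]
        gcongr
      · rw [haU]; exact hint t
  · let M : ℕ → ℝ := fun m => (m : ℝ) + 1
    have hM : ∀ m, 0 < M m := fun m => by positivity
    have hMt : Tendsto M atTop atTop :=
      tendsto_atTop_add_const_right _ _ tendsto_natCast_atTop_atTop
    have hval : ∀ m t, ∫ s, (1 - cos (t * s)) ∂(ENNReal.ofReal (2 * M m ^ 2) •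
        Measure.dirac (1 / M m)) = 2 * M m ^ 2 * (1 - cos (t / M m)) := fun m t => by
      rw [integral_smul_measure, integral_dirac, ENNReal.toReal_ofReal (by positivity),
        smul_eq_mul, mul_one_div]
    have habs : ∀ t : ℝ, |t| ^ (2 : ℝ) = t ^ 2 := fun t => by
      rw [rpow_two, sq_abs]
    refine ⟨fun m => ENNReal.ofReal (2 * M m ^ 2) • Measure.dirac (1 / M m), fun m => ?_,
      fun m t => ?_, fun t => ?_⟩
    · exact Measure.smul_finite _ ENNReal.ofReal_ne_top
    · rw [hval, habs]
      have h1 := one_sub_sq_div_two_le_cos (x := t / M m)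
      have h2 : M m ^ 2 * (t / M m) ^ 2 = t ^ 2 := by
        have := (hM m).ne'
        field_simp
      nlinarith [sq_nonneg (M m)]
    · simp only [hval, habs]
      have h0 : Tendsto (fun m => t ^ 4 / M m ^ 2) atTop (𝓝 0) :=
        tendsto_const_nhds.div_atTop ((tendsto_pow_atTop two_ne_zero).comp hMt)
      rw [tendsto_iff_norm_sub_tendsto_zero]
      refine squeeze_zero' (Eventually.of_forall fun _ => norm_nonneg _) ?_ h0
      filter_upwards [hMt.eventually_ge_atTop |t|] with m hm
      have hm0 := hM m
      have h1 : |t / M m| ≤ 1 := by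
        rw [abs_div, abs_of_pos hm0]
        exact (div_le_one hm0).2 hm
      have h2 := cos_bound h1
      have h3 : 2 * M m ^ 2 * (1 - cos (t / M m)) - t ^ 2 =
          -(2 * M m ^ 2 * (cos (t / M m) - (1 - (t / M m) ^ 2 / 2))) := by
        field_simp
        ring
      rw [h3, norm_neg, norm_mul, norm_of_nonneg (by positivity : 0 ≤ 2 * M m ^ 2), norm_eq_abs]
      calc 2 * M m ^ 2 * |cos (t / M m) - (1 - (t / M m) ^ 2 / 2)|
          ≤ 2 * M m ^ 2 * (|t / M m| ^ 4 * (5 / 96)) := by gcongr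
        _ = (5 / 48) * (t ^ 4 / M m ^ 2) := by
          rw [(by decide : Even 4).pow_abs]
          field_simp
          ring
        _ ≤ t ^ 4 / M m ^ 2 := by
          have : 0 ≤ t ^ 4 / M m ^ 2 := by positivity
          linarith

lemma norm_cexp_neg_mul_norm_sq {V : Type*} [NormedAddCommGroup V]
    (b : ℝ) (v : V) :
    ‖Complex.exp (-b * ‖v‖ ^ 2)‖ = Real.exp (-b * ‖v‖ ^ 2) := by
  rw [Complex.norm_exp]
  congr 1
  norm_cast

lemma charFun_ofReal_smul {V : Type*} [NormedAddCommGroup V] [InnerProductSpace ℝ V]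
    [MeasurableSpace V] (ν : Measure V) {a : ℝ} (ha : 0 ≤ a) (v : V) :
    charFun (ENNReal.ofReal a • ν) v = a * charFun ν v := by
  rw [charFun_apply, integral_smul_measure, ENNReal.toReal_ofReal ha, charFun_apply,
    Complex.real_smul]

lemma charFun_add_measure {V : Type*} [NormedAddCommGroup V] [InnerProductSpace ℝ V]
    [MeasurableSpace V] [BorelSpace V] (μ ν : Measure V) [IsFiniteMeasure μ]
    [IsFiniteMeasure ν] (v : V) :
    charFun (μ + ν) v = charFun μ v + charFun ν v := by
  have h : ∀ (ρ : Measure V) [IsFiniteMeasure ρ],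
      Integrable (fun x => Complex.exp (⟪x, v⟫ * Complex.I)) ρ := fun ρ _ =>
    (integrable_const (1 : ℝ)).mono'
      (by fun_prop : Continuous fun x : V => Complex.exp (⟪x, v⟫ * Complex.I)).aestronglyMeasurable
      (ae_of_all _ fun x => by rw [Complex.norm_exp_ofReal_mul_I])
  simp only [charFun_apply]
  exact integral_add_measure (h μ) (h ν)

section GaussianPositivity

variable {V : Type*} [NormedAddCommGroup V] [InnerProductSpace ℝ V] [FiniteDimensional ℝ V]
  [MeasurableSpace V] [BorelSpace V]

/-- A function is Gaussian-positive if the Fourier transforms of its products with centred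
Gaussians have non-negative real part. For continuous bounded functions this is a form of positive
definiteness that is evidently stable under bounded pointwise limits. -/
def GaussianPositive (f : V → ℂ) : Prop :=
  ∀ b : ℝ, 0 < b → ∀ w : V,
    0 ≤ (𝓕 (fun v : V => f v * Complex.exp (-b * ‖v‖ ^ 2)) w).re

lemma integrable_cexp_neg_mul_norm_sq {b : ℝ} (hb : 0 < b) :
    Integrable (fun v : V => Complex.exp (-b * ‖v‖ ^ 2)) := by
  simpa using GaussianFourier.integrable_cexp_neg_mul_sq_norm_add (V := V)
    (b := (b : ℂ)) (by simpa using hb) 0 0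

open Filter Topology in
lemma GaussianPositive.of_tendsto {F : ℕ → V → ℂ} {f : V → ℂ}
    (hF : ∀ m, GaussianPositive (F m)) (hmeas : ∀ m, AEStronglyMeasurable (F m))
    {C : ℝ} (hC : ∀ m v, ‖F m v‖ ≤ C)
    (hlim : ∀ v, Tendsto (fun m => F m v) atTop (𝓝 (f v))) :
    GaussianPositive f := by
  intro b hb w
  have key : Tendsto (fun m => (𝓕 (fun v : V => F m v * Complex.exp (-b * ‖v‖ ^ 2)) w).re) atTop
      (𝓝 (𝓕 (fun v : V => f v * Complex.exp (-b * ‖v‖ ^ 2)) w).re) := by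
    refine (Complex.continuous_re.tendsto _).comp ?_
    simp only [Real.fourier_eq]
    refine tendsto_integral_of_dominated_convergence
      (fun v => C * ‖Complex.exp (-b * ‖v‖ ^ 2)‖) (fun m => ?_)
      ((integrable_cexp_neg_mul_norm_sq hb).norm.const_mul C)
      (fun m => ae_of_all _ fun v => ?_) (ae_of_all _ fun v => ?_)
    · have h1 : Continuous fun v : V => Real.fourierChar (-⟪v, w⟫) := by fun_prop
      exact h1.aestronglyMeasurable.smul ((hmeas m).mul
        (by fun_prop : Continuous fun v : V => Complex.exp (-b * ‖v‖ ^ 2)).aestronglyMeasurable)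
    · rw [Circle.norm_smul, norm_mul]
      gcongr
      exact hC m v
    · exact ((hlim v).mul_const _).const_smul _
  exact ge_of_tendsto' key fun m => hF m b hb w

open Filter Topology in
lemma GaussianPositive.re_fourier_nonneg {f : V → ℂ} (hf : GaussianPositive f)
    (hint : Integrable f) (w : V) : 0 ≤ (𝓕 f w).re := by
  let b : ℕ → ℝ := fun m => 1 / ((m : ℝ) + 1)
  have hb : ∀ m, 0 < b m := fun m => Nat.one_div_pos_of_nat
  have key : Tendsto (fun m => (𝓕 (fun v : V => f v * Complex.exp (-b m * ‖v‖ ^ 2)) w).re) atTop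
      (𝓝 (𝓕 f w).re) := by
    refine (Complex.continuous_re.tendsto _).comp ?_
    simp only [Real.fourier_eq]
    refine tendsto_integral_of_dominated_convergence
      (fun v => ‖f v‖) (fun m => ?_) hint.norm
      (fun m => ae_of_all _ fun v => ?_) (ae_of_all _ fun v => ?_)
    · have h1 : Continuous fun v : V => Real.fourierChar (-⟪v, w⟫) := by fun_prop
      exact h1.aestronglyMeasurable.smul (hint.1.mul
        (by fun_prop : Continuous fun v : V => Complex.exp (-b m * ‖v‖ ^ 2)).aestronglyMeasurable)
    · rw [Circle.norm_smul, norm_mul, norm_cexp_neg_mul_norm_sq]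
      refine mul_le_of_le_one_right (norm_nonneg _) (Real.exp_le_one_iff.2 ?_)
      have := hb m
      nlinarith [sq_nonneg ‖v‖]
    · have h1 : Tendsto (fun m => Complex.exp (-b m * ‖v‖ ^ 2)) atTop (𝓝 1) := by
        have h2 : Continuous fun s : ℝ => Complex.exp (-s * ‖v‖ ^ 2) := by fun_prop
        have h3 := (h2.tendsto 0).comp tendsto_one_div_add_atTop_nhds_zero_nat
        simpa [b, Function.comp_def] using h3
      have h4 := (h1.const_mul (f v)).const_smul (Real.fourierChar (-⟪v, w⟫))
      rwa [mul_one] at h4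
  exact ge_of_tendsto' key fun m => hf (b m) (hb m) w

lemma gaussianPositive_charFun (ν : Measure V) [IsFiniteMeasure ν] :
    GaussianPositive (charFun ν) := by
  intro b hb w
  have hint : Integrable (Function.uncurry fun v x : V =>
      Real.fourierChar (-⟪v, w⟫) • (Complex.exp (⟪x, v⟫ * Complex.I) *
        Complex.exp (-b * ‖v‖ ^ 2))) (volume.prod ν) := by
    have h1 := (integrable_cexp_neg_mul_norm_sq (V := V) hb).norm.comp_fst ν
    refine h1.mono' ?_ (ae_of_all _ fun z => ?_)
    · refine Continuous.aestronglyMeasurable ?_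
      unfold Function.uncurry
      fun_prop
    · simp only [Function.uncurry]
      rw [Circle.norm_smul, norm_mul, Complex.norm_exp_ofReal_mul_I, one_mul]
  have hswap : 𝓕 (fun v : V => charFun ν v * Complex.exp (-b * ‖v‖ ^ 2)) w =
      ∫ x, 𝓕 (fun v : V => Complex.exp (-b * ‖v‖ ^ 2 +
        2 * Real.pi * Complex.I * ⟪(2 * Real.pi)⁻¹ • x, v⟫)) w ∂ν := by
    simp only [Real.fourier_eq, charFun_apply]
    calc _ = ∫ v, ∫ x, Real.fourierChar (-⟪v, w⟫) • (Complex.exp (⟪x, v⟫ * Complex.I) *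
        Complex.exp (-b * ‖v‖ ^ 2)) ∂ν := by
          congr 1 with v
          simp only [Circle.smul_def, smul_eq_mul]
          rw [← integral_mul_const, integral_const_mul]
      _ = _ := by
          rw [integral_integral_swap hint]
          congr 1 with x
          congr 1 with v
          rw [← Complex.exp_add, real_inner_smul_left]
          congr 2
          have : (Real.pi : ℂ) ≠ 0 := by exact_mod_cast Real.pi_ne_zero
          push_cast
          field_simp
          ring
  rw [hswap]
  have hval : ∀ x : V, 𝓕 (fun v : V => Complex.exp (-b * ‖v‖ ^ 2 +
        2 * Real.pi * Complex.I * ⟪(2 * Real.pi)⁻¹ • x, v⟫)) w =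
      (((Real.pi / b) ^ (finrank ℝ V / 2 : ℝ) *
        Real.exp (-Real.pi ^ 2 * ‖(2 * Real.pi)⁻¹ • x - w‖ ^ 2 / b) : ℝ) : ℂ) := fun x => by
    rw [fourier_gaussian_innerProductSpace' (by simpa using hb)]
    push_cast
    rw [Complex.ofReal_cpow (by positivity)]
    push_cast
    rfl
  simp only [hval]
  rw [integral_complex_ofReal, Complex.ofReal_re]
  exact integral_nonneg fun x => by positivity

lemma exists_charFun_eq_pow (ν : Measure V) [IsFiniteMeasure ν] (k : ℕ) :
    ∃ ρ : Measure V, IsFiniteMeasure ρ ∧ ∀ v, charFun ρ v = charFun ν v ^ k := by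
  induction k with
  | zero => exact ⟨Measure.dirac 0, inferInstance, fun v => by simp⟩
  | succ k ih =>
    obtain ⟨ρ, hρ, h⟩ := ih
    exact ⟨ρ.conv ν, inferInstance, fun v => by rw [charFun_conv, h, pow_succ]⟩

open Filter Topology in
/-- Compound Poisson characteristic functions are Gaussian-positive. -/
lemma gaussianPositive_exp_charFun_sub (Λ : Measure V) [IsFiniteMeasure Λ] :
    GaussianPositive fun v => Complex.exp (charFun Λ v - Λ.real Set.univ) := by
  set L := Λ.real Set.univ with hL
  obtain ⟨K, hK⟩ := exists_nat_gt L
  let ρ : ℕ → Measure V := fun m =>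
    ENNReal.ofReal (1 - L / (m + K : ℕ)) • Measure.dirac 0 + ENNReal.ofReal (1 / (m + K : ℕ)) • Λ
  have hρfin : ∀ m, IsFiniteMeasure (ρ m) := fun m => by
    have := Measure.smul_finite (Measure.dirac (0 : V))
      (ENNReal.ofReal_ne_top (r := 1 - L / (m + K : ℕ)))
    have := Measure.smul_finite Λ (ENNReal.ofReal_ne_top (r := 1 / (m + K : ℕ)))
    simp only [ρ]
    infer_instance
  have hL0 : 0 ≤ L := measureReal_nonneg
  have hK0 : (0 : ℝ) < K := hL0.trans_lt hK
  have hmK : ∀ m : ℕ, L / (m + K : ℕ) ≤ 1 := fun m => by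
    have : (0 : ℝ) ≤ m := m.cast_nonneg
    rw [div_le_one (by push_cast; linarith)]
    push_cast
    linarith
  have hρ : ∀ m v, charFun (ρ m) v = 1 + (charFun Λ v - L) / (m + K : ℕ) := fun m v => by
    have := Measure.smul_finite (Measure.dirac (0 : V))
      (ENNReal.ofReal_ne_top (r := 1 - L / (m + K : ℕ)))
    have := Measure.smul_finite Λ (ENNReal.ofReal_ne_top (r := 1 / (m + K : ℕ)))
    simp only [ρ]
    rw [charFun_add_measure, charFun_ofReal_smul _ (by linarith [hmK m]),
      charFun_ofReal_smul _ (by positivity), charFun_dirac]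
    simp only [inner_zero_left, Complex.ofReal_zero, zero_mul, Complex.exp_zero]
    push_cast
    ring
  choose σ hσ hσρ using fun m => exists_charFun_eq_pow (ρ m) (m + K)
  refine GaussianPositive.of_tendsto (F := fun m => charFun (σ m)) (C := 1)
    (fun m => gaussianPositive_charFun (σ m))
    (fun m => stronglyMeasurable_charFun.aestronglyMeasurable) (fun m v => ?_) (fun v => ?_)
  · refine (norm_charFun_le v).trans (le_of_eq ?_)
    have h1 : ((σ m).real Set.univ : ℂ) = 1 := by
      rw [← charFun_zero, hσρ, hρ, charFun_zero, ← hL]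
      simp
    exact_mod_cast h1
  · have h1 := (Complex.tendsto_one_add_div_pow_exp (charFun Λ v - L)).comp
      (tendsto_add_atTop_nat K)
    refine h1.congr fun m => ?_
    rw [hσρ, hρ]
    rfl

lemma gaussianPositive_exp_integral_cos_sub_one (Λ : Measure V) [IsFiniteMeasure Λ] :
    GaussianPositive fun v => (Real.exp (∫ x, (Real.cos ⟪v, x⟫ - 1) ∂Λ) : ℂ) := by
  let Λs : Measure V := ENNReal.ofReal (1 / 2) • (Λ + Λ.map ((-1 : ℝ) • ·))
  have : IsFiniteMeasure Λs := Measure.smul_finite _ ENNReal.ofReal_ne_top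
  have hch : ∀ v, charFun Λs v = (∫ x, Real.cos ⟪v, x⟫ ∂Λ : ℝ) := fun v => by
    simp only [Λs]
    rw [charFun_ofReal_smul _ (by norm_num), charFun_add_measure, charFun_map_smul,
      neg_one_smul, charFun_neg, Complex.add_conj, charFun_apply]
    have h1 : (∫ x, Complex.exp (⟪x, v⟫ * Complex.I) ∂Λ).re = ∫ x, Real.cos ⟪v, x⟫ ∂Λ := by
      have h2 : Integrable (fun x => Complex.exp (⟪x, v⟫ * Complex.I)) Λ :=
        (integrable_const (1 : ℝ)).mono' (by
          fun_prop : Continuous fun x : V =>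
            Complex.exp (⟪x, v⟫ * Complex.I)).aestronglyMeasurable
          (ae_of_all _ fun x => by rw [Complex.norm_exp_ofReal_mul_I])
      rw [← RCLike.re_eq_complex_re, ← integral_re h2]
      congr 1 with x
      rw [RCLike.re_eq_complex_re, Complex.exp_ofReal_mul_I_re, real_inner_comm]
    rw [h1]
    push_cast
    ring
  have htot : Λs.real Set.univ = Λ.real Set.univ := by
    have h1 := hch 0
    rw [charFun_zero] at h1
    simpa using h1
  have h := gaussianPositive_exp_charFun_sub Λs
  convert h using 2 with v
  have hcos : Integrable (fun x => Real.cos ⟪v, x⟫) Λ :=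
    (integrable_const (1 : ℝ)).mono'
      (by fun_prop : Continuous fun x : V => Real.cos ⟪v, x⟫).aestronglyMeasurable
      (ae_of_all _ fun x => Real.abs_cos_le_one _)
  rw [hch, htot, integral_sub hcos (integrable_const 1)]
  simp

open Filter Topology in
/-- If `0 < q ≤ 2`, then the exponential of minus a Lévy representation with exponent `q` is
Gaussian-positive. -/
lemma gaussianPositive_exp_neg_integral_rpow {q : ℝ} (hq0 : 0 < q) (hq2 : q ≤ 2)
    (μ : Measure (sphere (0 : V) 1)) [IsFiniteMeasure μ] :
    GaussianPositive fun v =>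
      (Real.exp (-∫ ξ : sphere (0 : V) 1, |⟪v, (ξ : V)⟫| ^ q ∂μ) : ℂ) := by
  obtain ⟨κ, hκ, hκle, hκlim⟩ := exists_tendsto_integral_one_sub_cos hq0 hq2
  let Φ : sphere (0 : V) 1 × ℝ → V := fun z => z.2 • (z.1 : V)
  have hΦ : Continuous Φ := by fun_prop
  let Λ : ℕ → Measure V := fun m => (μ.prod (κ m)).map Φ
  have hΛ : ∀ m v, ∫ x, (Real.cos ⟪v, x⟫ - 1) ∂Λ m =
      -∫ ξ : sphere (0 : V) 1, ∫ s, (1 - Real.cos (⟪v, (ξ : V)⟫ * s)) ∂κ m ∂μ := fun m v => by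
    simp only [Λ]
    rw [integral_map hΦ.aemeasurable
      (by fun_prop : Continuous fun x : V => Real.cos ⟪v, x⟫ - 1).aestronglyMeasurable,
      integral_prod _ ?_]
    · rw [← integral_neg]
      congr 1 with ξ
      rw [← integral_neg]
      congr 1 with s
      simp only [Φ]
      rw [real_inner_smul_right, neg_sub, mul_comm s]
    · refine (integrable_const (2 : ℝ)).mono' (Continuous.aestronglyMeasurable (by fun_prop))
        (ae_of_all _ fun z => ?_)
      rw [Real.norm_eq_abs, abs_le]
      constructor <;> linarith [Real.neg_one_le_cos ⟪v, Φ z⟫, Real.cos_le_one ⟪v, Φ z⟫]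
  refine GaussianPositive.of_tendsto
    (F := fun m v => (Real.exp (∫ x, (Real.cos ⟪v, x⟫ - 1) ∂Λ m) : ℂ)) (C := 1)
    (fun m => gaussianPositive_exp_integral_cos_sub_one (Λ m)) (fun m => ?_) (fun m v => ?_)
    (fun v => ?_)
  · have h1 : StronglyMeasurable fun v => ∫ x, (Real.cos ⟪v, x⟫ - 1) ∂Λ m :=
      StronglyMeasurable.integral_prod_right'
        (f := fun z : V × V => Real.cos ⟪z.1, z.2⟫ - 1)
        (Continuous.stronglyMeasurable (by fun_prop))
    exact (Complex.continuous_ofReal.comp_stronglyMeasurable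
      (Real.continuous_exp.comp_stronglyMeasurable h1)).aestronglyMeasurable
  · rw [Complex.norm_real, Real.norm_of_nonneg (Real.exp_nonneg _), Real.exp_le_one_iff]
    exact integral_nonpos fun x => by
      simpa using Real.cos_le_one ⟪v, x⟫
  · simp only [hΛ]
    refine (Complex.continuous_ofReal.tendsto _).comp ((Real.continuous_exp.tendsto _).comp
      (Tendsto.neg ?_))
    refine tendsto_integral_of_dominated_convergence (fun _ => ‖v‖ ^ q) (fun m => ?_)
      (integrable_const _) (fun m => ae_of_all _ fun ξ => ?_)
      (ae_of_all _ fun ξ => hκlim ⟪v, (ξ : V)⟫)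
    · exact (StronglyMeasurable.integral_prod_right'
        (f := fun z : sphere (0 : V) 1 × ℝ => 1 - Real.cos (⟪v, (z.1 : V)⟫ * z.2))
        (Continuous.stronglyMeasurable (by fun_prop))).aestronglyMeasurable
    · rw [Real.norm_of_nonneg (integral_nonneg fun s => by simpa using Real.cos_le_one _)]
      refine (hκle m _).trans (Real.rpow_le_rpow (abs_nonneg _) ?_ hq0.le)
      simpa using abs_real_inner_le_norm v (ξ : V)

end GaussianPositivity

section MellinScaling

open Set

lemma integral_comp_abs_eq_two_smul {E : Type*} [NormedAddCommGroup E] [NormedSpace ℝ E]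
    {f : ℝ → E} (hf : IntegrableOn f (Ioi 0)) :
    ∫ t, f |t| = (2 : ℝ) • ∫ t in Ioi (0 : ℝ), f t := by
  have heq : EqOn (fun t => f |t|) f (Ioi 0) := fun t ht => by
    simp only [abs_of_pos (mem_Ioi.1 ht)]
  have hpos : IntegrableOn (fun t => f |t|) (Ioi 0) := hf.congr_fun heq.symm measurableSet_Ioi
  have hneg : IntegrableOn (fun t => f |t|) (Iic 0) := by
    let m : MeasurableEmbedding fun t : ℝ => -t := (Homeomorph.neg ℝ).measurableEmbedding
    rw [← Measure.map_neg_eq_self (volume : Measure ℝ)]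
    rw [m.integrableOn_map_iff]
    simp_rw [Function.comp_def, abs_neg, neg_preimage, neg_Iic, neg_zero]
    exact (integrableOn_Ici_iff_integrableOn_Ioi).2 hpos
  rw [← setIntegral_univ, ← Iic_union_Ioi (a := (0 : ℝ)),
    setIntegral_union (Iic_disjoint_Ioi le_rfl) measurableSet_Ioi hneg hpos, two_smul]
  congr 1
  · have h := integral_comp_neg_Iic 0 f
    rw [neg_zero] at h
    rw [← h]
    exact setIntegral_congr_fun measurableSet_Iic fun t ht => by
      simp only [abs_of_nonpos (mem_Iic.1 ht)]
  · exact setIntegral_congr_fun measurableSet_Ioi heq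

lemma rpow_sub_one_eq_mul_mul_rpow {a : ℝ} (ha : 0 < a) (p : ℝ) {u : ℝ} (hu : 0 < u) :
    u ^ (p - 1) = a ^ (1 - p) * (a * u) ^ (p - 1) := by
  have h : a ^ (1 - p) * a ^ (p - 1) = 1 := by
    rw [← Real.rpow_add ha]; ring_nf; exact Real.rpow_zero _
  rw [Real.mul_rpow ha.le hu.le, ← mul_assoc, h, one_mul]

lemma integral_rpow_smul_comp_mul_Ioi {E : Type*} [NormedAddCommGroup E] [NormedSpace ℝ E]
    (p : ℝ) {a : ℝ} (ha : 0 < a) (F : ℝ → E) :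
    ∫ u in Ioi (0 : ℝ), u ^ (p - 1) • F (a * u) =
      a ^ (-p) • ∫ t in Ioi (0 : ℝ), t ^ (p - 1) • F t := by
  have h1 := integral_comp_mul_left_Ioi (fun t : ℝ => t ^ (p - 1) • F t) 0 ha
  rw [mul_zero] at h1
  have h2 : ∫ u in Ioi (0 : ℝ), u ^ (p - 1) • F (a * u) =
      ∫ u in Ioi (0 : ℝ), a ^ (1 - p) • ((a * u) ^ (p - 1) • F (a * u)) :=
    setIntegral_congr_fun measurableSet_Ioi fun u hu => by
      simp only [smul_smul]
      rw [← rpow_sub_one_eq_mul_mul_rpow ha p hu]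
  rw [h2, integral_smul, h1, smul_smul, ← Real.rpow_neg_one a, ← Real.rpow_add ha]
  ring_nf

lemma integrableOn_rpow_smul_comp_mul_Ioi {E : Type*} [NormedAddCommGroup E] [NormedSpace ℝ E]
    {p : ℝ} {a : ℝ} (ha : 0 < a) {F : ℝ → E}
    (hF : IntegrableOn (fun t : ℝ => t ^ (p - 1) • F t) (Ioi 0)) :
    IntegrableOn (fun u : ℝ => u ^ (p - 1) • F (a * u)) (Ioi 0) := by
  have h1 : IntegrableOn (fun u : ℝ => (a * u) ^ (p - 1) • F (a * u)) (Ioi 0) := by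
    rw [integrableOn_Ioi_comp_mul_left_iff (fun t : ℝ => t ^ (p - 1) • F t) 0 ha, mul_zero]
    exact hF
  refine IntegrableOn.congr_fun (h1.smul (a ^ (1 - p))) (fun u hu => ?_) measurableSet_Ioi
  simp only [Pi.smul_apply, smul_smul]
  rw [← rpow_sub_one_eq_mul_mul_rpow ha p hu]

/-- Joint integrability of a Mellin-type kernel `u ^ (p - 1) F(a(x) u) ρ(x)`. -/
lemma integrable_uncurry_rpow_mul_comp_mul {X : Type*} [MeasurableSpace X] {μ : Measure X}
    [SFinite μ] {p : ℝ} {F : ℝ → ℝ} (hFm : Measurable F)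
    (hF : IntegrableOn (fun t : ℝ => t ^ (p - 1) • F t) (Ioi 0)) {a : X → ℝ} (ham : Measurable a)
    (ha : ∀ᵐ x ∂μ, 0 < a x) {ρ : X → ℂ} (hρm : AEStronglyMeasurable ρ μ)
    (hρ : Integrable (fun x => a x ^ (-p) * ‖ρ x‖) μ) :
    Integrable (Function.uncurry fun x u => (u ^ (p - 1) * F (a x * u)) • ρ x)
      (μ.prod (volume.restrict (Ioi (0 : ℝ)))) := by
  have hmeas : AEStronglyMeasurable (Function.uncurry fun x u =>
      (u ^ (p - 1) * F (a x * u)) • ρ x) (μ.prod (volume.restrict (Ioi (0 : ℝ)))) := by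
    have h1 : Measurable fun z : X × ℝ => z.2 ^ (p - 1) * F (a z.1 * z.2) := by fun_prop
    exact h1.aestronglyMeasurable.smul hρm.comp_fst
  rw [integrable_prod_iff hmeas]
  refine ⟨?_, ?_⟩
  · filter_upwards [ha] with x hx
    exact (integrableOn_rpow_smul_comp_mul_Ioi hx hF).smul_const (ρ x)
  · refine (hρ.mul_const (∫ t in Ioi (0 : ℝ), t ^ (p - 1) • ‖F t‖)).congr ?_
    filter_upwards [ha] with x hx
    have h1 := integral_rpow_smul_comp_mul_Ioi p hx fun t => ‖F t‖
    rw [mul_right_comm, ← smul_eq_mul (a x ^ (-p)), ← h1, ← integral_mul_const]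
    refine setIntegral_congr_fun measurableSet_Ioi fun u hu => ?_
    simp only [Function.uncurry, norm_smul, norm_mul, smul_eq_mul,
      Real.norm_of_nonneg (Real.rpow_nonneg (mem_Ioi.1 hu).le _)]

lemma integrableOn_rpow_smul_exp_neg_rpow {p q : ℝ} (hp : 0 < p) (hq : 0 < q) :
    IntegrableOn (fun t : ℝ => t ^ (p - 1) • Real.exp (-t ^ q)) (Ioi 0) ∧
      ∫ t in Ioi (0 : ℝ), t ^ (p - 1) • Real.exp (-t ^ q) = 1 / q * Real.Gamma (p / q) := by
  have h := integral_rpow_mul_exp_neg_rpow hq (by linarith : -1 < p - 1)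
  rw [sub_add_cancel] at h
  refine ⟨Integrable.of_integral_ne_zero ?_, h⟩
  simp only [smul_eq_mul, h]
  have := Real.Gamma_pos_of_pos (div_pos hp hq)
  positivity

lemma integrableOn_rpow_mul_inv_one_add_pow {p : ℝ} (hp : 0 < p) {k : ℕ} (hk : p < k) :
    IntegrableOn (fun t : ℝ => t ^ (p - 1) • (1 + t ^ k)⁻¹) (Ioi 0) := by
  have hmeas : Measurable fun t : ℝ => t ^ (p - 1) • (1 + t ^ k)⁻¹ := by fun_prop
  rw [← Ioc_union_Ioi_eq_Ioi zero_le_one]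
  refine IntegrableOn.union ?_ ?_
  · have h1 : IntegrableOn (fun t : ℝ => t ^ (p - 1)) (Ioc 0 1) :=
      (intervalIntegrable_iff_integrableOn_Ioc_of_le zero_le_one).1
        (intervalIntegral.intervalIntegrable_rpow' (by linarith))
    refine h1.mono' hmeas.aestronglyMeasurable ?_
    filter_upwards [ae_restrict_mem measurableSet_Ioc] with t ht
    have ht0 : 0 < t := ht.1
    rw [smul_eq_mul, Real.norm_of_nonneg (by positivity)]
    refine mul_le_of_le_one_right (by positivity) (inv_le_one_of_one_le₀ ?_)
    have : 0 ≤ t ^ k := by positivity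
    linarith
  · have h1 : IntegrableOn (fun t : ℝ => t ^ (p - 1 - k)) (Ioi 1) :=
      integrableOn_Ioi_rpow_of_lt (by linarith) zero_lt_one
    refine h1.mono' hmeas.aestronglyMeasurable ?_
    filter_upwards [ae_restrict_mem measurableSet_Ioi] with t ht
    have ht0 : (0 : ℝ) < t := zero_lt_one.trans ht
    have h2 : t ^ (p - 1 - (k : ℝ)) = t ^ (p - 1) * (t ^ k)⁻¹ := by
      rw [Real.rpow_sub ht0 (p - 1), Real.rpow_natCast, div_eq_mul_inv]
    rw [smul_eq_mul, Real.norm_of_nonneg (by positivity), h2]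
    gcongr
    linarith

end MellinScaling

section RadialIntegrability

variable {V : Type*} [NormedAddCommGroup V] [InnerProductSpace ℝ V] [FiniteDimensional ℝ V]
  [MeasurableSpace V] [BorelSpace V]

lemma integrable_norm_rpow_neg_mul_norm {p : ℝ} (hp0 : 0 < p) (hp : p < finrank ℝ V)
    {f : V → ℂ} (hf : Integrable f) {C : ℝ} (hC : ∀ x, ‖f x‖ ≤ C) :
    Integrable fun x => ‖x‖ ^ (-p) * ‖f x‖ := by
  have hd : 1 ≤ finrank ℝ V := by
    have h : (0 : ℝ) < finrank ℝ V := hp0.trans hp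
    exact_mod_cast h
  have hmeas : AEStronglyMeasurable fun x : V => ‖x‖ ^ (-p) * ‖f x‖ :=
    (by fun_prop : Measurable fun x : V => ‖x‖ ^ (-p)).aestronglyMeasurable.mul hf.1.norm
  rw [← integrableOn_univ, ← Set.union_compl_self (ball (0 : V) 1)]
  refine IntegrableOn.union ?_ ?_
  · refine integrableOn_ball_of_norm_le_rpow hd (C := C) hp (ae_of_all _ fun x => ?_) hmeas
    rw [norm_mul, norm_norm, Real.norm_of_nonneg (by positivity), mul_comm]
    gcongr
    exact hC x
  · refine (hf.norm.integrableOn (s := (ball (0 : V) 1)ᶜ)).mono' hmeas.restrict ?_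
    filter_upwards [ae_restrict_mem measurableSet_ball.compl] with x hx
    have hx1 : 1 ≤ ‖x‖ := by simpa using hx
    rw [norm_mul, norm_norm, Real.norm_of_nonneg (by positivity)]
    exact mul_le_of_le_one_left (norm_nonneg _)
      (Real.rpow_le_one_of_one_le_of_nonpos hx1 (by linarith))

lemma integrable_exp_neg_mul_norm_rpow (hd : 1 ≤ finrank ℝ V) {c q : ℝ} (hc : 0 < c)
    (hq : 0 < q) : Integrable fun x : V => Real.exp (-(c * ‖x‖) ^ q) := by
  have : Nontrivial V := nontrivial_of_finrank_pos (R := ℝ) hd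
  rw [integrable_fun_norm_addHaar volume (f := fun t => Real.exp (-(c * t) ^ q))]
  have hd' : (0 : ℝ) < finrank ℝ V := by exact_mod_cast hd
  refine (integrableOn_rpow_smul_comp_mul_Ioi hc
    (integrableOn_rpow_smul_exp_neg_rpow hd' hq).1).congr_fun (fun t _ => ?_) measurableSet_Ioi
  simp only
  rw [← Real.rpow_natCast, Nat.cast_sub hd, Nat.cast_one]

lemma integral_comp_smul_mul_fourier {g ψ : V → ℂ} (hg : Integrable g) (hψ : Integrable ψ)
    {u : ℝ} (hu : 0 < u) :
    ∫ x, g (u • x) * 𝓕 ψ x = ∫ y, 𝓕 g y * ψ (u • y) := by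
  have h1 : ∀ x, 𝓕 (fun y => ψ (u • y)) x =
      |(u ^ finrank ℝ V)⁻¹| • 𝓕 ψ (u⁻¹ • x) := fun x => by
    rw [Real.fourier_eq, Real.fourier_eq, ← Measure.integral_comp_smul]
    refine integral_congr_ae (ae_of_all _ fun y => ?_)
    simp only [real_inner_smul_left, real_inner_smul_right]
    rw [inv_mul_cancel_left₀ hu.ne']
  have h2 := Measure.integral_comp_smul (volume : Measure V)
    (fun x => g x * 𝓕 ψ (u⁻¹ • x)) u
  simp only [smul_smul, inv_mul_cancel₀ hu.ne', one_smul] at h2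
  rw [h2, ← integral_smul]
  have hψu : Integrable fun y => ψ (u • y) := hψ.comp_smul hu.ne'
  have h3 : ∫ y, 𝓕 g y * ψ (u • y) = ∫ x, g x * 𝓕 (fun y => ψ (u • y)) x := by
    simpa using! (VectorFourier.integral_fourierIntegral_smul_eq_flip (L := innerₗ V)
      Real.continuous_fourierChar continuous_inner hg hψu)
  rw [h3]
  refine integral_congr_ae (ae_of_all _ fun x => ?_)
  simp only [h1, mul_smul_comm]

end RadialIntegrability

section NegativePowers

variable {V : Type*} [NormedAddCommGroup V] [InnerProductSpace ℝ V]

/-- A continuous, even, positively homogeneous function which is bounded below by a multiple of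
the Euclidean norm. -/
structure IsGaugeLike (N : V → ℝ) (c : ℝ) : Prop where
  continuous : Continuous N
  pos : 0 < c
  le : ∀ x, c * ‖x‖ ≤ N x
  smul : ∀ u : ℝ, 0 < u → ∀ x, N (u • x) = u * N x
  neg : ∀ x, N (-x) = N x

namespace IsGaugeLike

variable {N : V → ℝ} {c : ℝ}

lemma apply_nonneg (hN : IsGaugeLike N c) (x : V) : 0 ≤ N x :=
  (mul_nonneg hN.pos.le (norm_nonneg x)).trans (hN.le x)

lemma apply_pos (hN : IsGaugeLike N c) {x : V} (hx : x ≠ 0) : 0 < N x :=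
  (mul_pos hN.pos (norm_pos_iff.2 hx)).trans_le (hN.le x)

end IsGaugeLike

/-- The Mellin transform along the ray through `y` in terms of the unit direction of `y`. -/
lemma integral_rpow_smul_comp_smul (p : ℝ) (ψ : V → ℂ) {y : V} (hy : y ≠ 0) :
    ∫ u in Set.Ioi (0 : ℝ), u ^ (p - 1) • ψ (u • y) =
      ‖y‖ ^ (-p) • ∫ t in Set.Ioi (0 : ℝ), t ^ (p - 1) • ψ (t • (‖y‖⁻¹ • y)) := by
  rw [← integral_rpow_smul_comp_mul_Ioi p (norm_pos_iff.2 hy)]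
  refine integral_congr_ae (ae_of_all _ fun u => ?_)
  simp only [smul_smul]
  rw [mul_right_comm, mul_inv_cancel₀ (norm_ne_zero_iff.2 hy), one_mul]

lemma SchwartzMap.exists_norm_le_mul_inv_one_add_pow (f : SchwartzMap V ℂ) (k : ℕ) :
    ∃ D : ℝ, ∀ z, ‖f z‖ ≤ D * (1 + ‖z‖ ^ k)⁻¹ := by
  obtain ⟨C₀, -, h0⟩ := f.decay 0 0
  obtain ⟨C₁, -, h1⟩ := f.decay k 0
  refine ⟨C₀ + C₁, fun z => ?_⟩
  have h0 := h0 z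
  have h1 := h1 z
  simp only [pow_zero, one_mul, norm_iteratedFDeriv_zero] at h0 h1
  have h2 : 0 < 1 + ‖z‖ ^ k := by positivity
  rw [← div_eq_mul_inv, le_div_iff₀ h2]
  linarith

/-- The Mellin transform of a decaying function along a ray. -/
def rayMellin (p : ℝ) (ψ : V → ℂ) (θ : V) : ℂ :=
  ∫ t in Set.Ioi (0 : ℝ), t ^ (p - 1) • ψ (t • θ)

lemma integral_abs_rpow_smul_eq_rayMellin [MeasurableSpace V] [BorelSpace V] {p : ℝ}
    (hp0 : 0 < p) {ψ : V → ℂ}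
    (hψ : Continuous ψ)
    (hψe : ∀ x, ψ (-x) = ψ x) {D : ℝ} {k : ℕ} (hk : p < k)
    (hD : ∀ z, ‖ψ z‖ ≤ D * (1 + ‖z‖ ^ k)⁻¹) {θ : V} (hθ : ‖θ‖ = 1) :
    ∫ t : ℝ, |t| ^ (p - 1) • ψ (t • θ) = (2 : ℝ) • rayMellin p ψ θ := by
  have h1 : IntegrableOn (fun t : ℝ => t ^ (p - 1) • ψ (t • θ)) (Set.Ioi 0) := by
    have hm : Measurable fun t : ℝ => t ^ (p - 1) • ψ (t • θ) := by
      have := hψ.measurable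
      fun_prop
    refine ((integrableOn_rpow_mul_inv_one_add_pow hp0 hk).const_mul D).mono'
      hm.aestronglyMeasurable ?_
    filter_upwards [ae_restrict_mem measurableSet_Ioi] with t ht
    have ht0 : (0 : ℝ) < t := ht
    have h2 := hD (t • θ)
    rw [norm_smul, hθ, mul_one, Real.norm_of_nonneg ht0.le] at h2
    rw [norm_smul, Real.norm_of_nonneg (Real.rpow_nonneg ht0.le _), smul_eq_mul, mul_left_comm]
    gcongr
  rw [rayMellin, ← integral_comp_abs_eq_two_smul h1]
  refine integral_congr_ae (ae_of_all _ fun t => ?_)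
  rcases abs_choice t with h | h <;> simp only [h, neg_smul, hψe]

variable [FiniteDimensional ℝ V] [MeasurableSpace V] [BorelSpace V]

namespace IsGaugeLike

variable {N : V → ℝ} {c : ℝ}

lemma integrable_exp_neg_rpow (hN : IsGaugeLike N c) (hd : 1 ≤ finrank ℝ V) {q : ℝ} (hq : 0 < q) :
    Integrable fun x => (Real.exp (-N x ^ q) : ℂ) := by
  suffices h : Integrable fun x => Real.exp (-N x ^ q) from h.ofReal
  have hm : Measurable fun x => Real.exp (-N x ^ q) := by
    have := hN.continuous.measurable
    fun_prop
  refine (integrable_exp_neg_mul_norm_rpow hd hN.pos hq).mono' hm.aestronglyMeasurable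
    (ae_of_all _ fun x => ?_)
  rw [Real.norm_of_nonneg (Real.exp_pos _).le]
  have h0 : 0 ≤ c * ‖x‖ := mul_nonneg hN.pos.le (norm_nonneg x)
  gcongr
  exact hN.le x

lemma integrable_rpow_neg_mul_norm (hN : IsGaugeLike N c) {p : ℝ} (hp0 : 0 < p)
    (hp : p < finrank ℝ V) {f : V → ℂ} (hf : Integrable f) {C : ℝ} (hC : ∀ x, ‖f x‖ ≤ C) :
    Integrable fun x => N x ^ (-p) * ‖f x‖ := by
  have hd : 1 ≤ finrank ℝ V := by
    have h : (0 : ℝ) < finrank ℝ V := hp0.trans hp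
    exact_mod_cast h
  have : Nontrivial V := nontrivial_of_finrank_pos (R := ℝ) hd
  have hm : Measurable fun x => N x ^ (-p) := by
    have := hN.continuous.measurable
    fun_prop
  refine ((integrable_norm_rpow_neg_mul_norm hp0 hp hf hC).const_mul (c ^ (-p))).mono'
    (hm.aestronglyMeasurable.mul hf.1.norm) ?_
  filter_upwards [Measure.ae_ne volume (0 : V)] with x hx
  have h0 : 0 < c * ‖x‖ := mul_pos hN.pos (norm_pos_iff.2 hx)
  rw [norm_mul, norm_norm, Real.norm_of_nonneg (Real.rpow_nonneg (hN.apply_nonneg x) _),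
    ← mul_assoc, ← Real.mul_rpow hN.pos.le (norm_nonneg x)]
  exact mul_le_mul_of_nonneg_right
    (Real.rpow_le_rpow_of_nonpos h0 (hN.le x) (neg_nonpos.2 hp0.le)) (norm_nonneg _)

variable {p q : ℝ}

/-- Joint integrability behind the Mellin representation of `N ^ (-p)`. -/
lemma integrable_uncurry_mellin (hN : IsGaugeLike N c) (hp0 : 0 < p) (hp : p < finrank ℝ V)
    (hq : 0 < q) {φ : V → ℂ} (hφ : Integrable φ) {C : ℝ} (hC : ∀ x, ‖φ x‖ ≤ C) :
    Integrable (Function.uncurry fun x u => (u ^ (p - 1) * Real.exp (-(N x * u) ^ q)) • φ x)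
      (volume.prod (volume.restrict (Set.Ioi (0 : ℝ)))) := by
  have hd : 1 ≤ finrank ℝ V := by
    have h : (0 : ℝ) < finrank ℝ V := hp0.trans hp
    exact_mod_cast h
  have : Nontrivial V := nontrivial_of_finrank_pos (R := ℝ) hd
  refine integrable_uncurry_rpow_mul_comp_mul (F := fun t => Real.exp (-t ^ q)) (by fun_prop)
    (integrableOn_rpow_smul_exp_neg_rpow hp0 hq).1 hN.continuous.measurable ?_ hφ.1
    (hN.integrable_rpow_neg_mul_norm hp0 hp hφ hC)
  filter_upwards [Measure.ae_ne volume (0 : V)] with x hx using hN.apply_pos hx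

lemma integral_mellin_inner (hN : IsGaugeLike N c) (φ : V → ℂ) {u : ℝ} (hu : 0 < u) :
    ∫ x, (u ^ (p - 1) * Real.exp (-(N x * u) ^ q)) • φ x =
      u ^ (p - 1) • ∫ x, (Real.exp (-N (u • x) ^ q) : ℂ) * φ x := by
  rw [← integral_smul]
  refine integral_congr_ae (ae_of_all _ fun x => ?_)
  simp only [hN.smul u hu, mul_smul, mul_comm u]
  rw [Complex.real_smul (x := Real.exp _)]

lemma integrableOn_mellin (hN : IsGaugeLike N c) (hp0 : 0 < p) (hp : p < finrank ℝ V)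
    (hq : 0 < q) {φ : V → ℂ} (hφ : Integrable φ) {C : ℝ} (hC : ∀ x, ‖φ x‖ ≤ C) :
    IntegrableOn (fun u : ℝ => u ^ (p - 1) • ∫ x, (Real.exp (-N (u • x) ^ q) : ℂ) * φ x)
      (Set.Ioi 0) := by
  refine (hN.integrable_uncurry_mellin hp0 hp hq hφ hC).integral_prod_right.congr ?_
  filter_upwards [ae_restrict_mem measurableSet_Ioi] with u hu
  exact hN.integral_mellin_inner φ hu

/-- The Mellin representation of `N ^ (-p)` as a superposition of the functions `exp (-(uN)^q)`. -/
lemma integral_rpow_neg_smul (hN : IsGaugeLike N c) (hp0 : 0 < p) (hp : p < finrank ℝ V)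
    (hq : 0 < q) {φ : V → ℂ} (hφ : Integrable φ) {C : ℝ} (hC : ∀ x, ‖φ x‖ ≤ C) :
    (1 / q * Real.Gamma (p / q)) • ∫ x, N x ^ (-p) • φ x =
      ∫ u in Set.Ioi (0 : ℝ), u ^ (p - 1) • ∫ x, (Real.exp (-N (u • x) ^ q) : ℂ) * φ x := by
  have hd : 1 ≤ finrank ℝ V := by
    have h : (0 : ℝ) < finrank ℝ V := hp0.trans hp
    exact_mod_cast h
  have : Nontrivial V := nontrivial_of_finrank_pos (R := ℝ) hd
  rw [← setIntegral_congr_fun measurableSet_Ioi fun u hu => hN.integral_mellin_inner φ hu,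
    ← integral_integral_swap (hN.integrable_uncurry_mellin hp0 hp hq hφ hC), ← integral_smul]
  refine integral_congr_ae ?_
  filter_upwards [Measure.ae_ne volume (0 : V)] with x hx
  have h1 := integral_rpow_smul_comp_mul_Ioi p (hN.apply_pos hx) fun t => Real.exp (-t ^ q)
  rw [(integrableOn_rpow_smul_exp_neg_rpow hp0 hq).2] at h1
  simp only [smul_eq_mul] at h1
  rw [integral_smul_const, h1, smul_smul, mul_comm]

end IsGaugeLike

lemma continuous_fourier_of_integrable {f : V → ℂ} (hf : Integrable f) : Continuous (𝓕 f) :=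
  VectorFourier.fourierIntegral_continuous (L := innerₗ V) Real.continuous_fourierChar
    continuous_inner hf

lemma norm_fourier_le_integral_norm (f : V → ℂ) (y : V) : ‖𝓕 f y‖ ≤ ∫ x, ‖f x‖ :=
  VectorFourier.norm_fourierIntegral_le_integral_norm Real.fourierChar volume (innerₗ V) f y

lemma fourier_cexp_neg_pi_mul_norm_sq :
    𝓕 (fun v : V => Complex.exp (-Real.pi * ‖v‖ ^ 2)) =
      fun v : V => Complex.exp (-Real.pi * ‖v‖ ^ 2) := by
  ext w
  have hpi : (Real.pi : ℂ) ≠ 0 := by exact_mod_cast Real.pi_ne_zero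
  rw [fourier_gaussian_innerProductSpace (b := (Real.pi : ℂ)) (by simpa using Real.pi_pos),
    div_self hpi, Complex.one_cpow, one_mul]
  congr 1
  field_simp

lemma IsGaugeLike.integrable_rpow_mul_fourier {N : V → ℝ} {c p q : ℝ} (hN : IsGaugeLike N c)
    (hp0 : 0 < p) (hp : p < finrank ℝ V) (hq : 0 < q) {G : V → ℝ}
    (hG : ∀ y, 𝓕 (fun x => (Real.exp (-N x ^ q) : ℂ)) y = G y) (hG0 : ∀ y, 0 ≤ G y) :
    Integrable fun y => ‖y‖ ^ (-p) * G y := by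
  have hd : 1 ≤ finrank ℝ V := by
    have h : (0 : ℝ) < finrank ℝ V := hp0.trans hp
    exact_mod_cast h
  have : Nontrivial V := nontrivial_of_finrank_pos (R := ℝ) hd
  have hg := hN.integrable_exp_neg_rpow hd hq
  set g : V → ℂ := fun x => (Real.exp (-N x ^ q) : ℂ) with hgdef
  set γ : V → ℂ := fun v => Complex.exp (-Real.pi * ‖v‖ ^ 2) with hγdef
  have hγ : Integrable γ := integrable_cexp_neg_mul_norm_sq Real.pi_pos
  have hγreal : ∀ v, γ v = (Real.exp (-Real.pi * ‖v‖ ^ 2) : ℂ) := fun v => by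
    simp only [hγdef]; push_cast; rfl
  have hγ1 : ∀ v, ‖γ v‖ ≤ 1 := fun v => by
    rw [hγdef, norm_cexp_neg_mul_norm_sq]
    exact Real.exp_le_one_iff.2 (by have := Real.pi_pos; nlinarith [sq_nonneg ‖v‖])
  have hGre : G = fun y => (𝓕 g y).re := by
    ext y; rw [hG, Complex.ofReal_re]
  have hGc : Continuous G := by
    rw [hGre]
    exact Complex.continuous_re.comp (continuous_fourier_of_integrable hg)
  have hGb : ∀ y, ‖G y‖ ≤ ∫ x, ‖g x‖ := fun y => by
    rw [← Complex.norm_real, ← hG]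
    exact norm_fourier_le_integral_norm g y
  set H : V → ℝ → ℝ := fun y u => (u ^ (p - 1) * Real.exp (-Real.pi * (‖y‖ * u) ^ (2 : ℝ))) * G y
  have hHm : Measurable (Function.uncurry H) := by
    have := hGc.measurable
    have : Measurable fun z : V × ℝ =>
      (z.2 ^ (p - 1) * Real.exp (-Real.pi * (‖z.1‖ * z.2) ^ (2 : ℝ))) * G z.1 := by fun_prop
    exact this
  have hHu : ∀ u ∈ Set.Ioi (0 : ℝ), ∀ y,
      H y u = u ^ (p - 1) * (G y * Real.exp (-Real.pi * ‖u • y‖ ^ 2)) := fun u hu y => by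
    simp only [H, norm_smul, Real.norm_of_nonneg (Set.mem_Ioi.1 hu).le, mul_comm u, Real.rpow_two]
    ring
  have hHint : Integrable (Function.uncurry H)
      (volume.prod (volume.restrict (Set.Ioi (0 : ℝ)))) := by
    rw [integrable_prod_iff' hHm.aestronglyMeasurable]
    refine ⟨?_, ?_⟩
    · filter_upwards [ae_restrict_mem measurableSet_Ioi] with u hu
      have h1 : Integrable fun y : V => Real.exp (-Real.pi * ‖u • y‖ ^ 2) := by
        have := (hγ.comp_smul (Set.mem_Ioi.1 hu).ne').norm
        simpa only [hγdef, norm_cexp_neg_mul_norm_sq] using this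
      refine ((h1.bdd_mul hGc.aestronglyMeasurable (ae_of_all _ hGb)).const_mul
        (u ^ (p - 1))).congr (ae_of_all _ fun y => ?_)
      exact (hHu u hu y).symm
    · refine (hN.integrableOn_mellin hp0 hp hq hγ hγ1).norm.congr ?_
      filter_upwards [ae_restrict_mem measurableSet_Ioi] with u hu
      have hu0 : 0 < u := hu
      have h2 := integral_comp_smul_mul_fourier hg hγ hu0
      rw [show 𝓕 γ = γ from fourier_cexp_neg_pi_mul_norm_sq] at h2
      rw [h2]
      have h3 : ∫ y, 𝓕 g y * γ (u • y) =
          ((∫ y, G y * Real.exp (-Real.pi * ‖u • y‖ ^ 2) : ℝ) : ℂ) := by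
        rw [← integral_complex_ofReal]
        refine integral_congr_ae (ae_of_all _ fun y => ?_)
        simp only [hG, hγreal, Complex.ofReal_mul]
      rw [h3, norm_smul, Complex.norm_real, Real.norm_of_nonneg (Real.rpow_nonneg hu0.le _),
        Real.norm_of_nonneg (integral_nonneg fun y => mul_nonneg (hG0 y) (Real.exp_pos _).le),
        ← integral_const_mul]
      refine integral_congr_ae (ae_of_all _ fun y => ?_)
      simp only [Function.uncurry]
      rw [hHu u hu y, Real.norm_of_nonneg]
      have := hG0 y
      positivity
  obtain ⟨K, hKpos, hK⟩ : ∃ K : ℝ, 0 < K ∧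
      ∫ t in Set.Ioi (0 : ℝ), t ^ (p - 1) * Real.exp (-Real.pi * t ^ (2 : ℝ)) = K := by
    refine ⟨_, ?_, integral_rpow_mul_exp_neg_mul_rpow two_pos (by linarith) Real.pi_pos⟩
    have := Real.Gamma_pos_of_pos (s := (p - 1 + 1) / 2) (by linarith)
    have := Real.pi_pos
    positivity
  refine (hHint.integral_prod_left.mul_const K⁻¹).congr ?_
  filter_upwards [Measure.ae_ne volume (0 : V)] with y hy
  have h4 := integral_rpow_smul_comp_mul_Ioi p (norm_pos_iff.2 hy)
    fun t => Real.exp (-Real.pi * t ^ (2 : ℝ))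
  simp only [smul_eq_mul] at h4
  rw [hK] at h4
  simp only [Function.uncurry, H]
  rw [integral_mul_const, h4]
  field_simp

lemma exists_measure_sphere_integral_eq [Nontrivial V] {w : V → ℝ} (hw : Integrable w)
    (hw0 : ∀ y, 0 ≤ w y) :
    ∃ μ : Measure (sphere (0 : V) 1), IsFiniteMeasure μ ∧ ∀ J : V → ℂ, StronglyMeasurable J →
      ∫ θ : sphere (0 : V) 1, J θ ∂μ = ∫ y, w y • J (‖y‖⁻¹ • y) := by
  classical
  obtain ⟨ξ, hξ⟩ : (sphere (0 : V) 1).Nonempty := NormedSpace.sphere_nonempty.2 zero_le_one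
  set d : V → V := fun y => if y = 0 then ξ else ‖y‖⁻¹ • y with hd
  have hdm : Measurable d :=
    Measurable.ite (measurableSet_singleton (0 : V)) measurable_const (by fun_prop)
  have hds : ∀ y, d y ∈ sphere (0 : V) 1 := fun y => by
    by_cases hy : y = 0
    · simpa only [hd, hy, if_true] using hξ
    · simp only [hd, hy, if_false, mem_sphere_zero_iff_norm, norm_smul, norm_inv, norm_norm]
      exact inv_mul_cancel₀ (norm_ne_zero_iff.2 hy)
  set dir : V → sphere (0 : V) 1 := fun y => ⟨d y, hds y⟩ with hdir
  have hdirm : Measurable dir := hdm.subtype_mk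
  set ν : Measure V := volume.withDensity fun y => ENNReal.ofReal (w y)
  have hν : IsFiniteMeasure ν := isFiniteMeasure_withDensity_ofReal hw.2
  refine ⟨ν.map dir, inferInstance, fun J hJ => ?_⟩
  have hJm : AEStronglyMeasurable (fun θ : sphere (0 : V) 1 => J θ) (ν.map dir) :=
    (hJ.comp_measurable measurable_subtype_coe).aestronglyMeasurable
  rw [integral_map hdirm.aemeasurable hJm,
    integral_withDensity_eq_integral_toReal_smul₀ hw.1.aemeasurable.ennreal_ofReal
      (ae_of_all _ fun y => ENNReal.ofReal_lt_top)]
  refine integral_congr_ae ?_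
  filter_upwards [Measure.ae_ne volume (0 : V)] with y hy
  simp only [hdir, hd, hy, if_false, ENNReal.toReal_ofReal (hw0 y)]

lemma stronglyMeasurable_rayMellin {p : ℝ} {ψ : V → ℂ} (hψ : Continuous ψ) :
    StronglyMeasurable (rayMellin p ψ) := by
  have h1 : Measurable fun z : V × ℝ => z.2 ^ (p - 1) • ψ (z.2 • z.1) := by
    have := hψ.measurable
    fun_prop
  exact h1.stronglyMeasurable.integral_prod_right'

lemma integral_rpow_smul_integral_mul_comp_smul [Nontrivial V] {p : ℝ} (hp0 : 0 < p) {G : V → ℝ}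
    (hGm : Measurable G)
    (hGi : Integrable fun y => ‖y‖ ^ (-p) * G y) {ψ : V → ℂ} (hψ : Continuous ψ) {D : ℝ} {k : ℕ}
    (hk : p < k) (hD : ∀ z, ‖ψ z‖ ≤ D * (1 + ‖z‖ ^ k)⁻¹) :
    ∫ u in Set.Ioi (0 : ℝ), u ^ (p - 1) • ∫ y, (G y : ℂ) * ψ (u • y) =
      ∫ y, (‖y‖ ^ (-p) * G y) • rayMellin p ψ (‖y‖⁻¹ • y) := by
  have hint : Integrable (Function.uncurry fun (y : V) (u : ℝ) =>
      u ^ (p - 1) • ((G y : ℂ) * ψ (u • y)))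
      (volume.prod (volume.restrict (Set.Ioi (0 : ℝ)))) := by
    have h1 := integrable_uncurry_rpow_mul_comp_mul (μ := (volume : Measure V))
      (F := fun t : ℝ => (1 + t ^ k)⁻¹) (p := p) (by fun_prop)
      (integrableOn_rpow_mul_inv_one_add_pow hp0 hk) (a := fun y => ‖y‖) (by fun_prop)
      (by filter_upwards [Measure.ae_ne volume (0 : V)] with y hy using norm_pos_iff.2 hy)
      (ρ := fun y => ((D * G y : ℝ) : ℂ)) (by fun_prop) (by
        refine (hGi.norm.const_mul |D|).congr (ae_of_all _ fun y => ?_)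
        simp only [Complex.norm_real, norm_mul, Real.norm_eq_abs,
          abs_of_nonneg (Real.rpow_nonneg (norm_nonneg y) (-p))]
        ring)
    have hm : Measurable (Function.uncurry fun (y : V) (u : ℝ) =>
        u ^ (p - 1) • ((G y : ℂ) * ψ (u • y))) := by
      have := hψ.measurable
      have : Measurable fun z : V × ℝ => z.2 ^ (p - 1) • ((G z.1 : ℂ) * ψ (z.2 • z.1)) := by
        fun_prop
      exact this
    refine h1.mono hm.aestronglyMeasurable ?_
    have h2 : ∀ᵐ z : V × ℝ ∂volume.prod (volume.restrict (Set.Ioi (0 : ℝ))), 0 < z.2 :=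
      Measure.quasiMeasurePreserving_snd.ae (ae_restrict_mem measurableSet_Ioi)
    filter_upwards [h2] with ⟨y, u⟩ hu
    have hu0 : (0 : ℝ) < u := hu
    have h3 := hD (u • y)
    rw [norm_smul, Real.norm_of_nonneg hu0.le, mul_comm u] at h3
    simp only [Function.uncurry, norm_smul, norm_mul, Complex.norm_real,
      Real.norm_of_nonneg (Real.rpow_nonneg hu0.le (p - 1)), mul_assoc]
    rw [mul_left_comm _ ‖D‖, ← mul_assoc ‖D‖, mul_comm (‖D‖ * _)]
    have h4 : ‖ψ (u • y)‖ ≤ ‖D‖ * ‖(1 + (‖y‖ * u) ^ k)⁻¹‖ := by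
      rw [← norm_mul]
      exact h3.trans (Real.le_norm_self _)
    gcongr
  simp_rw [← integral_smul]
  rw [← integral_integral_swap hint]
  refine integral_congr_ae ?_
  filter_upwards [Measure.ae_ne volume (0 : V)] with y hy
  rw [rayMellin, mul_comm, mul_smul, ← integral_rpow_smul_comp_smul p ψ hy, ← integral_smul]
  refine integral_congr_ae (ae_of_all _ fun u => ?_)
  simp only
  rw [smul_comm, Complex.real_smul (x := G y)]

theorem IsGaugeLike.exists_measure_sphere {N : V → ℝ} {c p q : ℝ} (hN : IsGaugeLike N c)
    (hp0 : 0 < p) (hp : p < finrank ℝ V) (hq : 0 < q)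
    (hpos : GaussianPositive fun x => (Real.exp (-N x ^ q) : ℂ)) :
    ∃ μ : Measure (sphere (0 : V) 1), IsFiniteMeasure μ ∧
      ∀ φ : SchwartzMap V ℂ, (∀ x, φ (-x) = φ x) →
        ∫ x, N x ^ (-p) • φ x =
          ∫ θ : sphere (0 : V) 1, (∫ t : ℝ, |t| ^ (p - 1) • 𝓕 (⇑φ) (t • (θ : V))) ∂μ := by
  have hd : 1 ≤ finrank ℝ V := by
    have h : (0 : ℝ) < finrank ℝ V := hp0.trans hp
    exact_mod_cast h
  have : Nontrivial V := nontrivial_of_finrank_pos (R := ℝ) hd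
  have hg := hN.integrable_exp_neg_rpow hd hq
  set g : V → ℂ := fun x => (Real.exp (-N x ^ q) : ℂ) with hgdef
  set G : V → ℝ := fun y => (𝓕 g y).re
  have hG0 : ∀ y, 0 ≤ G y := hpos.re_fourier_nonneg hg
  have hG : ∀ y, 𝓕 g y = G y := fun y => by
    refine (Complex.conj_eq_iff_re.1 ?_).symm
    rw [Real.fourier_eq, ← integral_conj, ← integral_neg_eq_self]
    refine integral_congr_ae (ae_of_all _ fun x => ?_)
    simp only [hgdef, hN.neg, Circle.smul_def, smul_eq_mul, map_mul, Complex.conj_ofReal,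
      inner_neg_left, neg_neg, ← Circle.coe_inv_eq_conj, AddChar.map_neg_eq_inv]
  have hGc : Continuous G := Complex.continuous_re.comp (continuous_fourier_of_integrable hg)
  have hGi : Integrable fun y => ‖y‖ ^ (-p) * G y :=
    hN.integrable_rpow_mul_fourier hp0 hp hq hG hG0
  set K : ℝ := 1 / q * Real.Gamma (p / q)
  have hK : 0 < K := by
    have := Real.Gamma_pos_of_pos (div_pos hp0 hq)
    positivity
  obtain ⟨μ, hμ, hμJ⟩ := exists_measure_sphere_integral_eq (hGi.const_mul (K⁻¹ * 2⁻¹)) fun y => by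
    have := hG0 y
    positivity
  refine ⟨μ, hμ, fun φ hφe => ?_⟩
  obtain ⟨k, hk⟩ := exists_nat_gt p
  obtain ⟨D, hD⟩ := (𝓕 φ : SchwartzMap V ℂ).exists_norm_le_mul_inv_one_add_pow k
  obtain ⟨C, -, hC⟩ := φ.decay 0 0
  simp only [pow_zero, one_mul, norm_iteratedFDeriv_zero] at hC
  have hφe' : (fun x => φ (-x)) = φ := funext hφe
  set ψ : V → ℂ := 𝓕 (⇑φ) with hψdef
  have hψcoe : ⇑(𝓕 φ : SchwartzMap V ℂ) = ψ := SchwartzMap.fourier_coe φ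
  rw [hψcoe] at hD
  have hψc : Continuous ψ := hψcoe ▸ (𝓕 φ : SchwartzMap V ℂ).continuous
  have hψi : Integrable ψ := hψcoe ▸ (𝓕 φ : SchwartzMap V ℂ).integrable
  have hψe : ∀ x, ψ (-x) = ψ x := fun x => by
    rw [hψdef, ← Real.fourierInv_eq_fourier_neg, Real.fourierInv_eq_fourier_comp_neg, hφe']
  have hφψ : 𝓕 ψ = φ := by
    ext x
    rw [← hφe x, ← φ.continuous.fourierInv_fourier_eq φ.integrable hψi,
      Real.fourierInv_eq_fourier_neg, neg_neg]
  have hlhs := hN.integral_rpow_neg_smul hp0 hp hq φ.integrable hC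
  rw [setIntegral_congr_fun (g := fun u : ℝ => u ^ (p - 1) • ∫ y, (G y : ℂ) * ψ (u • y))
    measurableSet_Ioi fun u hu => by
      have h1 := integral_comp_smul_mul_fourier hg hψi hu
      rw [hφψ] at h1
      simp only [hG] at h1
      simp only [← h1, hgdef],
    integral_rpow_smul_integral_mul_comp_smul hp0 hGc.measurable hGi hψc hk hD] at hlhs
  have hrhs : ∀ θ : sphere (0 : V) 1, ∫ t : ℝ, |t| ^ (p - 1) • ψ (t • (θ : V)) =
      (2 : ℝ) • rayMellin p ψ θ := fun θ =>
    integral_abs_rpow_smul_eq_rayMellin hp0 hψc hψe hk hD (mem_sphere_zero_iff_norm.1 θ.2)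
  simp only [hrhs]
  rw [integral_smul, hμJ _ (stronglyMeasurable_rayMellin hψc), ← integral_smul]
  simp only [mul_smul _ (_ * G _), smul_smul (2 : ℝ)]
  rw [integral_smul, mul_left_comm, mul_inv_cancel₀ two_ne_zero, mul_one, ← hlhs, smul_smul,
    inv_mul_cancel₀ hK.ne', one_smul]

end NegativePowers

lemma continuous_integral_abs_inner_rpow {V : Type*} [NormedAddCommGroup V]
    [InnerProductSpace ℝ V] [MeasurableSpace V] [BorelSpace V]
    (μ : Measure (sphere (0 : V) 1)) [IsFiniteMeasure μ] {q : ℝ} (hq : 0 < q) :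
    Continuous fun x : V => ∫ ξ : sphere (0 : V) 1, |⟪x, (ξ : V)⟫| ^ q ∂μ := by
  refine continuous_iff_continuousAt.2 fun x₀ => ?_
  have hm : ∀ x : V, Continuous fun ξ : sphere (0 : V) 1 => |⟪x, (ξ : V)⟫| ^ q := fun x =>
    (by fun_prop : Continuous fun ξ : sphere (0 : V) 1 => |⟪x, (ξ : V)⟫|).rpow_const
      fun _ => Or.inr hq.le
  refine continuousAt_of_dominated (bound := fun _ => (‖x₀‖ + 1) ^ q)
    (Filter.Eventually.of_forall fun x => (hm x).measurable.aestronglyMeasurable) ?_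
    (integrable_const _) (ae_of_all _ fun ξ => ?_)
  · filter_upwards [ball_mem_nhds x₀ one_pos] with x hx
    refine ae_of_all _ fun ξ => ?_
    rw [Real.norm_of_nonneg (by positivity)]
    have h1 : ‖x‖ ≤ ‖x₀‖ + 1 := by
      have h2 := norm_sub_norm_le x x₀
      have h3 : ‖x - x₀‖ < 1 := mem_ball_iff_norm.1 hx
      linarith
    have h4 : |⟪x, (ξ : V)⟫| ≤ ‖x‖ := by
      have h5 := abs_real_inner_le_norm x (ξ : V)
      rwa [mem_sphere_zero_iff_norm.1 ξ.2, mul_one] at h5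
    gcongr
    exact h4.trans h1
  · exact ((by fun_prop : Continuous fun x : V => |⟪x, (ξ : V)⟫|).rpow_const
      fun _ => Or.inr hq.le).continuousAt

lemma IsNormOn.nonneg {n : ℕ} {N : Euc n → ℝ} (hN : IsNormOn n N) (x : Euc n) : 0 ≤ N x := by
  have h1 := hN.2.2 x (-x)
  have h2 := hN.2.1 (-1) x
  rw [neg_one_smul, abs_neg, abs_one, one_mul] at h2
  rw [add_neg_cancel, (hN.1 0).2 rfl, h2] at h1
  linarith

lemma IsNormOn.exists_isGaugeLike {n : ℕ} (hn : 0 < n) {N : Euc n → ℝ} (hN : IsNormOn n N)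
    (hc : Continuous N) : ∃ c, IsGaugeLike N c := by
  have : Nonempty (Fin n) := ⟨⟨0, hn⟩⟩
  obtain ⟨ξ, hξ, hmin⟩ := (isCompact_sphere (0 : Euc n) 1).exists_isMinOn
    (NormedSpace.sphere_nonempty.2 zero_le_one) hc.continuousOn
  have hξ0 : ξ ≠ 0 := by
    rintro rfl
    simp at hξ
  have hpos : 0 < N ξ := (hN.nonneg ξ).lt_of_ne fun h => hξ0 ((hN.1 ξ).1 h.symm)
  refine ⟨N ξ, hc, hpos, fun x => ?_, fun u hu x => ?_, fun x => ?_⟩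
  · rcases eq_or_ne x 0 with rfl | hx
    · simpa using hN.nonneg 0
    · have hx' : 0 < ‖x‖ := norm_pos_iff.2 hx
      have hs : ‖x‖⁻¹ • x ∈ sphere (0 : Euc n) 1 := by
        rw [mem_sphere_zero_iff_norm, norm_smul, norm_inv, norm_norm, inv_mul_cancel₀ hx'.ne']
      have h1 : N ξ ≤ N (‖x‖⁻¹ • x) := hmin hs
      rwa [hN.2.1, abs_of_pos (inv_pos.2 hx'), ← div_eq_inv_mul, le_div_iff₀ hx'] at h1
  · rw [hN.2.1, abs_of_pos hu]
  · have h2 := hN.2.1 (-1) x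
    rwa [neg_one_smul, abs_neg, abs_one, one_mul] at h2

/-- **Subspaces of `L_q`, `0 < q ≤ 2`, embed in `L_{-p}` for all `0 < p < n`.** -/
theorem subspace_Lq_embeds_Lneg (n : ℕ) (q : ℝ) (hq0 : 0 < q) (hq2 : q ≤ 2)
    (N : Euc n → ℝ) (hN : IsNormOn n N) (h : EmbedsInLPos n q N) :
    ∀ p : ℝ, 0 < p → p < n → EmbedsInLNeg n p N := by
  intro p hp0 hpn
  obtain ⟨μ, hμ, hμN⟩ := h
  have hc : Continuous N := by
    have h1 : N = fun x => (∫ ξ : sphere (0 : Euc n) 1, |⟪x, (ξ : Euc n)⟫| ^ q ∂μ) ^ q⁻¹ := by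
      ext x
      rw [← hμN, Real.rpow_rpow_inv (hN.nonneg x) hq0.ne']
    rw [h1]
    exact (continuous_integral_abs_inner_rpow μ hq0).rpow_const
      fun _ => Or.inr (inv_nonneg.2 hq0.le)
  have hn : 0 < n := by
    have h1 : (0 : ℝ) < n := hp0.trans hpn
    exact_mod_cast h1
  obtain ⟨c, hg⟩ := hN.exists_isGaugeLike hn hc
  refine hg.exists_measure_sphere hp0 (by rwa [finrank_euclideanSpace_fin]) hq0 ?_
  simp only [hμN]
  exact gaussianPositive_exp_neg_integral_rpow hq0 hq2 μ

end
end

section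
/- For every origin-symmetric convex body K in ℝⁿ and every p with max(0, n−3) ≤ p < n (p > 0), the space (ℝⁿ, ‖·‖_K) embeds in L_{−p}. In particular, every n-dimensional normed space with n ≥ 4 embeds in L_{−(n−3)}. -/
open MeasureTheory Metric Module
open scoped ENNReal FourierTransform RealInnerProductSpace Pointwise

noncomputable section

/-- One-dimensional Brunn–Minkowski inequality for compact sets. -/
lemma volume_add_le_of_isCompact {A B H : Set ℝ} {a b : ℝ} (ha : 0 < a) (hb : 0 < b)
    (hA : IsCompact A) (hB : IsCompact B) (hA0 : A.Nonempty) (hB0 : B.Nonempty)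
    (h : ∀ x ∈ A, ∀ y ∈ B, a * x + b * y ∈ H) :
    ENNReal.ofReal a * volume A + ENNReal.ofReal b * volume B ≤ volume H := by
  set S : Set ℝ := (b * sInf B) +ᵥ (a • A) with hS
  set T : Set ℝ := (a * sSup A) +ᵥ (b • B) with hT
  have hSv : volume S = ENNReal.ofReal a * volume A := by
    rw [hS, measure_vadd, Measure.addHaar_smul]
    simp [abs_of_pos ha]
  have hTv : volume T = ENNReal.ofReal b * volume B := by
    rw [hT, measure_vadd, Measure.addHaar_smul]
    simp [abs_of_pos hb]
  have hTm : MeasurableSet T := ((hB.smul b).vadd _).measurableSet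
  have hdisj : AEDisjoint volume S T := by
    refine measure_mono_null (t := {a * sSup A + b * sInf B}) ?_ (by simp)
    rintro z ⟨⟨_, ⟨x, hx, rfl⟩, rfl⟩, ⟨_, ⟨y, hy, rfl⟩, hz⟩⟩
    simp only [vadd_eq_add, smul_eq_mul, Set.mem_singleton_iff] at hz ⊢
    have h1 : x ≤ sSup A := le_csSup hA.bddAbove hx
    have h2 : sInf B ≤ y := csInf_le hB.bddBelow hy
    nlinarith [mul_le_mul_of_nonneg_left h1 ha.le, mul_le_mul_of_nonneg_left h2 hb.le]
  rw [← hSv, ← hTv, ← measure_union₀ hTm.nullMeasurableSet hdisj]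
  refine measure_mono (Set.union_subset ?_ ?_)
  · rintro _ ⟨_, ⟨x, hx, rfl⟩, rfl⟩
    have := h x hx _ (hB.sInf_mem hB0)
    simpa [add_comm] using this
  · rintro _ ⟨_, ⟨y, hy, rfl⟩, rfl⟩
    simpa using h _ (hA.sSup_mem hA0) y hy

/-- One-dimensional Brunn–Minkowski inequality. -/
lemma volume_add_le {A B H : Set ℝ} {a b : ℝ} (ha : 0 < a) (hb : 0 < b)
    (hA : MeasurableSet A) (hB : MeasurableSet B) (hA0 : A.Nonempty) (hB0 : B.Nonempty)
    (h : ∀ x ∈ A, ∀ y ∈ B, a * x + b * y ∈ H) :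
    ENNReal.ofReal a * volume A + ENNReal.ofReal b * volume B ≤ volume H := by
  obtain ⟨x₀, hx₀⟩ := hA0
  obtain ⟨y₀, hy₀⟩ := hB0
  rw [hA.measure_eq_iSup_isCompact, hB.measure_eq_iSup_isCompact]
  simp only [iSup_and', ENNReal.mul_iSup]
  refine ENNReal.biSup_add_biSup_le' ⟨∅, by simp⟩ ⟨∅, by simp⟩ fun A' hA' B' hB' ↦ ?_
  refine le_trans ?_ (volume_add_le_of_isCompact ha hb (hA'.2.insert x₀) (hB'.2.insert y₀)
    (Set.insert_nonempty _ _) (Set.insert_nonempty _ _) fun x hx y hy ↦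
      h x (Set.insert_subset hx₀ hA'.1 hx) y (Set.insert_subset hy₀ hB'.1 hy))
  gcongr <;> exact Set.subset_insert _ _

/-- The Prékopa–Leindler inequality on `ℝ` for functions with supremum `1`. -/
lemma lintegral_add_le_of_iSup_eq_one {f g h : ℝ → ℝ≥0∞} {a b : ℝ} (ha : 0 < a) (hb : 0 < b)
    (hab : a + b = 1) (hf : Measurable f) (hg : Measurable g) (hh : Measurable h)
    (hf1 : ⨆ x, f x = 1) (hg1 : ⨆ x, g x = 1)
    (H : ∀ x y, f x ^ a * g y ^ b ≤ h (a * x + b * y)) :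
    ENNReal.ofReal a * (∫⁻ x, f x) + ENNReal.ofReal b * (∫⁻ x, g x) ≤ ∫⁻ x, h x := by
  have layer : ∀ u : ℝ → ℝ≥0∞, Measurable u → (∀ x, u x ≤ 1) →
      ∫⁻ x, u x = ∫⁻ t in Set.Ioo (0 : ℝ) 1, volume {x | ENNReal.ofReal t < u x} := by
    intro u hu hu1
    have hfin : ∀ x, u x ≠ ∞ := fun x ↦ ne_top_of_le_ne_top ENNReal.one_ne_top (hu1 x)
    have := lintegral_eq_lintegral_meas_lt (μ := volume) (f := fun x ↦ (u x).toReal)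
      (ae_of_all _ fun x ↦ ENNReal.toReal_nonneg) hu.ennreal_toReal.aemeasurable
    simp only [ENNReal.ofReal_toReal (hfin _)] at this
    rw [this, ← Set.Ioo_union_Ici_eq_Ioi (zero_lt_one (α := ℝ)), lintegral_union measurableSet_Ici]
    · rw [setLIntegral_congr_fun (g := fun _ ↦ 0) measurableSet_Ici]
      · rw [lintegral_zero, add_zero]
        refine setLIntegral_congr_fun measurableSet_Ioo fun t ht ↦ ?_
        congr 1
        ext x
        simp only [Set.mem_ofPred_eq]
        rw [ENNReal.ofReal_lt_iff_lt_toReal ht.1.le (hfin x)]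
      · intro t ht
        convert measure_empty (μ := (volume : Measure ℝ))
        ext x
        simp only [Set.mem_ofPred_eq, Set.mem_empty_iff_false, iff_false, not_lt]
        exact (ENNReal.toReal_mono ENNReal.one_ne_top (hu1 x)).trans (by simpa using ht)
    · rw [Set.disjoint_left]
      rintro x hx hx'
      exact absurd hx.2 (not_lt.2 hx')
  have hmin : ∫⁻ x, min (h x) 1 ≤ ∫⁻ x, h x := lintegral_mono fun x ↦ min_le_left _ _
  refine le_trans ?_ hmin
  rw [layer f hf fun x ↦ hf1 ▸ le_iSup f x, layer g hg fun x ↦ hg1 ▸ le_iSup g x,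
    layer _ (hh.min measurable_const) fun x ↦ min_le_right _ _,
    ← lintegral_const_mul' _ _ ENNReal.ofReal_ne_top,
    ← lintegral_const_mul' _ _ ENNReal.ofReal_ne_top, ← lintegral_add_left]
  · refine setLIntegral_mono' measurableSet_Ioo fun t ht ↦ ?_
    have ht1 : ENNReal.ofReal t < 1 := by simpa using ht.2
    have hfn : {x | ENNReal.ofReal t < f x}.Nonempty := by
      obtain ⟨x, hx⟩ := lt_iSup_iff.1 (ht1.trans_eq hf1.symm)
      exact ⟨x, hx⟩
    have hgn : {x | ENNReal.ofReal t < g x}.Nonempty := by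
      obtain ⟨x, hx⟩ := lt_iSup_iff.1 (ht1.trans_eq hg1.symm)
      exact ⟨x, hx⟩
    refine volume_add_le ha hb (measurableSet_lt measurable_const hf)
      (measurableSet_lt measurable_const hg) hfn
      hgn fun x hx y hy ↦ ?_
    simp only [Set.mem_ofPred_eq, lt_min_iff] at hx hy ⊢
    refine ⟨lt_of_lt_of_le ?_ (H x y), ht1⟩
    calc ENNReal.ofReal t = ENNReal.ofReal t ^ a * ENNReal.ofReal t ^ b := by
          rw [← ENNReal.rpow_add_of_nonneg _ _ ha.le hb.le, hab, ENNReal.rpow_one]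
      _ < f x ^ a * g y ^ b :=
          ENNReal.mul_lt_mul (ENNReal.rpow_lt_rpow hx ha) (ENNReal.rpow_lt_rpow hy hb)
  · have : Antitone fun t : ℝ ↦ volume {x | ENNReal.ofReal t < f x} := fun s t hst ↦
      measure_mono fun x hx ↦ lt_of_le_of_lt (ENNReal.ofReal_le_ofReal hst) hx
    exact this.measurable.const_mul _

/-- The Prékopa–Leindler inequality on `ℝ` for bounded functions. -/
lemma prekopa_leindler_real {f g h : ℝ → ℝ≥0∞} {a b : ℝ} (ha : 0 < a) (hb : 0 < b)
    (hab : a + b = 1) (hf : Measurable f) (hg : Measurable g) (hh : Measurable h)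
    {C : ℝ≥0∞} (hC : C ≠ ∞) (hfC : ∀ x, f x ≤ C) (hgC : ∀ x, g x ≤ C)
    (H : ∀ x y, f x ^ a * g y ^ b ≤ h (a * x + b * y)) :
    (∫⁻ x, f x) ^ a * (∫⁻ x, g x) ^ b ≤ ∫⁻ x, h x := by
  set F := ⨆ x, f x with hF
  set G := ⨆ x, g x with hG
  have hFt : F ≠ ∞ := ne_top_of_le_ne_top hC (iSup_le hfC)
  have hGt : G ≠ ∞ := ne_top_of_le_ne_top hC (iSup_le hgC)
  rcases eq_or_ne F 0 with hF0 | hF0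
  · have : ∀ x, f x = 0 := by simpa [hF] using hF0
    simp [this, ha]
  rcases eq_or_ne G 0 with hG0 | hG0
  · have : ∀ x, g x = 0 := by simpa [hG] using hG0
    simp [this, hb]
  have hFG0 : F ^ a * G ^ b ≠ 0 := by simp [hF0, hG0, ha.not_gt, hb.not_gt, hFt, hGt]
  have hFGt : F ^ a * G ^ b ≠ ∞ :=
    ENNReal.mul_ne_top (ENNReal.rpow_ne_top_of_nonneg ha.le hFt)
      (ENNReal.rpow_ne_top_of_nonneg hb.le hGt)
  have key := lintegral_add_le_of_iSup_eq_one (f := fun x ↦ F⁻¹ * f x) (g := fun x ↦ G⁻¹ * g x)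
    (h := fun x ↦ (F ^ a * G ^ b)⁻¹ * h x) ha hb hab (hf.const_mul _) (hg.const_mul _)
    (hh.const_mul _) (by rw [← ENNReal.mul_iSup, ENNReal.inv_mul_cancel hF0 hFt])
    (by rw [← ENNReal.mul_iSup, ENNReal.inv_mul_cancel hG0 hGt]) ?_
  · rw [lintegral_const_mul _ hf, lintegral_const_mul _ hg, lintegral_const_mul _ hh] at key
    have amgm : ∀ x y : ℝ≥0∞, x ^ a * y ^ b ≤ ENNReal.ofReal a * x + ENNReal.ofReal b * y := by
      intro x y
      induction x with
      | top => simp [ENNReal.mul_top, ha]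
      | coe x =>
      induction y with
      | top => simp [ENNReal.mul_top, hb]
      | coe y =>
      have := NNReal.geom_mean_le_arith_mean2_weighted a.toNNReal b.toNNReal x y
        (by rw [← Real.toNNReal_add ha.le hb.le, hab, Real.toNNReal_one])
      rw [Real.coe_toNNReal _ ha.le, Real.coe_toNNReal _ hb.le] at this
      rw [← ENNReal.coe_rpow_of_nonneg _ ha.le, ← ENNReal.coe_rpow_of_nonneg _ hb.le]
      simp only [ENNReal.ofReal]
      exact_mod_cast this
    have key2 := (amgm _ _).trans key
    rw [ENNReal.mul_rpow_of_nonneg _ _ ha.le, ENNReal.mul_rpow_of_nonneg _ _ hb.le] at key2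
    have e : (F⁻¹ ^ a * (∫⁻ x, f x) ^ a) * (G⁻¹ ^ b * (∫⁻ x, g x) ^ b) =
        (F ^ a * G ^ b)⁻¹ * ((∫⁻ x, f x) ^ a * (∫⁻ x, g x) ^ b) := by
      rw [ENNReal.inv_rpow, ENNReal.inv_rpow, ENNReal.mul_inv (by simp [hF0, hFt])
        (Or.inl (ENNReal.rpow_ne_top_of_nonneg ha.le hFt))]
      ring
    rw [e] at key2
    exact (ENNReal.mul_le_mul_iff_right (ENNReal.inv_ne_zero.2 hFGt)
      (ENNReal.inv_ne_top.2 hFG0)).1 key2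
  · intro x y
    rw [ENNReal.mul_rpow_of_nonneg _ _ ha.le, ENNReal.mul_rpow_of_nonneg _ _ hb.le,
      ENNReal.inv_rpow, ENNReal.inv_rpow, ENNReal.mul_inv (by simp [hF0, hFt])
        (Or.inl (ENNReal.rpow_ne_top_of_nonneg ha.le hFt))]
    calc _ = (F ^ a)⁻¹ * (G ^ b)⁻¹ * (f x ^ a * g y ^ b) := by ring
      _ ≤ _ := by gcongr; exact H x y

/-- Log-concavity of a function with values in `[0, ∞]`. -/
def IsLogConc {E : Type*} [AddCommGroup E] [Module ℝ E] (f : E → ℝ≥0∞) : Prop :=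
  ∀ (x y : E) (a b : ℝ), 0 < a → 0 < b → a + b = 1 → f x ^ a * f y ^ b ≤ f (a • x + b • y)

lemma IsLogConc.lintegral_real {E : Type*} [AddCommGroup E] [Module ℝ E] [MeasurableSpace E]
    {f : E × ℝ → ℝ≥0∞} (hf : IsLogConc f) (hm : Measurable f) {C : ℝ≥0∞} (hC : C ≠ ∞)
    (hfC : ∀ z, f z ≤ C) : IsLogConc fun x ↦ ∫⁻ t, f (x, t) := by
  intro x y a b ha hb hab
  exact prekopa_leindler_real ha hb hab (hm.comp measurable_prodMk_left)
    (hm.comp measurable_prodMk_left) (hm.comp measurable_prodMk_left) hC (fun t ↦ hfC _)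
    (fun t ↦ hfC _) fun s t ↦ hf (x, s) (y, t) a b ha hb hab

/-- Marginals of log-concave functions are log-concave (Prékopa). -/
lemma IsLogConc.lintegral_pi : ∀ (m : ℕ) {f : ℝ × (Fin m → ℝ) → ℝ≥0∞}, IsLogConc f →
    Measurable f → ∀ {C : ℝ≥0∞}, C ≠ ∞ → (∀ z, f z ≤ C) → ∀ R : ℝ,
    (∀ z, R < ‖z‖ → f z = 0) → IsLogConc fun s ↦ ∫⁻ y, f (s, y) := by
  intro m
  induction m with
  | zero =>
    intro f hf hm C hC hfC R hR x y a b ha hb hab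
    have := hf (x, 0) (y, 0) a b ha hb hab
    have h0 : ∀ s, ∫⁻ y : Fin 0 → ℝ, f (s, y) = f (s, 0) := by
      intro s
      have hms : Measurable fun y ↦ f (s, y) := hm.comp measurable_prodMk_left
      rw [volume_pi, Measure.pi_of_empty _ (0 : Fin 0 → ℝ), lintegral_dirac' _ hms]
    simp only [h0]
    simpa using this
  | succ m ih =>
    intro f hf hm C hC hfC R hR
    set e : ℝ × (Fin m → ℝ) ≃ᵐ (Fin (m + 1) → ℝ) :=
      (MeasurableEquiv.piFinSuccAbove (fun _ ↦ ℝ) 0).symm with he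
    have he0 : ∀ z, e z 0 = z.1 := fun z ↦ by simp [he, MeasurableEquiv.piFinSuccAbove]
    have heS : ∀ z j, e z (Fin.succ j) = z.2 j := fun z j ↦ by
      simp [he, MeasurableEquiv.piFinSuccAbove]
    have hep : MeasurePreserving e volume volume :=
      (volume_preserving_piFinSuccAbove (fun _ : Fin (m + 1) ↦ ℝ) 0).symm
    set F : (ℝ × (Fin m → ℝ)) × ℝ → ℝ≥0∞ := fun z ↦ f (z.1.1, e (z.2, z.1.2)) with hF
    have hFm : Measurable F := hm.comp <| (measurable_fst.comp measurable_fst).prodMk <|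
      e.measurable.comp <| measurable_snd.prodMk <| measurable_snd.comp measurable_fst
    have hFl : IsLogConc F := by
      intro x y a b ha hb hab
      refine (hf _ _ a b ha hb hab).trans_eq ?_
      simp only [hF]
      congr 1
      ext i
      · simp
      · refine Fin.cases ?_ (fun j ↦ ?_) i <;> simp [he0, heS]
    have key : ∀ s, ∫⁻ y, f (s, y) = ∫⁻ y : Fin m → ℝ, ∫⁻ t, F ((s, y), t) := by
      intro s
      have hms : Measurable fun y ↦ f (s, y) := hm.comp measurable_prodMk_left
      have hmse : Measurable fun z ↦ f (s, e z) := hms.comp hep.measurable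
      rw [← hep.lintegral_comp hms, Measure.volume_eq_prod, lintegral_prod_symm' _ hmse]
    have hnorm : ∀ z : (ℝ × (Fin m → ℝ)) × ℝ, ‖z‖ ≤ ‖(z.1.1, e (z.2, z.1.2))‖ := by
      rintro ⟨⟨s, y⟩, t⟩
      have h0 : ‖t‖ ≤ ‖e (t, y)‖ := by simpa only [he0] using norm_le_pi_norm (e (t, y)) 0
      have h1 : ‖y‖ ≤ ‖e (t, y)‖ := (pi_norm_le_iff_of_nonneg (norm_nonneg _)).2 fun j ↦ by
        simpa only [heS] using norm_le_pi_norm (e (t, y)) j.succ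
      exact max_le (max_le_max le_rfl h1) (h0.trans (le_max_right _ _))
    simp only [key]
    refine ih (hFl.lintegral_real hFm hC fun z ↦ hfC _) hFm.lintegral_prod_right
      (C := C * ENNReal.ofReal (2 * R)) (ENNReal.mul_ne_top hC ENNReal.ofReal_ne_top) ?_ R ?_
    · intro z
      have : ∀ t, F (z, t) ≤ (Set.Icc (-R) R).indicator (fun _ ↦ C) t := by
        intro t
        by_cases ht : t ∈ Set.Icc (-R) R
        · simpa [ht] using hfC _
        · have : F (z, t) = 0 := by
            refine hR _ (lt_of_lt_of_le ?_ (hnorm (z, t)))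
            refine lt_of_lt_of_le ?_ (le_max_right _ _)
            by_contra h
            exact ht (abs_le.1 (not_lt.1 h))
          simp [this]
      refine (lintegral_mono this).trans_eq ?_
      rw [lintegral_indicator measurableSet_Icc, setLIntegral_const, Real.volume_Icc]
      ring_nf
    · intro z hz
      have : ∀ t, F (z, t) = 0 := fun t ↦
        hR _ (lt_of_lt_of_le hz ((le_max_left _ _).trans (hnorm (z, t))))
      simp [this]

/-- Sections of symmetric convex bodies by parallel hyperplanes decrease away from the origin. -/
lemma volume_section_le {m : ℕ} {K : Set (ℝ × (Fin m → ℝ))} (hconv : Convex ℝ K)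
    (hcomp : IsCompact K) (hsym : ∀ z ∈ K, -z ∈ K) {s t : ℝ} (hst : |s| ≤ |t|) :
    volume {y | (t, y) ∈ K} ≤ volume {y | (s, y) ∈ K} := by
  have hKm : MeasurableSet K := hcomp.measurableSet
  have hm : ∀ s : ℝ, MeasurableSet {y | (s, y) ∈ K} := fun s ↦ measurable_prodMk_left hKm
  have hlc : IsLogConc (K.indicator (fun _ ↦ (1 : ℝ≥0∞))) := by
    intro x y a b ha hb hab
    by_cases hx : x ∈ K
    · by_cases hy : y ∈ K
      · simp [hx, hy, hconv hx hy ha.le hb.le hab]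
      · simp [hy, hb]
    · simp [hx, ha]
  obtain ⟨R, hR⟩ := hcomp.isBounded.exists_norm_le
  have hA := hlc.lintegral_pi m (measurable_const.indicator hKm) ENNReal.one_ne_top
    (fun z ↦ Set.indicator_le_self' (fun _ _ ↦ zero_le) z) R fun z hz ↦
      Set.indicator_of_notMem (fun h ↦ (hR z h).not_gt hz) _
  have hAe : ∀ s, ∫⁻ y, K.indicator (fun _ ↦ (1 : ℝ≥0∞)) (s, y) = volume {y | (s, y) ∈ K} := by
    intro s
    rw [← lintegral_indicator_one (hm s)]
    rfl
  simp only [hAe] at hA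
  have hneg : ∀ t : ℝ, volume {y | (-t, y) ∈ K} = volume {y | (t, y) ∈ K} := by
    intro t
    rw [← Measure.measure_neg volume {y | (t, y) ∈ K}]
    congr 1
    ext y
    simp only [Set.mem_ofPred_eq, Set.mem_neg]
    constructor <;> intro h <;> simpa using hsym _ h
  rcases eq_or_ne |s| |t| with h | h
  · rcases abs_eq_abs.1 h with h | h
    · rw [h]
    · rw [h, hneg]
  have hlt : |s| < |t| := lt_of_le_of_ne hst h
  have ht : 0 < |t| := (abs_nonneg s).trans_lt hlt
  have ht0 : t ≠ 0 := abs_pos.1 ht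
  have hq : |s / t| < 1 := by rwa [abs_div, div_lt_one ht]
  rw [abs_lt] at hq
  have := hA t (-t) ((1 + s / t) / 2) ((1 - s / t) / 2) (by linarith [hq.1]) (by linarith [hq.2])
    (by ring)
  simp only [hneg] at this
  rw [← ENNReal.rpow_add_of_nonneg _ _ (by linarith [hq.1]) (by linarith [hq.2])] at this
  have e1 : (1 + s / t) / 2 + (1 - s / t) / 2 = 1 := by ring
  have e2 : ((1 + s / t) / 2) • t + ((1 - s / t) / 2) • -t = s := by
    simp only [smul_eq_mul]; field_simp; ring
  rwa [e1, e2, ENNReal.rpow_one] at this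

/-- The negative of the second derivative of a Gaussian, suitably normalised. -/
def mexicanHat (s : ℝ) : ℝ := (1 - 2 * Real.pi * s ^ 2) * Real.exp (-Real.pi * s ^ 2)

lemma continuous_mexicanHat : Continuous mexicanHat := by
  unfold mexicanHat; fun_prop

lemma integrable_sq_mul_gaussian : Integrable fun s : ℝ ↦ s ^ 2 * Real.exp (-Real.pi * s ^ 2) := by
  have := integrable_rpow_mul_exp_neg_mul_sq Real.pi_pos (s := 2) (by norm_num)
  simpa using this

lemma integrable_mexicanHat : Integrable mexicanHat := by
  have h0 := integrable_exp_neg_mul_sq Real.pi_pos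
  have := h0.sub (integrable_sq_mul_gaussian.const_mul (2 * Real.pi))
  refine this.congr (ae_of_all _ fun s ↦ ?_)
  simp only [mexicanHat, Pi.sub_apply]
  ring

lemma abs_mexicanHat_le (s : ℝ) : |mexicanHat s| ≤ 2 := by
  have hy : 0 ≤ Real.pi * s ^ 2 := by positivity
  have h1 : Real.pi * s ^ 2 + 1 ≤ Real.exp (Real.pi * s ^ 2) := Real.add_one_le_exp _
  have h2 : Real.exp (-Real.pi * s ^ 2) * Real.exp (Real.pi * s ^ 2) = 1 := by
    rw [← Real.exp_add]; simp
  have h3 := Real.exp_pos (-Real.pi * s ^ 2)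
  rw [mexicanHat, abs_le]
  constructor <;> nlinarith

lemma integral_mexicanHat : ∫ s, mexicanHat s = 0 := by
  have hd : ∀ s : ℝ, HasDerivAt (fun s ↦ s * Real.exp (-Real.pi * s ^ 2)) (mexicanHat s) s := by
    intro s
    convert! (hasDerivAt_id s).mul (((hasDerivAt_pow 2 s).const_mul (-Real.pi)).exp) using 1
    simp [mexicanHat]; ring
  exact integral_eq_zero_of_hasDerivAt_of_integrable hd integrable_mexicanHat
    (integrable_mul_exp_neg_mul_sq Real.pi_pos)

/-- The Fourier representation of `mexicanHat`, with nonnegative spectral density. -/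
lemma integral_sq_mul_gaussian_mul_exp (s : ℝ) :
    ∫ u : ℝ, ((2 * Real.pi * u ^ 2 * Real.exp (-Real.pi * u ^ 2) : ℝ) : ℂ) *
      Complex.exp (2 * Real.pi * Complex.I * s * u) = mexicanHat s := by
  set E : ℝ → ℂ := fun u ↦ Complex.exp (-Real.pi * u ^ 2 + 2 * Real.pi * Complex.I * s * u) with hE
  have hEc : Continuous E := by simp only [hE]; fun_prop
  have hEn : ∀ u, ‖E u‖ = Real.exp (-Real.pi * u ^ 2) := by
    intro u
    rw [hE, Complex.norm_exp]
    congr 1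
    simp [← Complex.ofReal_pow]
  have i0 : Integrable E := by
    refine (integrable_exp_neg_mul_sq Real.pi_pos).mono' hEc.aestronglyMeasurable ?_
    exact ae_of_all _ fun u ↦ (hEn u).le
  have i1 : Integrable fun u : ℝ ↦ u * E u := by
    refine (integrable_mul_exp_neg_mul_sq Real.pi_pos).mono
      (by fun_prop) (ae_of_all _ fun u ↦ ?_)
    rw [norm_mul, norm_mul, hEn, Real.norm_of_nonneg (Real.exp_pos _).le]
    simp
  have i2 : Integrable fun u : ℝ ↦ (u : ℂ) ^ 2 * E u := by
    refine integrable_sq_mul_gaussian.mono (by fun_prop) (ae_of_all _ fun u ↦ ?_)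
    rw [norm_mul, norm_mul, hEn, Real.norm_of_nonneg (Real.exp_pos _).le]
    simp
  have dE : ∀ u, HasDerivAt E (-2 * Real.pi * (u * E u) + 2 * Real.pi * Complex.I * s * E u) u := by
    intro u
    have h1 : HasDerivAt (fun u : ℝ ↦ (u : ℂ)) 1 u := Complex.ofRealCLM.hasDerivAt
    convert! (((h1.pow 2).const_mul (-Real.pi : ℂ)).add
      (h1.const_mul (2 * Real.pi * Complex.I * s))).cexp using 1
    simp [hE]; ring
  have duE : ∀ u : ℝ, HasDerivAt (fun u : ℝ ↦ u * E u)
      (E u + (-2 * Real.pi * (u ^ 2 * E u) + 2 * Real.pi * Complex.I * s * (u * E u))) u := by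
    intro u
    have h1 : HasDerivAt (fun u : ℝ ↦ (u : ℂ)) 1 u := Complex.ofRealCLM.hasDerivAt
    convert! h1.mul (dE u) using 1
    ring
  have i3 : Integrable fun u : ℝ ↦
      -2 * Real.pi * (u ^ 2 * E u) + 2 * Real.pi * Complex.I * s * (u * E u) :=
    (i2.const_mul _).add (i1.const_mul _)
  have e1 := integral_eq_zero_of_hasDerivAt_of_integrable dE
    ((i1.const_mul _).add (i0.const_mul _)) i0
  have e2 := integral_eq_zero_of_hasDerivAt_of_integrable duE
    (i0.add i3) i1
  rw [integral_add (i1.const_mul _) (i0.const_mul _), integral_const_mul, integral_const_mul] at e1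
  rw [integral_add i0 i3, integral_add (i2.const_mul _) (i1.const_mul _),
    integral_const_mul, integral_const_mul] at e2
  have e0 : ∫ u, E u = Real.exp (-Real.pi * s ^ 2) := by
    have hpi : (Real.pi : ℂ) ≠ 0 := by simp [Real.pi_ne_zero]
    have := fourierIntegral_gaussian (b := Real.pi) (by simpa using Real.pi_pos) (2 * Real.pi * s)
    rw [div_self hpi, Complex.one_cpow, one_mul] at this
    rw [Complex.ofReal_exp]
    convert! this using 1
    · refine integral_congr_ae (ae_of_all _ fun u ↦ ?_)
      simp only [hE, ← Complex.exp_add]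
      congr 1; ring
    · congr 1; push_cast; field_simp; ring
  have e3 : (∫ u : ℝ, ((2 * Real.pi * u ^ 2 * Real.exp (-Real.pi * u ^ 2) : ℝ) : ℂ) *
      Complex.exp (2 * Real.pi * Complex.I * s * u)) =
        2 * Real.pi * ∫ u : ℝ, (u : ℂ) ^ 2 * E u := by
    rw [← integral_const_mul]
    refine integral_congr_ae (ae_of_all _ fun u ↦ ?_)
    simp only [hE, Complex.exp_add]
    push_cast
    ring
  rw [e3]
  rw [mexicanHat, Complex.ofReal_mul, ← e0]
  push_cast
  have hI : Complex.I ^ 2 = -1 := Complex.I_sq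
  linear_combination -e2 - (Complex.I * s) * e1 + (2 * Real.pi * s ^ 2 * ∫ u, E u) * hI

lemma integral_mexicanHat_mul_nonneg {A : ℝ → ℝ} (hA : ∀ s t, |s| ≤ |t| → A t ≤ A s)
    (hint : Integrable fun s ↦ mexicanHat s * A s) : 0 ≤ ∫ s, mexicanHat s * A s := by
  have hc : 0 < 2 * Real.pi := by positivity
  set s₀ := √(1 / (2 * Real.pi)) with hs₀
  have hs : s₀ ^ 2 = 1 / (2 * Real.pi) := Real.sq_sqrt (by positivity)
  have h0 : ∫ s, mexicanHat s * A s₀ = 0 := by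
    rw [integral_mul_const, integral_mexicanHat, zero_mul]
  rw [← h0]
  refine integral_mono (integrable_mexicanHat.mul_const _) hint fun s ↦ ?_
  have he := Real.exp_pos (-Real.pi * s ^ 2)
  rcases le_total |s| |s₀| with h | h
  · have hk : 0 ≤ mexicanHat s := by
      refine mul_nonneg ?_ he.le
      have : s ^ 2 ≤ s₀ ^ 2 := sq_le_sq.2 h
      rw [hs, le_div_iff₀ hc] at this
      linarith
    exact mul_le_mul_of_nonneg_left (hA _ _ h) hk
  · have hk : mexicanHat s ≤ 0 := by
      refine mul_nonpos_of_nonpos_of_nonneg ?_ he.le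
      have : s₀ ^ 2 ≤ s ^ 2 := sq_le_sq.2 h
      rw [hs, div_le_iff₀ hc] at this
      linarith
    exact mul_le_mul_of_nonpos_left (hA _ _ h) hk

lemma integral_mexicanHat_fst_nonneg {m : ℕ} {K : Set (ℝ × (Fin m → ℝ))} (hconv : Convex ℝ K)
    (hcomp : IsCompact K) (hsym : ∀ z ∈ K, -z ∈ K) : 0 ≤ ∫ z in K, mexicanHat z.1 := by
  have hKm : MeasurableSet K := hcomp.measurableSet
  have hm : ∀ s : ℝ, MeasurableSet {y | (s, y) ∈ K} := fun s ↦ measurable_prodMk_left hKm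
  have hfin : volume K ≠ ∞ := hcomp.measure_lt_top.ne
  have hi : Integrable (K.indicator fun z : ℝ × (Fin m → ℝ) ↦ mexicanHat z.1)
      (volume.prod volume) := by
    rw [← Measure.volume_eq_prod, integrable_indicator_iff hKm]
    exact (continuous_mexicanHat.comp continuous_fst).continuousOn.integrableOn_compact hcomp
  have e : ∀ s, ∫ y, K.indicator (fun z : ℝ × (Fin m → ℝ) ↦ mexicanHat z.1) (s, y) =
      mexicanHat s * volume.real {y | (s, y) ∈ K} := by
    intro s
    have : (fun y ↦ K.indicator (fun z : ℝ × (Fin m → ℝ) ↦ mexicanHat z.1) (s, y)) =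
        {y | (s, y) ∈ K}.indicator fun _ ↦ mexicanHat s := rfl
    rw [this, integral_indicator_const _ (hm s), smul_eq_mul, mul_comm]
  have hi2 := hi.integral_prod_left
  rw [← integral_indicator hKm, Measure.volume_eq_prod, integral_prod _ hi]
  simp only [e] at hi2 ⊢
  refine integral_mexicanHat_mul_nonneg (fun s t hst ↦ ?_) hi2
  refine ENNReal.toReal_mono ?_ (volume_section_le hconv hcomp hsym hst)
  refine ne_top_of_le_ne_top (hcomp.image continuous_snd).measure_lt_top.ne (measure_mono ?_)
  exact fun y hy ↦ ⟨_, hy, rfl⟩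

lemma exists_linearEquiv_fst_eq_inner {m : ℕ} {ξ : Euc (m + 1)} (hξ : ξ ≠ 0) :
    ∃ L : Euc (m + 1) ≃ₗ[ℝ] ℝ × (Fin m → ℝ), ∀ x, (L x).1 = ⟪x, ξ⟫ := by
  set f : Euc (m + 1) →ₗ[ℝ] ℝ := (innerₗ (Euc (m + 1))) ξ with hf
  have hfr : f.range = ⊤ := by
    refine LinearMap.range_eq_top.2 fun r ↦ ⟨(r / ⟪ξ, ξ⟫) • ξ, ?_⟩
    have : ⟪ξ, ξ⟫ ≠ 0 := by simpa using hξ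
    simp only [hf, innerₗ_apply_apply, inner_smul_right]
    field_simp
  obtain ⟨q, hq⟩ := Submodule.exists_isCompl f.ker
  set g := f.ker.projectionOnto q hq with hg
  have hrk : finrank ℝ f.ker = m := by
    have := f.finrank_range_add_finrank_ker
    rw [hfr, finrank_top] at this
    simp at this
    omega
  let L₀ := LinearMap.equivProdOfSurjectiveOfIsCompl f g hfr (by simp [hg]) (by simpa [hg] using hq)
  let e : f.ker ≃ₗ[ℝ] (Fin m → ℝ) := LinearEquiv.ofFinrankEq _ _ (by simp [hrk])
  refine ⟨L₀.trans ((LinearEquiv.refl ℝ ℝ).prodCongr e), fun x ↦ ?_⟩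
  simp [L₀, hf, real_inner_comm]

lemma integral_mexicanHat_inner_nonneg {n : ℕ} {K : Set (Euc n)} (hconv : Convex ℝ K)
    (hcomp : IsCompact K) (hsym : ∀ z ∈ K, -z ∈ K) (ξ : Euc n) :
    0 ≤ ∫ x in K, mexicanHat ⟪x, ξ⟫ := by
  rcases eq_or_ne ξ 0 with rfl | hξ
  · simp [mexicanHat]
  obtain _ | m := n
  · exact absurd (Subsingleton.elim _ _) hξ
  obtain ⟨L, hL⟩ := exists_linearEquiv_fst_eq_inner hξ
  set Λ := L.toContinuousLinearEquiv with hΛ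
  have hemb : MeasurableEmbedding Λ := Λ.toHomeomorph.measurableEmbedding
  set ν : Measure (ℝ × (Fin m → ℝ)) := (volume : Measure (Euc (m + 1))).map Λ with hν
  have : ν.IsAddHaarMeasure := Λ.isAddHaarMeasure_map volume
  have : (volume : Measure (ℝ × (Fin m → ℝ))).IsAddHaarMeasure :=
    Measure.prod.instIsAddHaarMeasure _ _
  have hs := Measure.isAddLeftInvariant_eq_smul ν volume
  have h1 : ∫ x in K, mexicanHat ⟪x, ξ⟫ = ∫ z in Λ '' K, mexicanHat z.1 ∂ν := by
    rw [hν, hemb.setIntegral_map, Set.preimage_image_eq _ Λ.injective]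
    exact integral_congr_ae (ae_of_all _ fun x ↦ congrArg mexicanHat (hL x).symm)
  rw [h1, hs, Measure.restrict_smul, integral_smul_nnreal_measure]
  refine smul_nonneg (zero_le) (integral_mexicanHat_fst_nonneg ?_ ?_ ?_)
  · exact hconv.linear_image L.toLinearMap
  · exact hcomp.image Λ.continuous
  · rintro _ ⟨x, hx, rfl⟩
    exact ⟨-x, hsym x hx, by simp⟩

/-- The spectral measure of `mexicanHat`. -/
def hatMeasure : Measure ℝ :=
  volume.withDensity fun u ↦ ENNReal.ofReal (2 * Real.pi * u ^ 2 * Real.exp (-Real.pi * u ^ 2))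

instance : IsFiniteMeasure hatMeasure := by
  refine isFiniteMeasure_withDensity_ofReal ?_
  have := (integrable_sq_mul_gaussian.const_mul (2 * Real.pi)).2
  simpa only [mul_assoc] using this

lemma integral_exp_hatMeasure (s : ℝ) :
    ∫ u, Complex.exp (2 * Real.pi * Complex.I * s * u) ∂hatMeasure = mexicanHat s := by
  rw [← integral_sq_mul_gaussian_mul_exp, hatMeasure,
    integral_withDensity_eq_integral_toReal_smul (by fun_prop) (by simp)]
  refine integral_congr_ae (ae_of_all _ fun u ↦ ?_)
  simp only
  rw [ENNReal.toReal_ofReal (by positivity), Complex.real_smul]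

/-- The integral over `K` of the plane wave with profile `mexicanHat` and frequency `ξ`. -/
def hatTransform {n : ℕ} (K : Set (Euc n)) (ξ : Euc n) : ℝ := ∫ x in K, mexicanHat ⟪x, ξ⟫

lemma continuous_hatTransform {n : ℕ} {K : Set (Euc n)} (hcomp : IsCompact K) :
    Continuous (hatTransform K) := by
  unfold hatTransform
  refine continuous_parametric_integral_of_continuous (μ := volume)
    (f := fun ξ x ↦ mexicanHat ⟪x, ξ⟫) ?_ hcomp
  have := continuous_mexicanHat
  simp only [Function.uncurry_def]
  fun_prop

lemma abs_hatTransform_le {n : ℕ} {K : Set (Euc n)} (hcomp : IsCompact K) (ξ : Euc n) :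
    |hatTransform K ξ| ≤ 2 * (volume K).toReal := by
  have := norm_setIntegral_le_of_norm_le_const (μ := volume) (s := K)
    (f := fun x ↦ mexicanHat ⟪x, ξ⟫)
    hcomp.measure_lt_top (fun x _ ↦ abs_mexicanHat_le _)
  simpa [hatTransform, Measure.real] using this

/-- Pairing `hatTransform K` with a dilate of `ψ`, expressed through the inverse Fourier
transform `φ` of `ψ`. -/
lemma integral_hatTransform_smul {n : ℕ} {K : Set (Euc n)} (hcomp : IsCompact K)
    {φ ψ : Euc n → ℂ} (hψ : Integrable ψ)
    (hφ : ∀ w, ∫ ξ, Complex.exp (2 * Real.pi * Complex.I * (⟪w, ξ⟫ : ℝ)) * ψ ξ = φ w)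
    {t : ℝ} (ht : t ≠ 0) :
    ∫ ξ, hatTransform K ξ • ψ (t • ξ) =
      (|t| ^ n)⁻¹ • ∫ z, φ ((z.2 / t) • z.1) ∂((volume.restrict K).prod hatMeasure) := by
  have : IsFiniteMeasure (volume.restrict K) :=
    isFiniteMeasure_restrict.2 hcomp.measure_lt_top.ne
  set κ := (volume.restrict K).prod hatMeasure with hκ
  have hψt : Integrable fun ξ ↦ ψ (t • ξ) := hψ.comp_smul ht
  have hc (ξ : Euc n) : Continuous fun z : Euc n × ℝ ↦
      Complex.exp (2 * Real.pi * Complex.I * (⟪z.1, ξ⟫ : ℝ) * z.2) := by fun_prop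
  have hi (ξ : Euc n) : Integrable (fun z : Euc n × ℝ ↦
      Complex.exp (2 * Real.pi * Complex.I * (⟪z.1, ξ⟫ : ℝ) * z.2)) κ := by
    refine Integrable.of_bound (hc ξ).aestronglyMeasurable 1 (ae_of_all _ fun z ↦ ?_)
    rw [Complex.norm_exp]
    simp
  have h1 (ξ : Euc n) : hatTransform K ξ • ψ (t • ξ) =
      ∫ z, Complex.exp (2 * Real.pi * Complex.I * (⟪z.1, ξ⟫ : ℝ) * z.2) * ψ (t • ξ) ∂κ := by
    rw [integral_mul_const, hκ, integral_prod _ (hi ξ)]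
    simp only [integral_exp_hatMeasure, hatTransform]
    rw [integral_complex_ofReal, Complex.real_smul]
  simp_rw [h1]
  rw [integral_integral_swap, ← integral_smul]
  · refine integral_congr_ae (ae_of_all _ fun z ↦ ?_)
    simp only
    rw [← hφ]
    have := Measure.integral_comp_smul (volume : Measure (Euc n)) (fun ξ ↦
      Complex.exp (2 * Real.pi * Complex.I * (⟪(z.2 / t) • z.1, ξ⟫ : ℝ)) * ψ ξ) t
    simp only [finrank_euclideanSpace, Fintype.card_fin, abs_inv, abs_pow] at this
    rw [← this]
    refine integral_congr_ae (ae_of_all _ fun ξ ↦ ?_)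
    simp only [inner_smul_left, inner_smul_right]
    have ht' : (t : ℂ) ≠ 0 := by exact_mod_cast ht
    congr 2
    push_cast
    simp
    field_simp
  · have h2 : Integrable (fun y : Euc n × (Euc n × ℝ) ↦ ψ (t • y.1) * 1) (volume.prod κ) :=
      hψt.mul_prod (integrable_const (1 : ℂ))
    refine h2.mono ?_ (ae_of_all _ fun y ↦ ?_)
    · have h3 : Continuous fun y : Euc n × (Euc n × ℝ) ↦
        Complex.exp (2 * Real.pi * Complex.I * (⟪y.2.1, y.1⟫ : ℝ) * y.2.2) := by fun_prop
      have h4 := (h3.aestronglyMeasurable (μ := volume.prod κ)).mul h2.1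
      simp only [mul_one] at h4
      exact h4
    · simp only [Function.uncurry_def, norm_mul, Complex.norm_exp]
      simp

lemma lintegral_comp_smul_addHaar {E : Type*} [NormedAddCommGroup E] [NormedSpace ℝ E]
    [MeasurableSpace E] [BorelSpace E] [FiniteDimensional ℝ E] (μ : Measure E)
    [μ.IsAddHaarMeasure] {f : E → ℝ≥0∞} (hf : Measurable f) {r : ℝ} (hr : r ≠ 0) :
    ∫⁻ x, f (r • x) ∂μ = ENNReal.ofReal (|r| ^ finrank ℝ E)⁻¹ * ∫⁻ x, f x ∂μ := by
  rw [← lintegral_map hf (measurable_const_smul r), Measure.map_addHaar_smul μ hr,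
    lintegral_smul_measure, abs_inv, abs_pow, smul_eq_mul]

/-- Homogeneity of `r ↦ ∫ |t| ^ (p - 1) h (r t) dt`. -/
lemma lintegral_abs_rpow_mul_comp {p : ℝ} {h : ℝ → ℝ≥0∞} (hh : Measurable h) {r : ℝ}
    (hr : 0 < r) :
    ∫⁻ t : ℝ, ENNReal.ofReal (|t| ^ (p - 1)) * h (r * t) =
      ENNReal.ofReal (r ^ (-p)) * ∫⁻ t : ℝ, ENNReal.ofReal (|t| ^ (p - 1)) * h t := by
  have hm : Measurable fun t : ℝ ↦ ENNReal.ofReal (|t| ^ (p - 1)) * h t := by fun_prop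
  have h1 := lintegral_comp_smul_addHaar volume hm hr.ne'
  have h2 (t : ℝ) : ENNReal.ofReal (|t| ^ (p - 1)) * h (r * t) = ENNReal.ofReal (r ^ (1 - p)) *
      (ENNReal.ofReal (|r • t| ^ (p - 1)) * h (r • t)) := by
    rw [← mul_assoc, ← ENNReal.ofReal_mul (by positivity), smul_eq_mul, abs_mul, abs_of_pos hr,
      Real.mul_rpow hr.le (abs_nonneg _), ← mul_assoc, ← Real.rpow_add hr]
    simp
  simp_rw [h2]
  have hm' : Measurable fun t ↦ ENNReal.ofReal (|r • t| ^ (p - 1)) * h (r • t) :=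
    hm.comp (measurable_const_smul r)
  rw [lintegral_const_mul _ hm', h1, ← mul_assoc,
    ← ENNReal.ofReal_mul (by positivity), abs_of_pos hr]
  congr 2
  rw [finrank_self, pow_one, ← Real.rpow_neg_one, ← Real.rpow_add hr]
  ring_nf

lemma lintegral_abs_rpow_of_abs_le {p a : ℝ} (hp : 0 < p) (ha : 0 ≤ a) :
    ∫⁻ t : ℝ, (if |t| ≤ a then ENNReal.ofReal (|t| ^ (p - 1)) else 0) =
      ENNReal.ofReal (2 / p * a ^ p) := by
  set f : ℝ → ℝ := (Set.Iic a).indicator fun r ↦ r ^ (p - 1) with hf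
  have h1 : IntegrableOn f (Set.Ioi 0) := by
    rw [hf, IntegrableOn, integrable_indicator_iff measurableSet_Iic, IntegrableOn,
      Measure.restrict_restrict measurableSet_Iic, Set.Iic_inter_Ioi, ← IntegrableOn,
      ← intervalIntegrable_iff_integrableOn_Ioc_of_le ha]
    exact intervalIntegral.intervalIntegrable_rpow' (by linarith)
  have h2 : Integrable fun t : ℝ ↦ f |t| := by
    have := (integrable_fun_norm_addHaar (E := ℝ) volume (f := f)).2 (by simpa using h1)
    simpa using this
  have h3 : ∫ t : ℝ, f |t| = 2 / p * a ^ p := by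
    rw [integral_comp_abs, hf, setIntegral_indicator measurableSet_Iic, Set.Ioi_inter_Iic,
      ← intervalIntegral.integral_of_le ha, integral_rpow (Or.inl (by linarith))]
    rw [sub_add_cancel, Real.zero_rpow hp.ne']
    ring
  rw [← h3, ofReal_integral_eq_lintegral_ofReal h2 (ae_of_all _ fun t ↦ ?_)]
  · refine lintegral_congr fun t ↦ ?_
    by_cases h : |t| ≤ a <;> simp [hf, h]
  · by_cases h : |t| ≤ a
    · simp only [hf, Set.indicator, Set.mem_Iic, h, if_true, Pi.zero_apply]
      positivity
    · simp [hf, h]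

/-- Origin-symmetric convex bodies. -/
structure IsSymmBody {n : ℕ} (K : Set (Euc n)) : Prop where
  convex : Convex ℝ K
  isCompact : IsCompact K
  neg_mem : ∀ x ∈ K, -x ∈ K
  mem_nhds : K ∈ nhds (0 : Euc n)

namespace IsSymmBody

variable {n : ℕ} {K : Set (Euc n)}

lemma continuous_gauge (hK : IsSymmBody K) : Continuous (gauge K) :=
  _root_.continuous_gauge hK.convex hK.mem_nhds

lemma gauge_smul (hK : IsSymmBody K) (c : ℝ) (x : Euc n) :
    gauge K (c • x) = |c| * gauge K x := by
  rcases le_total 0 c with hc | hc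
  · rw [gauge_smul_of_nonneg hc, abs_of_nonneg hc, smul_eq_mul]
  · rw [← gauge_neg hK.neg_mem, ← neg_smul, gauge_smul_of_nonneg (neg_nonneg.2 hc),
      abs_of_nonpos hc, smul_eq_mul]

lemma gauge_le_one_iff (hK : IsSymmBody K) {x : Euc n} : gauge K x ≤ 1 ↔ x ∈ K := by
  rw [gauge_le_one_iff_mem_closure hK.convex hK.mem_nhds, hK.isCompact.isClosed.closure_eq]

lemma exists_mul_norm_le_gauge (hK : IsSymmBody K) :
    ∃ c > 0, ∀ x, c * ‖x‖ ≤ gauge K x := by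
  obtain ⟨r, hr, hr'⟩ := hK.isCompact.isBounded.subset_closedBall_lt 0 0
  refine ⟨r⁻¹, by positivity, fun x ↦ ?_⟩
  have := le_gauge_of_subset_closedBall (x := x) (absorbent_nhds_zero hK.mem_nhds) hr.le hr'
  rwa [div_eq_inv_mul] at this

lemma gauge_pos (hK : IsSymmBody K) {x : Euc n} (hx : x ≠ 0) : 0 < gauge K x := by
  obtain ⟨c, hc, h⟩ := hK.exists_mul_norm_le_gauge
  exact (mul_pos hc (norm_pos_iff.2 hx)).trans_le (h x)

lemma smul_mem_iff (hK : IsSymmBody K) {c : ℝ} (hc : c ≠ 0) {x : Euc n} :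
    c⁻¹ • x ∈ K ↔ gauge K x ≤ |c| := by
  rw [← hK.gauge_le_one_iff, hK.gauge_smul, abs_inv, inv_mul_le_one₀ (abs_pos.2 hc)]

lemma setLIntegral_comp_smul (hK : IsSymmBody K) {f : Euc n → ℝ≥0∞} (hf : Measurable f)
    {c : ℝ} (hc : c ≠ 0) :
    ∫⁻ x in K, f (c • x) =
      ENNReal.ofReal (|c| ^ n)⁻¹ * ∫⁻ y, if gauge K y ≤ |c| then f y else 0 := by
  have hg := hK.continuous_gauge.measurable
  have h1 := lintegral_comp_smul_addHaar (volume : Measure (Euc n))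
    (f := fun y ↦ if gauge K y ≤ |c| then f y else 0)
    (hf.ite (measurableSet_le hg measurable_const) measurable_const) hc
  rw [finrank_euclideanSpace, Fintype.card_fin] at h1
  rw [← h1, ← lintegral_indicator hK.isCompact.measurableSet]
  refine lintegral_congr fun x ↦ ?_
  have h2 : gauge K (c • x) ≤ |c| ↔ x ∈ K := by rw [← hK.smul_mem_iff hc, inv_smul_smul₀ hc]
  by_cases hx : x ∈ K
  · rw [Set.indicator_of_mem hx, if_pos (h2.2 hx)]
  · rw [Set.indicator_of_notMem hx, if_neg (mt h2.1 hx)]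

end IsSymmBody

/-- A measure whose image under `(t, x, u) ↦ (u / t) • x` is a multiple of
`gauge K ^ (-p)`, see `map_sourceMeasure`. -/
def sourceMeasure {n : ℕ} (p : ℝ) (K : Set (Euc n)) : Measure (ℝ × (Euc n × ℝ)) :=
  (volume.withDensity fun t : ℝ ↦ ENNReal.ofReal (|t| ^ (p - 1 - n))).prod
    ((volume.restrict K).prod hatMeasure)

/-- The factor of proportionality in `map_sourceMeasure`. -/
def hatConst (n : ℕ) (p : ℝ) : ℝ≥0∞ :=
  ENNReal.ofReal (2 / p) * ∫⁻ u, ENNReal.ofReal (|u| ^ (p - n)) ∂hatMeasure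

lemma ae_ne_zero_hatMeasure : ∀ᵐ u ∂hatMeasure, u ≠ 0 :=
  (withDensity_absolutelyContinuous _ _).ae_le (Measure.ae_ne volume 0)

lemma hatConst_ne_zero (n : ℕ) {p : ℝ} (hp : 0 < p) : hatConst n p ≠ 0 := by
  have h2 : ENNReal.ofReal (2 / p) ≠ 0 := by
    rw [Ne, ENNReal.ofReal_eq_zero, not_le]; positivity
  refine mul_ne_zero h2 fun h ↦ ?_
  rw [hatMeasure, lintegral_withDensity_eq_lintegral_mul _ (by fun_prop) (by fun_prop),
    lintegral_eq_zero_iff (by fun_prop)] at h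
  obtain ⟨u, hu, hu'⟩ := (h.and (Measure.ae_ne volume 0)).exists
  have h3 : 0 < 2 * Real.pi * u ^ 2 * Real.exp (-Real.pi * u ^ 2) * |u| ^ (p - n) := by
    have := abs_pos.2 hu'
    positivity
  simp only [Pi.mul_apply, Pi.zero_apply] at hu
  rw [← ENNReal.ofReal_mul (by positivity), ENNReal.ofReal_eq_zero] at hu
  linarith

lemma hatConst_ne_top {n : ℕ} {p : ℝ} (h : (n : ℝ) - 3 < p) : hatConst n p ≠ ∞ := by
  refine ENNReal.mul_ne_top ENNReal.ofReal_ne_top ?_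
  rw [hatMeasure, lintegral_withDensity_eq_lintegral_mul _ (by fun_prop) (by fun_prop)]
  have h1 : Integrable fun u : ℝ ↦ |u| ^ (2 + (p - n)) * Real.exp (-Real.pi * u ^ 2) := by
    have h2 := integrable_rpow_mul_exp_neg_mul_sq Real.pi_pos (s := 2 + (p - n)) (by linarith)
    have h3 := (integrable_fun_norm_addHaar (E := ℝ) volume (f := fun r : ℝ ↦
      r ^ (2 + (p - n)) * Real.exp (-Real.pi * r ^ 2))).2 (by simpa using h2.integrableOn)
    simpa using h3
  have h4 := (h1.const_mul (2 * Real.pi)).2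
  refine ((lintegral_mono_ae ?_).trans_lt h4).ne
  filter_upwards [Measure.ae_ne volume (0 : ℝ)] with u hu
  have hu' := abs_pos.2 hu
  simp only [Pi.mul_apply]
  rw [← ENNReal.ofReal_mul (by positivity), ← ofReal_norm,
    Real.norm_of_nonneg (by positivity)]
  refine ENNReal.ofReal_le_ofReal (le_of_eq ?_)
  rw [Real.rpow_add hu', Real.rpow_two, sq_abs]
  ring

lemma map_sourceMeasure {n : ℕ} (hn : n ≠ 0) {K : Set (Euc n)} (hK : IsSymmBody K) {p : ℝ}
    (hp : 0 < p) :
    (sourceMeasure p K).map (fun z ↦ (z.2.2 / z.1) • z.2.1) =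
      hatConst n p • volume.withDensity fun y ↦ ENNReal.ofReal (gauge K y ^ (-p)) := by
  have : Nonempty (Fin n) := Fin.pos_iff_nonempty.1 (Nat.pos_of_ne_zero hn)
  have hg := hK.continuous_gauge.measurable
  refine Measure.ext_of_lintegral _ fun f hf ↦ ?_
  have hT : Measurable fun z : ℝ × (Euc n × ℝ) ↦ (z.2.2 / z.1) • z.2.1 := by fun_prop
  have hfT : Measurable fun z : ℝ × (Euc n × ℝ) ↦ f ((z.2.2 / z.1) • z.2.1) := hf.comp hT
  rw [lintegral_map hf hT, sourceMeasure, lintegral_prod_symm _ hfT.aemeasurable]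
  have hm1 : Measurable fun w : Euc n × ℝ ↦ ∫⁻ t : ℝ, f ((w.2 / t) • w.1)
      ∂(volume.withDensity fun t : ℝ ↦ ENNReal.ofReal (|t| ^ (p - 1 - n))) :=
    Measurable.lintegral_prod_left' (f := fun z : ℝ × (Euc n × ℝ) ↦ f ((z.2.2 / z.1) • z.2.1)) hfT
  rw [lintegral_prod_symm _ hm1.aemeasurable]
  rw [lintegral_smul_measure,
    lintegral_withDensity_eq_lintegral_mul _ (by fun_prop) hf, smul_eq_mul, hatConst,
    mul_assoc, ← lintegral_mul_const _ (by fun_prop), ← lintegral_const_mul _ (by fun_prop)]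
  refine lintegral_congr_ae ?_
  filter_upwards [ae_ne_zero_hatMeasure] with u hu
  have hu' := abs_pos.2 hu
  have hm2 : Measurable fun z : Euc n × ℝ ↦ f ((u / z.2) • z.1) :=
    hf.comp (by fun_prop)
  rw [lintegral_lintegral_swap hm2.aemeasurable,
    lintegral_withDensity_eq_lintegral_mul _ (by fun_prop)
      (Measurable.lintegral_prod_left' (f := fun z : Euc n × ℝ ↦ f ((u / z.2) • z.1)) hm2)]
  set F : ℝ → Euc n → ℝ≥0∞ := fun t y ↦ ENNReal.ofReal (|u| ^ n)⁻¹ * (f y *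
    (if |t| ≤ |u| / gauge K y then ENNReal.ofReal (|t| ^ (p - 1)) else 0)) with hF
  have hFm : Measurable (Function.uncurry F) := by
    refine measurable_const.mul ((hf.comp measurable_snd).mul ?_)
    refine Measurable.ite (measurableSet_le ?_ ?_) ?_ measurable_const
    all_goals fun_prop
  have h1 : ∀ᵐ t : ℝ, ((fun t : ℝ ↦ ENNReal.ofReal (|t| ^ (p - 1 - n))) *
      fun t ↦ ∫⁻ x in K, f ((u / t) • x)) t = ∫⁻ y, F t y := by
    filter_upwards [Measure.ae_ne volume (0 : ℝ)] with t ht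
    have ht' := abs_pos.2 ht
    have hms : Measurable fun y ↦ if gauge K y ≤ |u / t| then f y else 0 :=
      hf.ite (measurableSet_le hg measurable_const) measurable_const
    rw [Pi.mul_apply, hK.setLIntegral_comp_smul hf (div_ne_zero hu ht), ← mul_assoc,
      ← lintegral_const_mul _ hms]
    refine lintegral_congr_ae ?_
    filter_upwards [Measure.ae_ne volume (0 : Euc n)] with y hy
    have hy' := hK.gauge_pos hy
    have h2 : gauge K y ≤ |u / t| ↔ |t| ≤ |u| / gauge K y := by
      rw [abs_div, le_div_iff₀ ht', le_div_iff₀ hy', mul_comm]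
    rw [hF]
    simp only [h2]
    split_ifs with h
    · rw [← ENNReal.ofReal_mul (by positivity), mul_comm (f y), ← mul_assoc,
        ← ENNReal.ofReal_mul (by positivity), Real.rpow_sub ht' (p - 1), Real.rpow_natCast, abs_div,
        div_pow]
      congr 2
      field_simp
    · simp
  rw [lintegral_congr_ae h1, lintegral_lintegral_swap hFm.aemeasurable, ← lintegral_const_mul _
    (by fun_prop), ← lintegral_const_mul _ (by fun_prop)]
  refine lintegral_congr_ae ?_
  filter_upwards [Measure.ae_ne volume (0 : Euc n)] with y hy
  have hy' := hK.gauge_pos hy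
  have hms : Measurable fun t : ℝ ↦
      if |t| ≤ |u| / gauge K y then ENNReal.ofReal (|t| ^ (p - 1)) else 0 :=
    Measurable.ite (measurableSet_le (by fun_prop) (by fun_prop)) (by fun_prop) measurable_const
  simp only [hF, Pi.mul_apply]
  rw [lintegral_const_mul _ (hms.const_mul _), lintegral_const_mul _ hms,
    lintegral_abs_rpow_of_abs_le hp (by positivity), mul_comm (f y), ← mul_assoc, ← mul_assoc,
    ← mul_assoc]
  congr 1
  rw [← ENNReal.ofReal_mul (by positivity), ← ENNReal.ofReal_mul (by positivity),
    ← ENNReal.ofReal_mul (by positivity)]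
  congr 1
  rw [Real.rpow_sub hu', Real.rpow_natCast, Real.div_rpow hu'.le hy'.le, Real.rpow_neg hy'.le]
  ring

/-- `f` decays at infinity faster than any power. -/
def RapidDecay {E F : Type*} [Norm E] [Norm F] (f : E → F) : Prop :=
  ∀ k : ℕ, ∃ B : ℝ, ∀ x, ‖f x‖ ≤ B * (1 + ‖x‖) ^ (-(k : ℝ))

lemma SchwartzMap.rapidDecay {E F : Type*} [NormedAddCommGroup E] [NormedSpace ℝ E]
    [NormedAddCommGroup F] [NormedSpace ℝ F] (f : SchwartzMap E F) : RapidDecay f := by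
  intro k
  refine ⟨2 ^ k * (Finset.Iic (k, 0)).sup (fun m ↦ SchwartzMap.seminorm ℝ m.1 m.2) f, fun x ↦ ?_⟩
  have h := f.one_add_le_sup_seminorm_apply (𝕜 := ℝ) (m := (k, 0)) le_rfl le_rfl x
  rw [norm_iteratedFDeriv_zero] at h
  rwa [Real.rpow_neg (by positivity), Real.rpow_natCast, ← div_eq_mul_inv,
    le_div_iff₀ (by positivity), mul_comm]

lemma rapidDecay_gaussian {E : Type*} [NormedAddCommGroup E] :
    RapidDecay fun x : E ↦ Real.exp (-Real.pi * ‖x‖ ^ 2) := by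
  intro k
  refine ⟨k.factorial * Real.exp 2, fun x ↦ ?_⟩
  have h1 := Real.pow_div_factorial_le_exp (1 + ‖x‖) (by positivity) k
  have h0 : (0 : ℝ) < k.factorial := by exact_mod_cast k.factorial_pos
  rw [div_le_iff₀ h0] at h1
  have h2 : Real.exp (-Real.pi * ‖x‖ ^ 2) * Real.exp (1 + ‖x‖) ≤ Real.exp 2 := by
    rw [← Real.exp_add]
    refine Real.exp_le_exp.2 ?_
    nlinarith [Real.pi_gt_three, sq_nonneg (‖x‖ - 1), sq_nonneg ‖x‖]
  rw [Real.rpow_neg (by positivity), Real.rpow_natCast, ← div_eq_mul_inv,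
    le_div_iff₀ (by positivity), Real.norm_of_nonneg (Real.exp_pos _).le]
  calc _ ≤ Real.exp (-Real.pi * ‖x‖ ^ 2) * (Real.exp (1 + ‖x‖) * k.factorial) := by gcongr
    _ = (Real.exp (-Real.pi * ‖x‖ ^ 2) * Real.exp (1 + ‖x‖)) * k.factorial := by ring
    _ ≤ Real.exp 2 * k.factorial := by gcongr
    _ = _ := mul_comm _ _

lemma integrable_norm_rpow_mul_one_add_norm_rpow {E : Type*} [NormedAddCommGroup E]
    [NormedSpace ℝ E] [MeasurableSpace E] [BorelSpace E] [FiniteDimensional ℝ E] [Nontrivial E]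
    (μ : Measure E) [μ.IsAddHaarMeasure] {a k : ℝ} (ha : -(finrank ℝ E : ℝ) < a)
    (hk : finrank ℝ E + a < k) :
    Integrable (fun x ↦ ‖x‖ ^ a * (1 + ‖x‖) ^ (-k)) μ := by
  rw [integrable_fun_norm_addHaar μ (f := fun r ↦ r ^ a * (1 + r) ^ (-k))]
  set d := finrank ℝ E with hd
  have hd1 : 1 ≤ d := Module.finrank_pos
  have hm : AEStronglyMeasurable (fun r : ℝ ↦ r ^ (d - 1) • (r ^ a * (1 + r) ^ (-k))) volume := by
    refine Measurable.aestronglyMeasurable ?_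
    fun_prop
  have h0 (r : ℝ) (hr : 0 < r) : ‖r ^ (d - 1) • (r ^ a * (1 + r) ^ (-k))‖ =
      r ^ ((d : ℝ) - 1 + a) * (1 + r) ^ (-k) := by
    rw [Real.norm_of_nonneg (by positivity), smul_eq_mul, ← mul_assoc, Real.rpow_add hr]
    rw [← Real.rpow_natCast, Nat.cast_sub hd1, Nat.cast_one]
  have hk0 : 0 < k := by linarith
  rw [← Set.Ioc_union_Ioi_eq_Ioi (zero_le_one' ℝ)]
  refine IntegrableOn.union ?_ ?_
  · have h1 : IntegrableOn (fun r : ℝ ↦ r ^ ((d : ℝ) - 1 + a)) (Set.Ioc 0 1) := by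
      rw [← intervalIntegrable_iff_integrableOn_Ioc_of_le zero_le_one]
      exact intervalIntegral.intervalIntegrable_rpow' (by linarith)
    refine h1.mono' hm.restrict ((ae_restrict_iff' measurableSet_Ioc).2 (ae_of_all _ fun r hr ↦ ?_))
    rw [h0 r hr.1]
    refine mul_le_of_le_one_right (Real.rpow_nonneg hr.1.le _) ?_
    exact Real.rpow_le_one_of_one_le_of_nonpos (by linarith [hr.1]) (by linarith)
  · have h1 : IntegrableOn (fun r : ℝ ↦ r ^ ((d : ℝ) - 1 + a - k)) (Set.Ioi 1) :=
      integrableOn_Ioi_rpow_of_lt (by linarith) one_pos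
    refine h1.mono' hm.restrict ((ae_restrict_iff' measurableSet_Ioi).2 (ae_of_all _ fun r hr ↦ ?_))
    have hr0 : 0 < r := one_pos.trans hr
    rw [h0 r hr0, sub_eq_add_neg _ k, Real.rpow_add hr0 _ (-k)]
    have h2 : (1 + r) ^ (-k) ≤ r ^ (-k) :=
      Real.rpow_le_rpow_of_nonpos hr0 (by linarith) (by linarith)
    exact mul_le_mul_of_nonneg_left h2 (Real.rpow_nonneg hr0.le _)

lemma RapidDecay.exists_integrable_bound {E F : Type*} [NormedAddCommGroup E]
    [NormedSpace ℝ E] [MeasurableSpace E] [BorelSpace E] [FiniteDimensional ℝ E] [Nontrivial E]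
    (μ : Measure E) [μ.IsAddHaarMeasure] [Norm F] {f : E → F} (hf : RapidDecay f)
    {a : ℝ} (ha : -(finrank ℝ E : ℝ) < a) :
    ∃ h : ℝ → ℝ, Measurable h ∧ (∀ x, ‖f x‖ ≤ h ‖x‖) ∧ (∀ r, 0 ≤ r → 0 ≤ h r) ∧
      Integrable (fun x ↦ ‖x‖ ^ a * h ‖x‖) μ := by
  obtain ⟨k, hk⟩ := exists_nat_gt (finrank ℝ E + a)
  obtain ⟨B, hB⟩ := hf k
  refine ⟨fun r ↦ |B| * (1 + r) ^ (-(k : ℝ)), by fun_prop, fun x ↦ (hB x).trans ?_,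
    fun r hr ↦ by positivity, ?_⟩
  · exact mul_le_mul_of_nonneg_right (le_abs_self B) (by positivity)
  · refine ((integrable_norm_rpow_mul_one_add_norm_rpow μ ha hk).const_mul |B|).congr
      (ae_of_all _ fun x ↦ ?_)
    simp only
    ring

lemma RapidDecay.integrable_norm_rpow_smul {E F : Type*} [NormedAddCommGroup E]
    [NormedSpace ℝ E] [MeasurableSpace E] [BorelSpace E] [FiniteDimensional ℝ E] [Nontrivial E]
    {μ : Measure E} [μ.IsAddHaarMeasure] [NormedAddCommGroup F] [NormedSpace ℝ F] {f : E → F}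
    (hf : RapidDecay f) (hfc : Continuous f) {a : ℝ} (ha : -(finrank ℝ E : ℝ) < a) :
    Integrable (fun x ↦ ‖x‖ ^ a • f x) μ := by
  obtain ⟨h, -, hfh, -, hi⟩ := hf.exists_integrable_bound μ ha
  refine hi.mono' ?_ (ae_of_all _ fun x ↦ ?_)
  · exact (Measurable.aestronglyMeasurable (by fun_prop)).smul hfc.aestronglyMeasurable
  · rw [norm_smul, Real.norm_of_nonneg (by positivity)]
    gcongr
    exact hfh x

namespace IsSymmBody

variable {n : ℕ} {K : Set (Euc n)}

lemma exists_gauge_rpow_neg_le (hK : IsSymmBody K) {p : ℝ} (hp : 0 ≤ p) :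
    ∃ c > 0, ∀ x, gauge K x ^ (-p) ≤ c * ‖x‖ ^ (-p) := by
  obtain ⟨c, hc, h⟩ := hK.exists_mul_norm_le_gauge
  refine ⟨c ^ (-p), by positivity, fun x ↦ ?_⟩
  rcases eq_or_ne x 0 with rfl | hx
  · rcases hp.eq_or_lt with rfl | hp
    · simp
    · rw [gauge_zero, norm_zero, Real.zero_rpow (by linarith)]
      simp
  · have := norm_pos_iff.2 hx
    rw [← Real.mul_rpow hc.le (norm_nonneg _)]
    exact Real.rpow_le_rpow_of_nonpos (by positivity) (h x) (by linarith)

lemma integrable_gauge_rpow_smul (hK : IsSymmBody K) {F : Type*} [NormedAddCommGroup F]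
    [NormedSpace ℝ F] {f : Euc n → F} (hf : RapidDecay f) (hfc : Continuous f) {p : ℝ}
    (hp : 0 ≤ p) (hpn : p < n) :
    Integrable fun x ↦ gauge K x ^ (-p) • f x := by
  have hn : n ≠ 0 := by rintro rfl; simp at hpn; linarith
  have : Nonempty (Fin n) := Fin.pos_iff_nonempty.1 (Nat.pos_of_ne_zero hn)
  obtain ⟨c, hc, h⟩ := hK.exists_gauge_rpow_neg_le hp
  have h1 := (hf.integrable_norm_rpow_smul (μ := volume) hfc (a := -p) (by simpa using hpn)).norm
  refine (h1.const_mul c).mono' ?_ (ae_of_all _ fun x ↦ ?_)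
  · have := hK.continuous_gauge
    exact (Measurable.aestronglyMeasurable (by fun_prop)).smul hfc.aestronglyMeasurable
  · rw [norm_smul, norm_smul, Real.norm_of_nonneg (Real.rpow_nonneg (gauge_nonneg _) _),
      Real.norm_of_nonneg (by positivity), ← mul_assoc]
    gcongr
    exact h x

lemma hatTransform_nonneg (hK : IsSymmBody K) (ξ : Euc n) : 0 ≤ hatTransform K ξ :=
  integral_mexicanHat_inner_nonneg hK.convex hK.isCompact hK.neg_mem ξ

lemma continuous_hatTransform (hK : IsSymmBody K) : Continuous (hatTransform K) :=
  _root_.continuous_hatTransform hK.isCompact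

lemma hatConst_smul_integral_gauge_rpow (hK : IsSymmBody K) (hn : n ≠ 0) {p : ℝ} (hp : 0 < p)
    (h3 : (n : ℝ) - 3 < p) {φ : Euc n → ℂ} (hφc : Continuous φ)
    (hφi : Integrable fun y ↦ gauge K y ^ (-p) • φ y) :
    (hatConst n p).toReal • ∫ y, gauge K y ^ (-p) • φ y =
      ∫ t : ℝ, |t| ^ (p - 1 - n) • ∫ z, φ ((z.2 / t) • z.1)
        ∂((volume.restrict K).prod hatMeasure) := by
  have hg := hK.continuous_gauge.measurable
  have hT : Measurable fun z : ℝ × (Euc n × ℝ) ↦ (z.2.2 / z.1) • z.2.1 := by fun_prop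
  have hmap := map_sourceMeasure hn hK hp
  have hw : Measurable fun y ↦ ENNReal.ofReal (gauge K y ^ (-p)) := by fun_prop
  have hr (y : Euc n) : (ENNReal.ofReal (gauge K y ^ (-p))).toReal = gauge K y ^ (-p) :=
    ENNReal.toReal_ofReal (Real.rpow_nonneg (gauge_nonneg _) _)
  have h1 : ∫ y, φ y ∂((sourceMeasure p K).map fun z ↦ (z.2.2 / z.1) • z.2.1) =
      (hatConst n p).toReal • ∫ y, gauge K y ^ (-p) • φ y := by
    rw [hmap, integral_smul_measure, integral_withDensity_eq_integral_toReal_smul hw (by simp)]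
    simp_rw [hr]
  have h2 : Integrable (fun z : ℝ × (Euc n × ℝ) ↦ φ ((z.2.2 / z.1) • z.2.1))
      (sourceMeasure p K) := by
    refine (integrable_map_measure hφc.aestronglyMeasurable hT.aemeasurable).1 ?_
    rw [hmap, integrable_smul_measure (hatConst_ne_zero n hp) (hatConst_ne_top h3),
      integrable_withDensity_iff_integrable_smul' hw (by simp)]
    simpa only [hr] using hφi
  rw [← h1, integral_map hT.aemeasurable hφc.aestronglyMeasurable, sourceMeasure,
    integral_prod _ h2, integral_withDensity_eq_integral_toReal_smul (by fun_prop) (by simp)]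
  refine integral_congr_ae (ae_of_all _ fun t ↦ ?_)
  simp only
  rw [ENNReal.toReal_ofReal (by positivity)]

lemma hatConst_smul_integral_gauge_rpow_eq (hK : IsSymmBody K) (hn : n ≠ 0) {p : ℝ} (hp : 0 < p)
    (h3 : (n : ℝ) - 3 < p) {φ ψ : Euc n → ℂ} (hφc : Continuous φ)
    (hφi : Integrable fun y ↦ gauge K y ^ (-p) • φ y) (hψ : Integrable ψ)
    (hφ : ∀ w, ∫ ξ, Complex.exp (2 * Real.pi * Complex.I * (⟪w, ξ⟫ : ℝ)) * ψ ξ = φ w) :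
    (hatConst n p).toReal • ∫ y, gauge K y ^ (-p) • φ y =
      ∫ t : ℝ, |t| ^ (p - 1) • ∫ ξ, hatTransform K ξ • ψ (t • ξ) := by
  rw [hK.hatConst_smul_integral_gauge_rpow hn hp h3 hφc hφi]
  refine integral_congr_ae ?_
  filter_upwards [Measure.ae_ne volume (0 : ℝ)] with t ht
  rw [integral_hatTransform_smul hK.isCompact hψ hφ ht, smul_smul,
    Real.rpow_sub (abs_pos.2 ht) (p - 1), Real.rpow_natCast, div_eq_mul_inv]

end IsSymmBody

lemma integral_exp_mul_gaussian {n : ℕ} (w : Euc n) :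
    ∫ ξ : Euc n, Complex.exp (2 * Real.pi * Complex.I * (⟪w, ξ⟫ : ℝ)) *
      (Real.exp (-Real.pi * ‖ξ‖ ^ 2) : ℝ) = (Real.exp (-Real.pi * ‖w‖ ^ 2) : ℝ) := by
  have hpi : (Real.pi : ℂ) ≠ 0 := by exact_mod_cast Real.pi_ne_zero
  have h := GaussianFourier.integral_cexp_neg_mul_sq_norm_add (b := Real.pi) (V := Euc n)
    (by simpa using Real.pi_pos) (2 * Real.pi * Complex.I) w
  rw [div_self hpi, Complex.one_cpow, one_mul] at h
  convert! h using 1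
  · refine integral_congr_ae (ae_of_all _ fun ξ ↦ ?_)
    simp only
    push_cast
    rw [← Complex.exp_add, add_comm]
  · push_cast
    congr 1
    rw [mul_pow, mul_pow, Complex.I_sq]
    field_simp
    ring

lemma integrable_gaussian {n : ℕ} : Integrable fun x : Euc n ↦ Real.exp (-Real.pi * ‖x‖ ^ 2) := by
  have h := GaussianFourier.integrable_cexp_neg_mul_sq_norm_add (b := Real.pi) (V := Euc n)
    (by simpa using Real.pi_pos) 0 0
  have h2 := h.re
  refine h2.congr (ae_of_all _ fun x ↦ ?_)
  simp only [zero_mul, add_zero]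
  have h3 : (-Real.pi * ‖x‖ ^ 2 : ℂ) = ((-Real.pi * ‖x‖ ^ 2 : ℝ) : ℂ) := by push_cast; rfl
  rw [h3]
  exact Complex.exp_ofReal_re _

namespace IsSymmBody

variable {n : ℕ} {K : Set (Euc n)}

lemma lintegral_hatTransform_mul_gaussian (hK : IsSymmBody K) {t : ℝ} (ht : t ≠ 0) :
    ∫⁻ ξ, ENNReal.ofReal (hatTransform K ξ) * ENNReal.ofReal (Real.exp (-Real.pi * ‖t • ξ‖ ^ 2)) =
      ENNReal.ofReal (|t| ^ n)⁻¹ * ∫⁻ z, ENNReal.ofReal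
        (Real.exp (-Real.pi * ‖(z.2 / t) • z.1‖ ^ 2)) ∂((volume.restrict K).prod hatMeasure) := by
  have : IsFiniteMeasure (volume.restrict K) :=
    isFiniteMeasure_restrict.2 hK.isCompact.measure_lt_top.ne
  have h1 := integral_hatTransform_smul hK.isCompact
    (ψ := fun ξ ↦ ((Real.exp (-Real.pi * ‖ξ‖ ^ 2) : ℝ) : ℂ)) integrable_gaussian.ofReal
    integral_exp_mul_gaussian ht
  simp_rw [Complex.real_smul, ← Complex.ofReal_mul] at h1
  rw [integral_complex_ofReal, integral_complex_ofReal, ← Complex.ofReal_mul,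
    Complex.ofReal_inj] at h1
  have hi1 : Integrable fun ξ ↦ hatTransform K ξ * Real.exp (-Real.pi * ‖t • ξ‖ ^ 2) := by
    refine (integrable_gaussian.comp_smul ht).bdd_mul
      (c := 2 * (volume K).toReal) hK.continuous_hatTransform.aestronglyMeasurable
      (ae_of_all _ fun ξ ↦ abs_hatTransform_le hK.isCompact ξ)
  have hi2 : Integrable (fun z : Euc n × ℝ ↦ Real.exp (-Real.pi * ‖(z.2 / t) • z.1‖ ^ 2))
      ((volume.restrict K).prod hatMeasure) := by
    refine Integrable.of_bound (Measurable.aestronglyMeasurable (by fun_prop)) 1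
      (ae_of_all _ fun z ↦ ?_)
    rw [Real.norm_of_nonneg (Real.exp_pos _).le, Real.exp_le_one_iff]
    have := Real.pi_pos
    simp only [neg_mul, Left.neg_nonpos_iff]
    positivity
  simp_rw [← ENNReal.ofReal_mul (hK.hatTransform_nonneg _)]
  rw [← ofReal_integral_eq_lintegral_ofReal hi1 (ae_of_all _ fun ξ ↦
    mul_nonneg (hK.hatTransform_nonneg _) (Real.exp_pos _).le),
    ← ofReal_integral_eq_lintegral_ofReal hi2 (ae_of_all _ fun ξ ↦ (Real.exp_pos _).le),
    ← ENNReal.ofReal_mul (by positivity), h1]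

/-- The total mass of the density `hatTransform K ξ * ‖ξ‖ ^ (-p)`. -/
lemma hatConst_mul_lintegral_gauge_rpow_mul_gaussian (hK : IsSymmBody K) (hn : n ≠ 0) {p : ℝ}
    (hp : 0 < p) :
    hatConst n p * ∫⁻ y, ENNReal.ofReal (gauge K y ^ (-p)) *
        ENNReal.ofReal (Real.exp (-Real.pi * ‖y‖ ^ 2)) =
      (∫⁻ ξ, ENNReal.ofReal (hatTransform K ξ) * ENNReal.ofReal (‖ξ‖ ^ (-p))) *
        ∫⁻ t : ℝ, ENNReal.ofReal (|t| ^ (p - 1)) * ENNReal.ofReal (Real.exp (-Real.pi * t ^ 2)) := by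
  have : Nonempty (Fin n) := Fin.pos_iff_nonempty.1 (Nat.pos_of_ne_zero hn)
  have hg := hK.continuous_gauge.measurable
  have hG := hK.continuous_hatTransform.measurable
  have hT : Measurable fun z : ℝ × (Euc n × ℝ) ↦ (z.2.2 / z.1) • z.2.1 := by fun_prop
  have hγ : Measurable fun y : Euc n ↦ ENNReal.ofReal (Real.exp (-Real.pi * ‖y‖ ^ 2)) := by
    fun_prop
  have hγT : Measurable fun z : ℝ × (Euc n × ℝ) ↦
      ENNReal.ofReal (Real.exp (-Real.pi * ‖(z.2.2 / z.1) • z.2.1‖ ^ 2)) := hγ.comp hT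
  have h1 : ∫⁻ y, ENNReal.ofReal (Real.exp (-Real.pi * ‖y‖ ^ 2))
      ∂((sourceMeasure p K).map fun z ↦ (z.2.2 / z.1) • z.2.1) =
      hatConst n p * ∫⁻ y, ENNReal.ofReal (gauge K y ^ (-p)) *
        ENNReal.ofReal (Real.exp (-Real.pi * ‖y‖ ^ 2)) := by
    rw [map_sourceMeasure hn hK hp, lintegral_smul_measure,
      lintegral_withDensity_eq_lintegral_mul _ (by fun_prop) hγ, smul_eq_mul]
    rfl
  rw [← h1, lintegral_map hγ hT, sourceMeasure, lintegral_prod _ hγT.aemeasurable,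
    lintegral_withDensity_eq_lintegral_mul _ (by fun_prop) (Measurable.lintegral_prod_right' hγT)]
  have h2 : ∀ᵐ t : ℝ, ((fun t : ℝ ↦ ENNReal.ofReal (|t| ^ (p - 1 - n))) * fun t ↦
      ∫⁻ z, ENNReal.ofReal (Real.exp (-Real.pi * ‖(z.2 / t) • z.1‖ ^ 2))
        ∂((volume.restrict K).prod hatMeasure)) t =
      ∫⁻ ξ, ENNReal.ofReal (hatTransform K ξ) * (ENNReal.ofReal (|t| ^ (p - 1)) *
        ENNReal.ofReal (Real.exp (-Real.pi * (‖ξ‖ * t) ^ 2))) := by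
    filter_upwards [Measure.ae_ne volume (0 : ℝ)] with t ht
    have hms : Measurable fun ξ ↦ ENNReal.ofReal (hatTransform K ξ) *
        ENNReal.ofReal (Real.exp (-Real.pi * ‖t • ξ‖ ^ 2)) := by fun_prop
    rw [Pi.mul_apply, Real.rpow_sub (abs_pos.2 ht) (p - 1), Real.rpow_natCast, div_eq_mul_inv,
      ENNReal.ofReal_mul (by positivity), mul_assoc, ← hK.lintegral_hatTransform_mul_gaussian ht,
      ← lintegral_const_mul _ hms]
    refine lintegral_congr fun ξ ↦ ?_
    rw [norm_smul, mul_pow, mul_pow, Real.norm_eq_abs, sq_abs, mul_comm (t ^ 2)]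
    ring
  rw [lintegral_congr_ae h2, lintegral_lintegral_swap (Measurable.aemeasurable (by fun_prop)),
    ← lintegral_mul_const _ (by fun_prop)]
  refine lintegral_congr_ae ?_
  filter_upwards [Measure.ae_ne volume (0 : Euc n)] with ξ hξ
  rw [lintegral_const_mul _ (by fun_prop), mul_assoc]
  congr 1
  exact lintegral_abs_rpow_mul_comp (h := fun t ↦ ENNReal.ofReal (Real.exp (-Real.pi * t ^ 2)))
    (by fun_prop) (norm_pos_iff.2 hξ)

end IsSymmBody

/-- The Gaussian moment `∫ |t| ^ (p - 1) exp (-π t ^ 2) dt`. -/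
def gaussMoment (p : ℝ) : ℝ≥0∞ :=
  ∫⁻ t : ℝ, ENNReal.ofReal (|t| ^ (p - 1)) * ENNReal.ofReal (Real.exp (-Real.pi * t ^ 2))

lemma gaussMoment_ne_zero (p : ℝ) : gaussMoment p ≠ 0 := by
  intro h
  rw [gaussMoment, lintegral_eq_zero_iff (by fun_prop)] at h
  obtain ⟨u, hu, hu'⟩ := (h.and (Measure.ae_ne volume 0)).exists
  have hu0 := abs_pos.2 hu'
  have h3 : 0 < |u| ^ (p - 1) * Real.exp (-Real.pi * u ^ 2) := by positivity
  simp only [Pi.zero_apply] at hu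
  rw [← ENNReal.ofReal_mul (by positivity), ENNReal.ofReal_eq_zero] at hu
  linarith

namespace RapidDecay

variable {E : Type*} [NormedAddCommGroup E] [NormedSpace ℝ E] {ψ : E → ℂ}

lemma exists_integrable_abs_rpow_bound (hψ : RapidDecay ψ) (p : ℝ) :
    ∃ h : ℝ → ℝ, Measurable h ∧ (∀ r, 0 ≤ r → 0 ≤ h r) ∧
      (∀ (t : ℝ) (x : E), ‖ψ (t • x)‖ ≤ h (‖x‖ * |t|)) ∧
      ∀ q, 0 < q → q ≤ p → Integrable fun t : ℝ ↦ |t| ^ (q - 1) * h |t| := by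
  obtain ⟨k, hk⟩ := exists_nat_gt p
  obtain ⟨B, hB⟩ := hψ k
  refine ⟨fun r ↦ |B| * (1 + r) ^ (-(k : ℝ)), by fun_prop, fun r hr ↦ by positivity,
    fun t x ↦ (hB _).trans ?_, fun q hq hqp ↦ ?_⟩
  · rw [norm_smul, mul_comm ‖t‖, Real.norm_eq_abs]
    exact mul_le_mul_of_nonneg_right (le_abs_self B) (by positivity)
  · have h1 := integrable_norm_rpow_mul_one_add_norm_rpow (E := ℝ) volume (a := q - 1) (k := k)
      (by simpa using hq) (by simpa using hqp.trans_lt hk)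
    refine (h1.const_mul |B|).congr (ae_of_all _ fun x ↦ ?_)
    simp only [Real.norm_eq_abs]
    ring

lemma continuous_integral_abs_rpow_smul (hψ : RapidDecay ψ) (hψc : Continuous ψ) {p : ℝ}
    (hp : 0 < p) :
    Continuous fun θ : sphere (0 : E) 1 ↦ ∫ t : ℝ, |t| ^ (p - 1) • ψ (t • (θ : E)) := by
  obtain ⟨h, -, -, hh, hi⟩ := hψ.exists_integrable_abs_rpow_bound p
  refine continuous_of_dominated (fun θ ↦ ?_) (fun θ ↦ ae_of_all _ fun t ↦ ?_)
    (hi p hp le_rfl)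
    (ae_of_all _ fun t ↦ by fun_prop)
  · have h1 : Measurable fun t : ℝ ↦ |t| ^ (p - 1) := by fun_prop
    have h2 : Continuous fun t : ℝ ↦ ψ (t • (θ : E)) := by fun_prop
    exact h1.aestronglyMeasurable.smul h2.aestronglyMeasurable
  · rw [norm_smul, Real.norm_of_nonneg (by positivity)]
    gcongr
    simpa using hh t θ

end RapidDecay

lemma integral_abs_rpow_smul_comp_smul {E F : Type*} [NormedAddCommGroup E] [NormedSpace ℝ E]
    [NormedAddCommGroup F] [NormedSpace ℝ F] (ψ : E → F) (p : ℝ) {ξ : E} (hξ : ξ ≠ 0) :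
    ∫ t : ℝ, |t| ^ (p - 1) • ψ (t • ξ) =
      ‖ξ‖ ^ (-p) • ∫ t : ℝ, |t| ^ (p - 1) • ψ (t • ‖ξ‖⁻¹ • ξ) := by
  have hr : 0 < ‖ξ‖ := norm_pos_iff.2 hξ
  have h1 := Measure.integral_comp_smul (volume : Measure ℝ)
    (fun t ↦ |t| ^ (p - 1) • ψ (t • ‖ξ‖⁻¹ • ξ)) ‖ξ‖
  have h2 (t : ℝ) : |‖ξ‖ • t| ^ (p - 1) • ψ ((‖ξ‖ • t) • ‖ξ‖⁻¹ • ξ) =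
      ‖ξ‖ ^ (p - 1) • |t| ^ (p - 1) • ψ (t • ξ) := by
    have h3 : (‖ξ‖ • t) • ‖ξ‖⁻¹ • ξ = t • ξ := by
      rw [smul_smul, smul_eq_mul, mul_comm ‖ξ‖ t, mul_assoc, mul_inv_cancel₀ hr.ne', mul_one]
    rw [h3, smul_eq_mul, abs_mul, abs_of_pos hr, Real.mul_rpow hr.le (abs_nonneg _), mul_smul]
  simp_rw [h2] at h1
  rw [integral_smul, finrank_self, pow_one, abs_of_pos (by positivity)] at h1
  have h3 : ‖ξ‖ ^ (1 - p) * ‖ξ‖ ^ (p - 1) = 1 := by rw [← Real.rpow_add hr]; simp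
  have h4 : ‖ξ‖ ^ (-p) = ‖ξ‖ ^ (1 - p) * ‖ξ‖⁻¹ := by
    rw [← Real.rpow_neg_one, ← Real.rpow_add hr]; ring_nf
  rw [h4, mul_smul, ← h1, smul_smul, h3, one_smul]

namespace IsSymmBody

variable {n : ℕ} {K : Set (Euc n)}

lemma lintegral_gauge_rpow_mul_gaussian_ne_top (hK : IsSymmBody K) {p : ℝ} (hp : 0 ≤ p)
    (hpn : p < n) :
    ∫⁻ y, ENNReal.ofReal (gauge K y ^ (-p)) *
      ENNReal.ofReal (Real.exp (-Real.pi * ‖y‖ ^ 2)) ≠ ∞ := by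
  have h1 := (hK.integrable_gauge_rpow_smul rapidDecay_gaussian (by fun_prop) hp hpn).2
  have h2 (y : Euc n) := Real.rpow_nonneg (gauge_nonneg (s := K) y) (-p)
  rw [hasFiniteIntegral_iff_ofReal (ae_of_all _ fun y ↦
    smul_nonneg (h2 y) (Real.exp_pos _).le)] at h1
  simpa only [smul_eq_mul, ENNReal.ofReal_mul (h2 _)] using h1.ne

lemma lintegral_hatTransform_mul_norm_rpow_ne_top (hK : IsSymmBody K) (hn : n ≠ 0) {p : ℝ}
    (hp : 0 < p) (h3 : (n : ℝ) - 3 < p) (hpn : p < n) :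
    ∫⁻ ξ, ENNReal.ofReal (hatTransform K ξ) * ENNReal.ofReal (‖ξ‖ ^ (-p)) ≠ ∞ := by
  intro h
  have h1 := hK.hatConst_mul_lintegral_gauge_rpow_mul_gaussian hn hp
  rw [h, ← gaussMoment, ENNReal.top_mul (gaussMoment_ne_zero p)] at h1
  exact ENNReal.mul_ne_top (hatConst_ne_top h3)
    (hK.lintegral_gauge_rpow_mul_gaussian_ne_top hp.le hpn) h1

lemma integral_hatTransform_swap (hK : IsSymmBody K) (hn : n ≠ 0) {p : ℝ}
    (hp : 0 < p) (h3 : (n : ℝ) - 3 < p) (hpn : p < n) {ψ : Euc n → ℂ} (hψ : RapidDecay ψ)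
    (hψc : Continuous ψ) :
    ∫ t : ℝ, |t| ^ (p - 1) • ∫ ξ, hatTransform K ξ • ψ (t • ξ) =
      ∫ ξ, hatTransform K ξ • ∫ t : ℝ, |t| ^ (p - 1) • ψ (t • ξ) := by
  have : Nonempty (Fin n) := Fin.pos_iff_nonempty.1 (Nat.pos_of_ne_zero hn)
  have hG := hK.continuous_hatTransform
  obtain ⟨h, hm, hh0, hh, hi⟩ := hψ.exists_integrable_abs_rpow_bound p
  simp_rw [← integral_smul]
  rw [integral_integral_swap]
  · simp_rw [smul_comm (hatTransform K _)]
  have hmeas : AEStronglyMeasurable (Function.uncurry fun (t : ℝ) (ξ : Euc n) ↦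
      |t| ^ (p - 1) • hatTransform K ξ • ψ (t • ξ)) (volume.prod volume) := by
    have h1 : Measurable fun z : ℝ × Euc n ↦ |z.1| ^ (p - 1) := by fun_prop
    have h2 : Continuous fun z : ℝ × Euc n ↦ hatTransform K z.2 • ψ (z.1 • z.2) := by fun_prop
    exact h1.aestronglyMeasurable.smul h2.aestronglyMeasurable
  refine ⟨hmeas, ?_⟩
  rw [HasFiniteIntegral, lintegral_prod_symm _ hmeas.enorm]
  have h1 : ∫⁻ t : ℝ, ENNReal.ofReal (|t| ^ (p - 1)) * ENNReal.ofReal (h |t|) ≠ ∞ := by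
    have h2 := (hi p hp le_rfl).2
    rw [hasFiniteIntegral_iff_ofReal (ae_of_all _ fun t ↦
      mul_nonneg (by positivity) (hh0 _ (abs_nonneg t)))] at h2
    simpa only [ENNReal.ofReal_mul (Real.rpow_nonneg (abs_nonneg _) _)] using h2.ne
  have h2 := ENNReal.mul_ne_top (hK.lintegral_hatTransform_mul_norm_rpow_ne_top hn hp h3 hpn) h1
  rw [← lintegral_mul_const _ (by fun_prop)] at h2
  refine (lintegral_mono_ae ?_).trans_lt h2.lt_top
  filter_upwards [Measure.ae_ne volume (0 : Euc n)] with ξ hξ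
  have hm' : Measurable fun t : ℝ ↦ ENNReal.ofReal (h |t|) := by fun_prop
  rw [mul_assoc, ← lintegral_abs_rpow_mul_comp hm' (norm_pos_iff.2 hξ),
    ← lintegral_const_mul _ (by fun_prop)]
  refine lintegral_mono fun t ↦ ?_
  simp only [Function.uncurry_apply_pair]
  rw [enorm_smul, enorm_smul, Real.enorm_of_nonneg (by positivity),
    Real.enorm_of_nonneg (hK.hatTransform_nonneg ξ), mul_left_comm, abs_mul, abs_norm]
  gcongr
  rw [← ofReal_norm]
  exact ENNReal.ofReal_le_ofReal (hh t ξ)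

/-- The representing measure, away from the endpoint, together with its total mass. -/
lemma exists_measure_sphere (hK : IsSymmBody K) (hn : n ≠ 0) {p : ℝ}
    (hp : 0 < p) (h3 : (n : ℝ) - 3 < p) (hpn : p < n) :
    ∃ μ : Measure (sphere (0 : Euc n) 1), IsFiniteMeasure μ ∧
      (∀ φ : SchwartzMap (Euc n) ℂ, ∫ x, gauge K x ^ (-p) • φ x =
        ∫ θ, (∫ t : ℝ, |t| ^ (p - 1) • 𝓕 (⇑φ) (t • (θ : Euc n))) ∂μ) ∧
      μ Set.univ * gaussMoment p = ∫⁻ y, ENNReal.ofReal (gauge K y ^ (-p)) *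
        ENNReal.ofReal (Real.exp (-Real.pi * ‖y‖ ^ 2)) := by
  have : Nonempty (Fin n) := Fin.pos_iff_nonempty.1 (Nat.pos_of_ne_zero hn)
  obtain ⟨θ₀, hθ₀⟩ : (sphere (0 : Euc n) 1).Nonempty := NormedSpace.sphere_nonempty.2 zero_le_one
  set g : Euc n → Euc n := fun ξ ↦ if ξ = 0 then θ₀ else ‖ξ‖⁻¹ • ξ with hg
  have hgm : Measurable g := Measurable.ite (measurableSet_singleton 0) measurable_const
    (by fun_prop)
  have hgs (ξ : Euc n) : g ξ ∈ sphere (0 : Euc n) 1 := by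
    by_cases hξ : ξ = 0
    · simpa [hg, hξ] using hθ₀
    · simp [hg, hξ, norm_smul]
  set N : Euc n → sphere (0 : Euc n) 1 := fun ξ ↦ ⟨g ξ, hgs ξ⟩ with hN
  have hNm : Measurable N := hgm.subtype_mk
  have hG := hK.continuous_hatTransform
  set d : Euc n → ℝ≥0∞ := fun ξ ↦
    ENNReal.ofReal (hatTransform K ξ) * ENNReal.ofReal (‖ξ‖ ^ (-p)) with hd
  have hdm : Measurable d := by fun_prop
  have hC0 := hatConst_ne_zero n hp
  have hCt := hatConst_ne_top h3
  have hfin : IsFiniteMeasure (volume.withDensity d) := isFiniteMeasure_withDensity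
    (hK.lintegral_hatTransform_mul_norm_rpow_ne_top hn hp h3 hpn)
  refine ⟨(hatConst n p)⁻¹ • (volume.withDensity d).map N, ?_, fun φ ↦ ?_, ?_⟩
  · exact Measure.smul_finite _ (ENNReal.inv_ne_top.2 hC0)
  · set ψ : SchwartzMap (Euc n) ℂ := 𝓕 φ with hψ
    have hψφ : ⇑ψ = 𝓕 (⇑φ) := SchwartzMap.fourier_coe φ
    rw [← hψφ]
    have hinv (w : Euc n) :
        ∫ ξ, Complex.exp (2 * Real.pi * Complex.I * (⟪w, ξ⟫ : ℝ)) * ψ ξ = φ w := by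
      have h1 := φ.continuous.fourierInv_fourier_eq φ.integrable
        (by rw [← hψφ]; exact ψ.integrable)
      rw [← h1, ← hψφ, Real.fourierInv_eq']
      refine integral_congr_ae (ae_of_all _ fun ξ ↦ ?_)
      simp only [smul_eq_mul, real_inner_comm]
      congr 2
      push_cast
      ring
    have h1 := hK.hatConst_smul_integral_gauge_rpow_eq hn hp h3 φ.continuous
      (hK.integrable_gauge_rpow_smul φ.rapidDecay φ.continuous hp.le hpn) ψ.integrable hinv
    rw [hK.integral_hatTransform_swap hn hp h3 hpn ψ.rapidDecay ψ.continuous] at h1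
    rw [integral_smul_measure, integral_map hNm.aemeasurable
      (ψ.rapidDecay.continuous_integral_abs_rpow_smul ψ.continuous hp).aestronglyMeasurable,
      integral_withDensity_eq_integral_toReal_smul hdm
        (ae_of_all _ fun ξ ↦ ENNReal.mul_lt_top ENNReal.ofReal_lt_top ENNReal.ofReal_lt_top)]
    have h2 : ∫ ξ, (d ξ).toReal • ∫ t : ℝ, |t| ^ (p - 1) • ψ (t • (N ξ : Euc n)) =
        ∫ ξ, hatTransform K ξ • ∫ t : ℝ, |t| ^ (p - 1) • ψ (t • ξ) := by
      refine integral_congr_ae ?_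
      filter_upwards [Measure.ae_ne volume (0 : Euc n)] with ξ hξ
      rw [integral_abs_rpow_smul_comp_smul ψ p hξ, smul_smul]
      simp only [hd, hN, hg, hξ, if_false]
      rw [ENNReal.toReal_mul, ENNReal.toReal_ofReal (hK.hatTransform_nonneg ξ),
        ENNReal.toReal_ofReal (by positivity)]
    rw [h2, ← h1, smul_smul, ENNReal.toReal_inv, inv_mul_cancel₀, one_smul]
    exact (ENNReal.toReal_pos hC0 hCt).ne'
  · rw [Measure.smul_apply, Measure.map_apply hNm MeasurableSet.univ, Set.preimage_univ,
      withDensity_apply _ MeasurableSet.univ, Measure.restrict_univ, smul_eq_mul, mul_assoc,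
      gaussMoment, ← hK.hatConst_mul_lintegral_gauge_rpow_mul_gaussian hn hp, ← mul_assoc,
      ENNReal.inv_mul_cancel hC0 hCt, one_mul]

end IsSymmBody

lemma rpow_le_rpow_add_rpow {x a b c : ℝ} (hx : 0 ≤ x) (hb : b ≠ 0) (hab : a ≤ b) (hbc : b ≤ c) :
    x ^ b ≤ x ^ a + x ^ c := by
  rcases hx.eq_or_lt with rfl | hx'
  · rw [Real.zero_rpow hb]
    positivity
  rcases le_total x 1 with h | h
  · exact (Real.rpow_le_rpow_of_exponent_ge hx' h hab).trans
      (le_add_of_nonneg_right (by positivity))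
  · exact (Real.rpow_le_rpow_of_exponent_le h hbc).trans
      (le_add_of_nonneg_left (by positivity))

lemma le_gaussMoment {p : ℝ} (hp : 1 ≤ p) :
    ENNReal.ofReal (Real.exp (-Real.pi * 4)) ≤ gaussMoment p := by
  calc ENNReal.ofReal (Real.exp (-Real.pi * 4))
      = ∫⁻ _ in Set.Icc (1 : ℝ) 2, ENNReal.ofReal (Real.exp (-Real.pi * 4)) := by
        rw [setLIntegral_const, Real.volume_Icc]
        norm_num
    _ ≤ ∫⁻ t in Set.Icc (1 : ℝ) 2,
          ENNReal.ofReal (|t| ^ (p - 1)) * ENNReal.ofReal (Real.exp (-Real.pi * t ^ 2)) := by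
        refine setLIntegral_mono' measurableSet_Icc fun t ht ↦ ?_
        rw [← ENNReal.ofReal_mul (by positivity)]
        refine ENNReal.ofReal_le_ofReal ?_
        have h1 : 1 ≤ |t| ^ (p - 1) :=
          Real.one_le_rpow (ht.1.trans (le_abs_self t)) (by linarith)
        have h2 : t ^ 2 ≤ 4 := by nlinarith [ht.1, ht.2]
        calc Real.exp (-Real.pi * 4) ≤ Real.exp (-Real.pi * t ^ 2) :=
              Real.exp_le_exp.2 (by nlinarith [Real.pi_pos])
          _ ≤ _ := le_mul_of_one_le_left (by positivity) h1
    _ ≤ gaussMoment p := setLIntegral_le_lintegral _ _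

/-- The radial integrals `∫ |t|^(q-1) ψ(tθ) dt` depend continuously on the exponent, uniformly in
the direction. -/
lemma RapidDecay.exists_tendsto_norm_integral_sub_le {E : Type*} [NormedAddCommGroup E]
    [NormedSpace ℝ E] {ψ : E → ℂ} (hψ : RapidDecay ψ) (hψc : Continuous ψ) {p : ℝ} (hp : 1 ≤ p)
    {q : ℕ → ℝ} (hpq : ∀ j, p < q j) (hqp : ∀ j, q j ≤ p + 1)
    (hq : Filter.Tendsto q Filter.atTop (nhds p)) :
    ∃ δ : ℕ → ℝ, Filter.Tendsto δ Filter.atTop (nhds 0) ∧ ∀ j, ∀ θ : sphere (0 : E) 1,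
      ‖(∫ t : ℝ, |t| ^ (q j - 1) • ψ (t • (θ : E))) -
        ∫ t : ℝ, |t| ^ (p - 1) • ψ (t • (θ : E))‖ ≤ δ j := by
  obtain ⟨h, hm, hh0, hh, hi⟩ := hψ.exists_integrable_abs_rpow_bound (p + 1)
  have hbound (j : ℕ) (t : ℝ) : |t| ^ (q j - 1) ≤ |t| ^ (p - 1) + |t| ^ (p + 1 - 1) :=
    rpow_le_rpow_add_rpow (abs_nonneg t) (by linarith [hpq j]) (by linarith [hpq j])
      (by linarith [hqp j])
  have hint (r : ℝ) (hr : 0 < r) (hr' : r ≤ p + 1) (θ : sphere (0 : E) 1) :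
      Integrable fun t : ℝ ↦ |t| ^ (r - 1) • ψ (t • (θ : E)) := by
    refine (hi r hr hr').mono' ?_ (ae_of_all _ fun t ↦ ?_)
    · have h1 : Measurable fun t : ℝ ↦ |t| ^ (r - 1) := by fun_prop
      have h2 : Continuous fun t : ℝ ↦ ψ (t • (θ : E)) := by fun_prop
      exact h1.aestronglyMeasurable.smul h2.aestronglyMeasurable
    · rw [norm_smul, Real.norm_of_nonneg (by positivity)]
      gcongr
      simpa using hh t θ
  have hp1 := hi p (by linarith) (by linarith)
  refine ⟨fun j ↦ ∫ t : ℝ, |(|t| ^ (q j - 1) - |t| ^ (p - 1))| * h |t|, ?_, fun j θ ↦ ?_⟩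
  · rw [← integral_zero ℝ ℝ (μ := volume)]
    refine tendsto_integral_of_dominated_convergence
      (fun t ↦ |t| ^ (p - 1) * h |t| + |t| ^ (p + 1 - 1) * h |t|
        + |t| ^ (p - 1) * h |t|) (fun j ↦ Measurable.aestronglyMeasurable (by fun_prop))
      ((hp1.add (hi (p + 1) (by linarith) le_rfl)).add hp1)
      (fun j ↦ ae_of_all _ fun t ↦ ?_) ?_
    · rw [norm_mul, Real.norm_of_nonneg (hh0 _ (abs_nonneg t)), Real.norm_eq_abs, abs_abs,
        ← add_mul, ← add_mul]
      refine mul_le_mul_of_nonneg_right ((abs_sub _ _).trans ?_) (hh0 _ (abs_nonneg t))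
      rw [abs_of_nonneg (Real.rpow_nonneg (abs_nonneg t) _),
        abs_of_nonneg (Real.rpow_nonneg (abs_nonneg t) _)]
      gcongr
      exact hbound j t
    · filter_upwards [Measure.ae_ne volume (0 : ℝ)] with t ht
      have h1 : Filter.Tendsto (fun j ↦ |t| ^ (q j - 1)) Filter.atTop (nhds (|t| ^ (p - 1))) :=
        (Real.continuousAt_const_rpow (abs_pos.2 ht).ne').tendsto.comp (hq.sub_const 1)
      simpa using ((h1.sub_const (|t| ^ (p - 1))).abs).mul_const (h |t|)
  · rw [← integral_sub (hint _ (by linarith [hpq j]) (hqp j) θ)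
      (hint _ (by linarith) (by linarith) θ)]
    refine norm_integral_le_of_norm_le (g := fun t ↦ |(|t| ^ (q j - 1) - |t| ^ (p - 1))| * h |t|)
      ?_ (ae_of_all _ fun t ↦ ?_)
    · refine ((hi (q j) (by linarith [hpq j]) (hqp j)).sub hp1).norm.congr
        (ae_of_all _ fun t ↦ ?_)
      simp only [Pi.sub_apply]
      rw [← sub_mul, norm_mul, Real.norm_of_nonneg (hh0 _ (abs_nonneg t)), Real.norm_eq_abs]
    · rw [← sub_smul, norm_smul, Real.norm_eq_abs]
      gcongr
      simpa using hh t θ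

namespace IsSymmBody

variable {n : ℕ} {K : Set (Euc n)}

lemma tendsto_integral_gauge_rpow_smul (hK : IsSymmBody K) {f : Euc n → ℂ} (hf : RapidDecay f)
    (hfc : Continuous f) {p : ℝ} (hp : 1 ≤ p) (hpn : p + 1 < n)
    {q : ℕ → ℝ} (hpq : ∀ j, p < q j) (hqp : ∀ j, q j ≤ p + 1)
    (hq : Filter.Tendsto q Filter.atTop (nhds p)) :
    Filter.Tendsto (fun j ↦ ∫ x, gauge K x ^ (-q j) • f x) Filter.atTop
      (nhds (∫ x, gauge K x ^ (-p) • f x)) := by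
  have h0 := hK.continuous_gauge
  have hi1 := (hK.integrable_gauge_rpow_smul hf hfc (p := p) (by linarith) (by linarith)).norm
  have hi2 := (hK.integrable_gauge_rpow_smul hf hfc (p := p + 1) (by linarith) hpn).norm
  refine tendsto_integral_of_dominated_convergence _ (fun j ↦ ?_) (hi1.add hi2)
    (fun j ↦ ae_of_all _ fun x ↦ ?_) ?_
  · have h1 : Measurable fun x ↦ gauge K x ^ (-q j) := by fun_prop
    exact h1.aestronglyMeasurable.smul hfc.aestronglyMeasurable
  · simp only [norm_smul, Pi.add_apply]
    rw [← add_mul]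
    gcongr
    simp only [Real.norm_of_nonneg (Real.rpow_nonneg (gauge_nonneg x) _)]
    rw [add_comm]
    exact rpow_le_rpow_add_rpow (gauge_nonneg x) (by linarith [hpq j]) (by linarith [hqp j])
      (by linarith [hpq j])
  · have : Nonempty (Fin n) := Fin.pos_iff_nonempty.1 (Nat.cast_pos.1 (by linarith : (0 : ℝ) < n))
    filter_upwards [Measure.ae_ne volume (0 : Euc n)] with x hx
    exact ((Real.continuousAt_const_rpow (hK.gauge_pos hx).ne').tendsto.comp hq.neg).smul_const
      (f x)

lemma exists_mass_bound (hK : IsSymmBody K) {p : ℝ} (hp : 1 ≤ p) (hpn : p + 1 < n) :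
    ∃ C : NNReal, ∀ q, p < q → q ≤ p + 1 → ∀ m : ℝ≥0∞,
      m * gaussMoment q = ∫⁻ y, ENNReal.ofReal (gauge K y ^ (-q)) *
        ENNReal.ofReal (Real.exp (-Real.pi * ‖y‖ ^ 2)) → m ≤ C := by
  have h0 := hK.continuous_gauge
  have h1 := hK.lintegral_gauge_rpow_mul_gaussian_ne_top (p := p) (by linarith) (by linarith)
  have h2 := hK.lintegral_gauge_rpow_mul_gaussian_ne_top (p := p + 1) (by linarith) hpn
  set c := ENNReal.ofReal (Real.exp (-Real.pi * 4)) with hc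
  have hc0 : c ≠ 0 := (ENNReal.ofReal_pos.2 (Real.exp_pos _)).ne'
  obtain ⟨C, hC⟩ : ∃ C : NNReal, (C : ℝ≥0∞) = _ :=
    ⟨_, ENNReal.coe_toNNReal (ENNReal.div_ne_top (ENNReal.add_ne_top.2 ⟨h1, h2⟩) hc0)⟩
  refine ⟨C, fun q hpq hqp m hm ↦ ?_⟩
  rw [hC, ENNReal.le_div_iff_mul_le (Or.inl hc0) (Or.inl ENNReal.ofReal_ne_top)]
  calc m * c ≤ m * gaussMoment q := by gcongr; exact le_gaussMoment (by linarith)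
    _ ≤ _ := by
      rw [hm, ← lintegral_add_left (by fun_prop)]
      refine lintegral_mono fun y ↦ ?_
      rw [← add_mul, ← ENNReal.ofReal_add (Real.rpow_nonneg (gauge_nonneg _) _)
        (Real.rpow_nonneg (gauge_nonneg _) _)]
      gcongr
      rw [add_comm]
      exact rpow_le_rpow_add_rpow (gauge_nonneg y) (by linarith) (by linarith) (by linarith)

/-- The endpoint case, by weak compactness of bounded sets of measures on the sphere. -/
lemma exists_measure_sphere_endpoint (hK : IsSymmBody K) {p : ℝ} (hp : 1 ≤ p)
    (h3 : (n : ℝ) - 3 ≤ p) (hpn : p + 1 < n) :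
    ∃ μ : Measure (sphere (0 : Euc n) 1), IsFiniteMeasure μ ∧
      ∀ φ : SchwartzMap (Euc n) ℂ, ∫ x, gauge K x ^ (-p) • φ x =
        ∫ θ, (∫ t : ℝ, |t| ^ (p - 1) • 𝓕 (⇑φ) (t • (θ : Euc n))) ∂μ := by
  have hn : n ≠ 0 := by
    rintro rfl
    norm_num at hpn
    linarith
  set q : ℕ → ℝ := fun j ↦ p + 1 / ((j : ℝ) + 2) with hqdef
  have hpq (j : ℕ) : p < q j := lt_add_of_pos_right _ (by positivity)
  have hqp' (j : ℕ) : q j < p + 1 := by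
    have : 1 / ((j : ℝ) + 2) < 1 := by
      rw [div_lt_one (by positivity)]
      linarith [(Nat.cast_nonneg j : (0 : ℝ) ≤ j)]
    simp only [hqdef]
    linarith
  have hqp (j : ℕ) := (hqp' j).le
  have hq : Filter.Tendsto q Filter.atTop (nhds p) := by
    have h1 : Filter.Tendsto (fun j : ℕ ↦ (j : ℝ) + 2) Filter.atTop Filter.atTop :=
      Filter.tendsto_atTop_add_const_right _ _ tendsto_natCast_atTop_atTop
    simpa [hqdef] using h1.inv_tendsto_atTop.const_add p
  choose μ hμf hμ hμm using fun j ↦ hK.exists_measure_sphere (p := q j) hn (by linarith [hpq j])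
    (by linarith [hpq j]) (by linarith [hqp j])
  obtain ⟨C, hC⟩ := hK.exists_mass_bound hp hpn
  have hmass (j : ℕ) : μ j Set.univ ≤ C := hC (q j) (hpq j) (hqp j) _ (hμm j)
  set ν : ℕ → FiniteMeasure (sphere (0 : Euc n) 1) := fun j ↦ ⟨μ j, hμf j⟩ with hν
  set l : Ultrafilter ℕ := Filter.hyperfilter ℕ with hl
  have hlt : (l : Filter ℕ) ≤ Filter.atTop := Nat.hyperfilter_le_atTop
  obtain ⟨ν₀, -, hν₀⟩ := (isCompact_setOfPred_finiteMeasure_le_of_compactSpace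
    (E := sphere (0 : Euc n) 1) C).ultrafilter_le_nhds (l.map ν) (by
      rw [Filter.le_principal_iff]
      refine Filter.mem_map.2 (Filter.Eventually.of_forall fun j ↦ ?_)
      have h1 : ((ν j).mass : ℝ≥0∞) ≤ C := by
        rw [FiniteMeasure.ennreal_mass]
        exact hmass j
      exact_mod_cast h1)
  have hweak := (FiniteMeasure.tendsto_iff_forall_integral_rclike_tendsto ℂ).1
    (show Filter.Tendsto ν l (nhds ν₀) from hν₀)
  refine ⟨ν₀, inferInstance, fun φ ↦ ?_⟩
  set ψ : SchwartzMap (Euc n) ℂ := 𝓕 φ with hψ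
  have hψφ : ⇑ψ = 𝓕 (⇑φ) := SchwartzMap.fourier_coe φ
  rw [← hψφ]
  have hμφ (j : ℕ) := hμ j φ
  simp_rw [← hψφ] at hμφ
  obtain ⟨δ, hδ, hδle⟩ :=
    ψ.rapidDecay.exists_tendsto_norm_integral_sub_le ψ.continuous hp hpq hqp hq
  have hH (r : ℝ) (hr : 0 < r) := ψ.rapidDecay.continuous_integral_abs_rpow_smul ψ.continuous hr
  have hHp := hH p (by linarith)
  have hlim1 := (hK.tendsto_integral_gauge_rpow_smul φ.rapidDecay φ.continuous hp hpn hpq hqp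
    hq).mono_left hlt
  have hlim2 := hweak (BoundedContinuousFunction.mkOfCompact ⟨_, hHp⟩)
  simp only [BoundedContinuousFunction.mkOfCompact_apply, ContinuousMap.coe_mk] at hlim2
  have hlim3 : Filter.Tendsto (fun j ↦
      (∫ θ, (∫ t : ℝ, |t| ^ (q j - 1) • ψ (t • (θ : Euc n))) ∂μ j) -
      ∫ θ, (∫ t : ℝ, |t| ^ (p - 1) • ψ (t • (θ : Euc n))) ∂μ j) l (nhds 0) := by
    refine squeeze_zero_norm (a := fun j ↦ δ j * C) (fun j ↦ ?_) ?_
    · have hmf := hμf j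
      have hint (r : ℝ) (hr : 0 < r) : Integrable (fun θ : sphere (0 : Euc n) 1 ↦
          ∫ t : ℝ, |t| ^ (r - 1) • ψ (t • (θ : Euc n))) (μ j) :=
        (hH r hr).integrable_of_hasCompactSupport (HasCompactSupport.of_compactSpace _)
      rw [← integral_sub (hint _ (by linarith [hpq j])) (hint _ (by linarith))]
      refine (norm_integral_le_of_norm_le_const (ae_of_all _ fun θ ↦ hδle j θ)).trans ?_
      obtain ⟨θ⟩ : Nonempty (sphere (0 : Euc n) 1) := by
        have : Nonempty (Fin n) := Fin.pos_iff_nonempty.1 (Nat.pos_of_ne_zero hn)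
        exact (NormedSpace.sphere_nonempty.2 zero_le_one).to_subtype
      have h1 : 0 ≤ δ j := (norm_nonneg _).trans (hδle j θ)
      gcongr
      exact ENNReal.toReal_le_coe_of_le_coe (hmass j)
    · simpa using (hδ.mono_left hlt).mul_const (C : ℝ)
  refine tendsto_nhds_unique hlim1 ?_
  simp_rw [hμφ]
  have h1 := hlim3.add hlim2
  rw [zero_add] at h1
  exact h1.congr fun j ↦ sub_add_cancel _ _

end IsSymmBody

lemma IsSymmBody.of_convex {n : ℕ} {K : Set (Euc n)} (hconv : Convex ℝ K) (hcomp : IsCompact K)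
    (hint : (interior K).Nonempty) (hsym : K = -K) : IsSymmBody K where
  convex := hconv
  isCompact := hcomp
  neg_mem x hx := by
    rw [hsym]
    simpa using hx
  mem_nhds := by
    obtain ⟨x, hx⟩ := hint
    have h1 : -x ∈ interior K := by
      rw [hsym, ← Set.image_neg_eq_neg]
      exact (Homeomorph.neg (Euc n)).isOpenMap.image_interior_subset K ⟨x, hx, rfl⟩
    have h2 := hconv.interior hx h1 (a := 1 / 2) (b := 1 / 2) (by norm_num) (by norm_num)
      (by norm_num)
    rw [smul_neg, add_neg_cancel] at h2
    exact mem_interior_iff_mem_nhds.1 h2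

/-- **Every origin-symmetric convex body in `ℝⁿ` embeds in `L_{-p}` for `n-3 ≤ p < n`,
`p > 0`.** In particular every `n`-dimensional normed space, `n ≥ 4`, embeds in `L_{-(n-3)}`. -/
theorem convexBody_embeds_Lneg (n : ℕ) (K : Set (Euc n))
    (hconv : Convex ℝ K) (hcomp : IsCompact K) (hint : (interior K).Nonempty)
    (hsym : K = -K) (p : ℝ) (hp : 0 < p) (h1 : (n : ℝ) - 3 ≤ p) (h2 : p < n) :
    EmbedsInLNeg n p (gauge K) := by
  have hK := IsSymmBody.of_convex hconv hcomp hint hsym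
  rcases h1.lt_or_eq with h3 | h3
  · have hn : n ≠ 0 := by
      rintro rfl
      norm_num at h2
      linarith
    obtain ⟨μ, hμ, h, -⟩ := hK.exists_measure_sphere hn hp h3 h2
    exact ⟨μ, hμ, fun φ _ ↦ h φ⟩
  · have hn : 3 < n := by
      have : (3 : ℝ) < n := by linarith
      exact_mod_cast this
    have hn' : (4 : ℝ) ≤ n := by exact_mod_cast hn
    obtain ⟨μ, hμ, h⟩ := hK.exists_measure_sphere_endpoint (p := p) (by linarith) h1 (by linarith)
    exact ⟨μ, hμ, fun φ _ ↦ h φ⟩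

end
end
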